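/- Let g = sl(2,ℂ) with standard basis e, h, f and let g̃ be the affine Lie algebra of type A₁⁽¹⁾. Let k be a positive integer, P = ℂ[f(j), h(j), e(j) : j ≤ −1], and let I_{kΛ₀} be the ideal of P generated by ⋃_{n≤−k−1} U(g)·(Σ_{j₁,…,j_{k+1}≤−1, j₁+⋯+j_{k+1}=n} e(j₁)⋯e(j_{k+1})), where · denotes the adjoint action of g on P. Then, as ℤ-graded vector spaces and g-modules, L(kΛ₀) ≅ P/I_{kΛ₀}. -/

import Mathlib

/-!
STATEMENT 15 (Primc, Theorem 9.1: a presentation of `L(kΛ₀)` for `A₁⁽¹⁾`).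

Let `g = sl(2,ℂ)` with standard basis `e, h, f` and let `g̃` be the affine Lie
algebra of type `A₁⁽¹⁾`.  Let `k` be a positive integer,
`P = ℂ[f(j), h(j), e(j) : j ≤ −1]`, and let `I_{kΛ₀}` be the ideal of `P`
generated by
`⋃_{n≤−k−1} U(g)·(Σ_{j₁,…,j_{k+1}≤−1, j₁+⋯+j_{k+1}=n} e(j₁)⋯e(j_{k+1}))`,
where `·` denotes the adjoint action of `g` on `P`.  Then, as `ℤ`-graded
vector spaces and `g`-modules, `L(kΛ₀) ≅ P/I_{kΛ₀}`.

`P` is modeled as the polynomial ring on variables indexed by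
`{e,h,f} × ℕ`, the pair `(x, m)` corresponding to `x(−(m+1))`; the adjoint
actions of `e, h, f` are the derivations determined by the brackets
`[e,f] = h`, `[h,e] = 2e`, `[h,f] = −2f`.  The grading of `P` gives the
variable `(x, m)` weight `m+1` (that is, degree `−(m+1)`), and the grading of
`L(kΛ₀)` is by the degree operator `d`.  The vacuum module `L(kΛ₀)` is
axiomatized by the structure `SL2VacuumModule`.
-/

open scoped BigOperators

/-- Axiomatization of the vacuum level `k` standard module `L(kΛ₀)` of the
affine Lie algebra `g̃ = sl(2,ℂ) ⊗ ℂ[t,t⁻¹] + ℂc + ℂd` of type `A₁⁽¹⁾`: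
the operators `e(n), h(n), f(n)`, the degree operator `d`, the affine
commutation relations at level `k` (with the normalized form `⟨h,h⟩ = 2`,
`⟨e,f⟩ = 1`), a highest weight vector of weight `kΛ₀`, truncation and
irreducibility. -/
structure SL2VacuumModule (k : ℕ) where
  V : Type
  [addCommGroup : AddCommGroup V]
  [module : Module ℂ V]
  /-- the action of `e(n) = e ⊗ tⁿ` -/
  E : ℤ → Module.End ℂ V
  /-- the action of `h(n) = h ⊗ tⁿ` -/
  Hh : ℤ → Module.End ℂ V
  /-- the action of `f(n) = f ⊗ tⁿ` -/
  F : ℤ → Module.End ℂ V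
  /-- the degree operator `d` -/
  D : Module.End ℂ V
  EE : ∀ m n, Commute (E m) (E n)
  FF : ∀ m n, Commute (F m) (F n)
  HE : ∀ m n, Hh m * E n - E n * Hh m = (2 : ℂ) • E (m + n)
  HF : ∀ m n, Hh m * F n - F n * Hh m = (-2 : ℂ) • F (m + n)
  EF : ∀ m n, E m * F n - F n * E m
    = Hh (m + n) + (if m + n = 0 then ((m * k : ℤ) : ℂ) else 0) • (1 : Module.End ℂ V)
  HH : ∀ m n, Hh m * Hh n - Hh n * Hh m
    = (if m + n = 0 then ((2 * m * k : ℤ) : ℂ) else 0) • (1 : Module.End ℂ V)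
  DE : ∀ n, D * E n - E n * D = (n : ℂ) • E n
  DH : ∀ n, D * Hh n - Hh n * D = (n : ℂ) • Hh n
  DF : ∀ n, D * F n - F n * D = (n : ℂ) • F n
  /-- the highest weight vector `v_{kΛ₀}` -/
  hwv : V
  hwv_ne : hwv ≠ 0
  /-- `e(n)v = h(n)v = f(n)v = 0` for `n ≥ 0` (the weight `kΛ₀` restricts to
  `0` on the Cartan subalgebra of `sl₂`, and `⟨kΛ₀, α₁^∨⟩ = 0`) -/
  hwv_hw : ∀ n : ℤ, 0 ≤ n → E n hwv = 0 ∧ Hh n hwv = 0 ∧ F n hwv = 0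
  hwv_deg : D hwv = 0
  /-- every vector is annihilated by all operators of sufficiently large mode -/
  trunc : ∀ w : V, ∃ N : ℤ, ∀ n, N ≤ n → E n w = 0 ∧ Hh n w = 0 ∧ F n w = 0
  /-- irreducibility -/
  irred : ∀ U : Submodule ℂ V,
    (∀ n, ∀ u ∈ U, E n u ∈ U ∧ Hh n u ∈ U ∧ F n u ∈ U) → U = ⊥ ∨ U = ⊤

attribute [instance] SL2VacuumModule.addCommGroup SL2VacuumModule.module

/-- the standard basis of `sl(2,ℂ)` as an index type -/
inductive SL2Gen : Type
  | e : SL2Gen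
  | h : SL2Gen
  | f : SL2Gen
  deriving DecidableEq

/-- the polynomial algebra `P = ℂ[f(j), h(j), e(j) : j ≤ −1]`;
the variable `(x, m)` is `x(−(m+1))` -/
abbrev PolySL2 : Type := MvPolynomial (SL2Gen × ℕ) ℂ

/-- the adjoint action of `e`: `e(j) ↦ 0`, `h(j) ↦ −2e(j)`, `f(j) ↦ h(j)` -/
noncomputable def adE : Derivation ℂ PolySL2 PolySL2 :=
  MvPolynomial.mkDerivation ℂ (fun p : SL2Gen × ℕ =>
    match p.1 with
    | SL2Gen.e => 0
    | SL2Gen.h => (-2 : ℂ) • MvPolynomial.X (SL2Gen.e, p.2)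
    | SL2Gen.f => MvPolynomial.X (SL2Gen.h, p.2))

/-- the adjoint action of `h`: `e(j) ↦ 2e(j)`, `h(j) ↦ 0`, `f(j) ↦ −2f(j)` -/
noncomputable def adH : Derivation ℂ PolySL2 PolySL2 :=
  MvPolynomial.mkDerivation ℂ (fun p : SL2Gen × ℕ =>
    match p.1 with
    | SL2Gen.e => (2 : ℂ) • MvPolynomial.X (SL2Gen.e, p.2)
    | SL2Gen.h => 0
    | SL2Gen.f => (-2 : ℂ) • MvPolynomial.X (SL2Gen.f, p.2))

/-- the adjoint action of `f`: `e(j) ↦ −h(j)`, `h(j) ↦ 2f(j)`, `f(j) ↦ 0` -/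
noncomputable def adF : Derivation ℂ PolySL2 PolySL2 :=
  MvPolynomial.mkDerivation ℂ (fun p : SL2Gen × ℕ =>
    match p.1 with
    | SL2Gen.e => (-1 : ℂ) • MvPolynomial.X (SL2Gen.h, p.2)
    | SL2Gen.h => (2 : ℂ) • MvPolynomial.X (SL2Gen.f, p.2)
    | SL2Gen.f => 0)

/-- `U(g)·s`: the smallest subspace of `P` containing `s` and stable under the
adjoint action of `g = sl(2,ℂ)` -/
noncomputable def gClosure (s : Set PolySL2) : Submodule ℂ PolySL2 :=
  sInf {U : Submodule ℂ PolySL2 |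
    s ⊆ U ∧ ∀ p ∈ U, adE p ∈ U ∧ adH p ∈ U ∧ adF p ∈ U}

/-- the generator `Σ_{j₁,…,j_{k+1} ≤ −1, j₁+⋯+j_{k+1} = n} e(j₁)⋯e(j_{k+1})`
of degree `n = −(k+1) − d ≤ −k−1` (in the variables `(e, m)`, `jᵢ = −(mᵢ+1)`,
the condition becomes `m₁+⋯+m_{k+1} = d`) -/
noncomputable def eGen (k : ℕ) (d : ℕ) : PolySL2 :=
  ∑ m ∈ (Fintype.piFinset fun _ : Fin (k + 1) => Finset.range (d + 1)) |>.filter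
      (fun m => ∑ i, m i = d),
    ∏ i, MvPolynomial.X (SL2Gen.e, m i)

/-- the ideal `I_{kΛ₀}` generated by
`⋃_{n≤−k−1} U(g)·(Σ_{j₁+⋯+j_{k+1}=n} e(j₁)⋯e(j_{k+1}))` -/
noncomputable def idealSL2 (k : ℕ) : Ideal PolySL2 :=
  Ideal.span (gClosure {p : PolySL2 | ∃ d : ℕ, p = eGen k d} : Set PolySL2)

/-- the weight of the variable `(x, m)`, namely `m + 1` (the polynomial
`x(−(m+1))` has degree `−(m+1)`) -/
def wtVar : SL2Gen × ℕ → ℕ := fun p => p.2 + 1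


namespace PV
set_option linter.unusedSectionVars false
set_option linter.unusedSimpArgs false
set_option linter.unusedVariables false
open Finset

section CAR
variable {B : Type} [LinearOrder B]

abbrev Fk (B : Type) := Finset B →₀ ℂ

noncomputable def ket (S : Finset B) : Fk B := Finsupp.single S 1

def sg (b : B) (S : Finset B) : ℂ := ∏ t ∈ S, (if t < b then (-1 : ℂ) else 1)

theorem sg_insert {b c : B} {S : Finset B} (h : c ∉ S) :
    sg b (insert c S) = (if c < b then (-1 : ℂ) else 1) * sg b S := by
  unfold sg; rw [Finset.prod_insert h]

theorem sg_erase {b c : B} {S : Finset B} (h : c ∈ S) :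
    sg b (S.erase c) = (if c < b then (-1 : ℂ) else 1) * sg b S := by
  unfold sg; rw [← Finset.mul_prod_erase _ _ h]
  split_ifs <;> simp

theorem sg_sq (b : B) (S : Finset B) : sg b S * sg b S = 1 := by
  unfold sg; rw [← Finset.prod_mul_distrib]
  apply Finset.prod_eq_one
  intro t _; split_ifs <;> simp

theorem sg_ne (b : B) (S : Finset B) : sg b S ≠ 0 := by
  intro h; have := sg_sq b S; rw [h] at this; simp at this

theorem sg_conj (b : B) (S : Finset B) : (starRingEnd ℂ) (sg b S) = sg b S := by
  unfold sg; rw [map_prod]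
  apply Finset.prod_congr rfl
  intro t _; split_ifs <;> simp

noncomputable def mkOp (φ : Finset B → Fk B) : Module.End ℂ (Fk B) := Finsupp.linearCombination ℂ φ

theorem mkOp_ket (φ : Finset B → Fk B) (S : Finset B) : mkOp φ (ket S) = φ S := by
  simp [mkOp, ket]

noncomputable def cr (b : B) : Module.End ℂ (Fk B) :=
  mkOp fun S => if b ∈ S then 0 else sg b S • ket (insert b S)
noncomputable def an (b : B) : Module.End ℂ (Fk B) :=
  mkOp fun S => if b ∈ S then sg b S • ket (S.erase b) else 0

theorem cr_ket (b : B) (S) : cr b (ket S) = if b ∈ S then 0 else sg b S • ket (insert b S) := mkOp_ket _ _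
theorem an_ket (b : B) (S) : an b (ket S) = if b ∈ S then sg b S • ket (S.erase b) else 0 := mkOp_ket _ _

theorem end_ext {M : Type*} [AddCommMonoid M] [Module ℂ M] {x y : Fk B →ₗ[ℂ] M} (h : ∀ S, x (ket S) = y (ket S)) : x = y := by
  apply Finsupp.lhom_ext'
  intro S
  apply LinearMap.ext_ring
  exact h S

theorem cr_cr (b c : B) : cr b * cr c + cr c * cr b = 0 := by
  apply end_ext; intro S
  simp only [LinearMap.add_apply, Module.End.mul_apply, cr_ket, LinearMap.zero_apply]
  rcases eq_or_ne b c with rfl | hbc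
  · by_cases hb : b ∈ S <;> simp [hb, cr_ket]
  by_cases hb : b ∈ S <;> by_cases hc : c ∈ S <;>
    simp [hb, hc, cr_ket, hbc, hbc.symm]
  rw [sg_insert hb, sg_insert hc, Finset.insert_comm c b]
  rcases lt_or_gt_of_ne hbc with h | h
  · simp [h, h.not_gt, mul_comm, smul_smul]
  · simp [h, h.not_gt, mul_comm, smul_smul]

theorem an_an (b c : B) : an b * an c + an c * an b = 0 := by
  apply end_ext; intro S
  simp only [LinearMap.add_apply, Module.End.mul_apply, an_ket, LinearMap.zero_apply]
  rcases eq_or_ne b c with rfl | hbc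
  · by_cases hb : b ∈ S <;> simp [hb, an_ket]
  by_cases hb : b ∈ S <;> by_cases hc : c ∈ S <;>
    simp [hb, hc, an_ket, hbc, hbc.symm]
  rw [sg_erase hb, sg_erase hc, Finset.erase_right_comm]
  rcases lt_or_gt_of_ne hbc with h | h
  · simp [h, h.not_gt, mul_comm, smul_smul]
  · simp [h, h.not_gt, mul_comm, smul_smul]

theorem cr_an (b c : B) : cr b * an c + an c * cr b = if b = c then 1 else 0 := by
  apply end_ext; intro S
  simp only [LinearMap.add_apply, Module.End.mul_apply, an_ket, cr_ket]
  rcases eq_or_ne b c with rfl | hbc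
  · by_cases hb : b ∈ S
    · simp [hb, cr_ket, smul_smul, sg_erase hb, sg_sq]
    · simp [hb, an_ket, smul_smul, sg_insert hb, sg_sq]
  by_cases hb : b ∈ S <;> by_cases hc : c ∈ S <;>
    simp [hb, hc, an_ket, cr_ket, hbc, hbc.symm]
  rw [sg_erase hc, sg_insert hb]
  rw [Finset.erase_insert_of_ne hbc]
  rcases lt_or_gt_of_ne hbc with h | h
  · simp [h, h.not_gt, mul_comm, smul_smul]
  · simp [h, h.not_gt, mul_comm, smul_smul]

/-- hermitian form -/
noncomputable def Hf (x y : Fk B) : ℂ := Finsupp.linearCombination ℂ (fun S => (starRingEnd ℂ) (x S)) y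

theorem Hf_eq (x y : Fk B) (T : Finset (Finset B)) (h : y.support ⊆ T) :
    Hf x y = ∑ S ∈ T, y S * (starRingEnd ℂ) (x S) := by
  unfold Hf
  rw [Finsupp.linearCombination_apply, Finsupp.sum_of_support_subset _ h]
  · simp
  · simp

theorem Hf_conj (x y : Fk B) : (starRingEnd ℂ) (Hf x y) = Hf y x := by
  rw [Hf_eq x y (x.support ∪ y.support) Finset.subset_union_right,
    Hf_eq y x (x.support ∪ y.support) Finset.subset_union_left, map_sum]
  apply Finset.sum_congr rfl; intro S _; simp [mul_comm]

theorem Hf_add_right (x y z : Fk B) : Hf x (y + z) = Hf x y + Hf x z := by simp [Hf]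
theorem Hf_smul_right (x y : Fk B) (c : ℂ) : Hf x (c • y) = c * Hf x y := by simp [Hf]
theorem Hf_neg_right (x y : Fk B)  : Hf x (-y) = -Hf x y := by simp [Hf]
theorem Hf_zero_right (x : Fk B) : Hf x 0 = 0 := by simp [Hf]
theorem Hf_sum_right {ι : Type*} (T : Finset ι) (x : Fk B) (y : ι → Fk B) : Hf x (∑ i ∈ T, y i) = ∑ i ∈ T, Hf x (y i) := by simp [Hf]
theorem Hf_add_left (x y z : Fk B) : Hf (x + y) z = Hf x z + Hf y z := by
  rw [← Hf_conj, Hf_add_right, map_add, Hf_conj, Hf_conj]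
theorem Hf_smul_left (x y : Fk B) (c : ℂ) : Hf (c • x) y = (starRingEnd ℂ) c * Hf x y := by
  rw [← Hf_conj, Hf_smul_right, map_mul, Hf_conj]
theorem Hf_neg_left (x y : Fk B) : Hf (-x) y = - Hf x y := by
  rw [← Hf_conj, Hf_neg_right, map_neg, Hf_conj]
theorem Hf_zero_left (x : Fk B) : Hf 0 x = 0 := by
  rw [← Hf_conj, Hf_zero_right, map_zero]
theorem Hf_sum_left {ι : Type*} (T : Finset ι) (x : Fk B) (y : ι → Fk B) : Hf (∑ i ∈ T, y i) x = ∑ i ∈ T, Hf (y i) x := by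
  rw [← Hf_conj, Hf_sum_right, map_sum]; simp [Hf_conj]
theorem Hf_ket_left (S : Finset B) (y : Fk B) : Hf (ket S) y = y S := by
  rw [Hf_eq _ y (insert S y.support) (Finset.subset_insert _ _)]
  rw [Finset.sum_eq_single S]
  · simp [ket]
  · intro T _ hT; simp [ket, Finsupp.single_apply, hT.symm]
  · simp
theorem Hf_self (x : Fk B) : Hf x x = ((∑ S ∈ x.support, ‖x S‖^2 : ℝ) : ℂ) := by
  rw [Hf_eq x x _ subset_rfl]
  push_cast
  apply Finset.sum_congr rfl; intro S _
  rw [Complex.mul_conj, Complex.normSq_eq_norm_sq]; push_cast; rfl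
theorem Hf_self_eq_zero {x : Fk B} (h : Hf x x = 0) : x = 0 := by
  rw [Hf_self] at h
  norm_cast at h
  rw [Finset.sum_eq_zero_iff_of_nonneg (fun _ _ => by positivity)] at h
  ext S
  by_cases hS : S ∈ x.support
  · simpa using h S hS
  · simpa using hS

theorem adj_of_ket {A A' : Module.End ℂ (Fk B)}
    (h : ∀ S T, (A (ket T)) S = (starRingEnd ℂ) ((A' (ket S)) T)) (x y : Fk B) :
    Hf x (A y) = Hf (A' x) y := by
  induction y using Finsupp.induction_linear with
  | zero => simp [Hf_zero_right]
  | add y z hy hz => rw [map_add, Hf_add_right, Hf_add_right, hy, hz]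
  | single T c =>
    have : (Finsupp.single T c : Fk B) = c • ket T := by simp [ket]
    rw [this, map_smul, Hf_smul_right, Hf_smul_right]; congr 1
    induction x using Finsupp.induction_linear with
    | zero => simp [Hf_zero_left]
    | add y z hy hz => rw [map_add, Hf_add_left, Hf_add_left, hy, hz]
    | single S c =>
      have : (Finsupp.single S c : Fk B) = c • ket S := by simp [ket]
      rw [this, map_smul, Hf_smul_left, Hf_smul_left]; congr 1
      rw [Hf_ket_left, ← Hf_conj, Hf_ket_left, h]

theorem ket_apply (S T : Finset B) : (ket S) T = if S = T then (1:ℂ) else 0 := by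
  simp [ket, Finsupp.single_apply]

theorem adj_cr (b : B) (x y : Fk B) : Hf x (cr b y) = Hf (an b x) y := by
  apply adj_of_ket
  intro S T
  rw [cr_ket, an_ket]
  by_cases hT : b ∈ T <;> by_cases hS : b ∈ S <;> simp only [hT, hS, if_true, if_false]
  · have : S.erase b ≠ T := by rintro rfl; simp at hT
    simp [ket_apply, this]
  · simp
  · simp only [Finsupp.smul_apply, ket_apply, smul_eq_mul, map_mul, sg_conj]
    by_cases h : insert b T = S
    · subst h
      simp [hT, sg_insert hT]
    · have : ¬ S.erase b = T := by rintro rfl; exact h (Finset.insert_erase hS)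
      simp [h, this]
  · have : insert b T ≠ S := by rintro rfl; simp at hS
    simp [ket_apply, this]

theorem adj_an (b : B) (x y : Fk B) : Hf x (an b y) = Hf (cr b x) y := by
  rw [← Hf_conj, ← adj_cr, Hf_conj]

/-- Schur lemma -/
theorem scalar_of_commute (Z : Module.End ℂ (Fk B)) (h1 : ∀ b, Commute Z (cr b)) (h2 : ∀ b, Commute Z (an b)) :
    Z = (Z (ket ∅) ∅) • (1 : Module.End ℂ (Fk B)) := by
  have hv : Z (ket ∅) = (Z (ket ∅) ∅) • ket ∅ := by
    ext S
    rcases S.eq_empty_or_nonempty with rfl | ⟨b, hb⟩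
    · simp [ket]
    · have h3 : an b (Z (ket ∅)) = 0 := by
        rw [← Module.End.mul_apply, ← (h2 b).eq, Module.End.mul_apply, an_ket]; simp
      have h4 : Hf (ket (S.erase b)) (an b (Z (ket ∅))) = 0 := by rw [h3, Hf_zero_right]
      rw [adj_an, cr_ket, if_neg (by simp), Finset.insert_erase hb, Hf_smul_left, Hf_ket_left] at h4
      have : Z (ket ∅) S = 0 := by simpa [sg_ne] using h4
      have hne : (∅ : Finset B) ≠ S := by rintro rfl; simp at hb
      rw [this]; simp [ket_apply, hne]
  apply end_ext; intro S
  induction S using Finset.induction_on with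
  | empty => simpa using hv
  | insert b S hb ih =>
    have : ket (insert b S) = sg b S • cr b (ket S) := by
      rw [cr_ket, if_neg hb, smul_smul, sg_sq, one_smul]
    rw [this, map_smul, ← Module.End.mul_apply, (h1 b).eq, Module.End.mul_apply, ih]
    simp [smul_smul, mul_comm]
end CAR
end PV

namespace PV
set_option linter.unusedSectionVars false
set_option linter.unusedSimpArgs false
set_option linter.unusedVariables false
open Finset

section Gen
variable {R : Type*} [Ring R] [Algebra ℂ R]
theorem gl_smul (a u w : R) (c : ℂ) (h : a * u - u * a = w) : a * (c • u) - (c • u) * a = c • w := by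
  subst h; rw [mul_smul_comm, smul_mul_assoc, smul_sub]
theorem gl_smul' (a u w : R) (c : ℂ) (h : a * u - u * a = w) : (c • a) * u - u * (c • a) = c • w := by
  subst h; rw [mul_smul_comm, smul_mul_assoc, smul_sub]
theorem gl_t1 (b c d e : R) (h1 : b * c + c * b = 0) (h2 : c * d + d * c = e) :
    (b * d) * c - c * (b * d) = b * e := by
  subst h2
  have : c * (b * d) = - (b * c * d) := by
    rw [← mul_assoc, eq_neg_of_add_eq_zero_right h1]; simp
  rw [this]; noncomm_ring
theorem gl_t2 (b c d e : R) (h1 : b * c + c * b = 0) (h2 : c * d + d * c = e) :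
    (- (d * b)) * c - c * (- (d * b)) = e * b := by
  subst h2
  have : d * b * c = - (d * (c * b)) := by
    rw [mul_assoc, eq_neg_of_add_eq_zero_left h1]; simp
  rw [neg_mul, this]; noncomm_ring
theorem gl_t3 (b c d e : R) (h1 : d * c + c * d = 0) (h2 : b * c + c * b = e) :
    (b * d) * c - c * (b * d) = - (e * d) := by
  subst h2
  have : b * d * c = - (b * c * d) := by
    rw [mul_assoc, eq_neg_of_add_eq_zero_left h1]; simp [mul_assoc]
  rw [this]; noncomm_ring
theorem gl_t4 (b c d e : R) (h1 : d * c + c * d = 0) (h2 : b * c + c * b = e) :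
    (- (d * b)) * c - c * (- (d * b)) = - (d * e) := by
  subst h2
  have : c * (-(d * b)) = d * c * b := by
    rw [eq_neg_of_add_eq_zero_left h1]; simp [mul_assoc]
  rw [this]; noncomm_ring
theorem gl_neg (a b : R) (h : a + b = 0) : a = -b := eq_neg_of_add_eq_zero_left h
theorem gl_half (a : R) (h : a + a = 0) : a = 0 := by
  rw [← two_smul ℂ] at h; simpa using h
theorem gl_fin (a b u w g: R) (h : (a * b - b * a) * u - u * (a * b - b * a) = w) (h' : g * u - u * g = w) :
    (a * b - b * a - g) * u = u * (a * b - b * a - g) := by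
  rw [← sub_eq_zero]; rw [← sub_eq_zero.2 (h.trans h'.symm)]; noncomm_ring
theorem gl_subsmul (a b c : ℂ) (u : R) (h : a = b - c) : b • u - c • u = a • u := by subst h; rw [sub_smul]
theorem gl_last (a b g : R) (h : a - g = b) : a = g + b := by subst h; abel
theorem jac (a b u a1 b1 ab1 ba1: R) (h1 : a * u - u * a = a1) (h2 : b * u - u * b = b1)
   (h3 : a * b1 - b1 * a = ab1) (h4 : b * a1 - a1 * b = ba1) :
   (a * b - b * a) * u - u * (a * b - b * a) = ab1 - ba1 := by
  subst h1 h2 h3 h4; noncomm_ring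
end Gen

section Ferm
variable {k : ℕ}

abbrev BB (k : ℕ) := ℤ ×ₗ Fin k
def bb (c : ℤ × Fin k) : BB k := toLex c

theorem bb_inj {c d : ℤ × Fin k} : bb c = bb d ↔ c = d := by simp [bb]

noncomputable def vac : Fk (BB k) := ket ∅

noncomputable def u (c : ℤ × Fin k) : Module.End ℂ (Fk (BB k)) := if 0 ≤ c.1 then cr (bb c) else an (bb c)
noncomputable def us (c : ℤ × Fin k) : Module.End ℂ (Fk (BB k)) := if 0 ≤ c.1 then an (bb c) else cr (bb c)

theorem u_u (c d : ℤ × Fin k) : u c * u d + u d * u c = 0 := by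
  unfold u; split_ifs with h1 h2 h2
  · exact cr_cr _ _
  · rw [cr_an, if_neg]; rw [bb_inj]; rintro rfl; exact h2 h1
  · rw [add_comm, cr_an, if_neg]; rw [bb_inj]; rintro rfl; exact h1 h2
  · exact an_an _ _
theorem us_us (c d : ℤ × Fin k) : us c * us d + us d * us c = 0 := by
  unfold us; split_ifs with h1 h2 h2
  · exact an_an _ _
  · rw [add_comm, cr_an, if_neg]; rw [bb_inj]; rintro rfl; exact h2 h1
  · rw [cr_an, if_neg]; rw [bb_inj]; rintro rfl; exact h1 h2
  · exact cr_cr _ _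
theorem u_us (c d : ℤ × Fin k) : u c * us d + us d * u c = if c = d then 1 else 0 := by
  by_cases hcd : c = d
  · subst hcd; rw [if_pos rfl]; unfold u us
    split_ifs
    · rw [cr_an, if_pos rfl]
    · rw [add_comm, cr_an, if_pos rfl]
  · rw [if_neg hcd]; unfold u us
    split_ifs
    · rw [cr_an, if_neg (mt bb_inj.1 hcd)]
    · exact cr_cr _ _
    · exact an_an _ _
    · rw [add_comm, cr_an, if_neg (fun h => hcd (bb_inj.1 h).symm)]

theorem u_sq (c : ℤ × Fin k) : u c * u c = 0 := by
  exact gl_half (R := Module.End ℂ (Fk (BB k))) _ (u_u c c)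

def sh (r : ℤ) (c : ℤ × Fin k) : ℤ × Fin k := (c.1 + r, c.2)

theorem sh_eq {r : ℤ} {c d : ℤ × Fin k} : sh r c = d ↔ c = sh (-r) d := by
  unfold sh; constructor
  · rintro rfl; ext <;> simp
  · rintro rfl; ext <;> simp

noncomputable def term (r : ℤ) (χ : ℤ → ℂ) (b : ℤ × Fin k) : Module.End ℂ (Fk (BB k)) :=
  χ b.1 • (if 0 ≤ b.1 then u b * us (sh r b) else - (us (sh r b) * u b))

theorem term_fin_ket (r : ℤ) (χ : ℤ → ℂ) (S : Finset (BB k)) :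
    ∃ T0 : Finset (ℤ × Fin k), ∀ b, b ∉ T0 → term r χ b (ket S) = 0 := by
  refine ⟨S.image ofLex ∪ S.image (fun x => sh (-r) (ofLex x)) ∪ (Finset.Ico 0 (-r) ×ˢ Finset.univ), ?_⟩
  intro b hb
  simp only [Finset.mem_union, not_or] at hb
  obtain ⟨⟨h1, h2⟩, h3⟩ := hb
  have h1' : bb b ∉ S := fun h => h1 (Finset.mem_image.2 ⟨_, h, rfl⟩)
  have h2' : bb (sh r b) ∉ S := fun h => h2 (Finset.mem_image.2 ⟨_, h, by simp [bb, sh]⟩)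
  have h3' : 0 ≤ b.1 → 0 ≤ b.1 + r := by
    intro h0; by_contra hc
    apply h3; simp; omega
  unfold term
  split_ifs with h
  · have : us (sh r b) (ket S) = 0 := by
      unfold us; rw [if_pos (show 0 ≤ (sh r b).1 from h3' h), an_ket, if_neg h2']
    simp [this]
  · have : u b (ket S) = 0 := by
      unfold u; rw [if_neg h, an_ket, if_neg h1']
    simp [this]

theorem term_fin (r : ℤ) (χ : ℤ → ℂ) (v : Fk (BB k)) :
    ∃ T0 : Finset (ℤ × Fin k), ∀ b, b ∉ T0 → term r χ b v = 0 := by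
  induction v using Finsupp.induction_linear with
  | zero => exact ⟨∅, by simp⟩
  | add x y hx hy =>
    obtain ⟨A, hA⟩ := hx
    obtain ⟨C, hC⟩ := hy
    refine ⟨A ∪ C, fun b hb => ?_⟩
    simp only [Finset.mem_union, not_or] at hb
    rw [map_add, hA b hb.1, hC b hb.2, add_zero]
  | single S c =>
    obtain ⟨A, hA⟩ := term_fin_ket r χ S
    refine ⟨A, fun b hb => ?_⟩
    have : (Finsupp.single S c : Fk (BB k)) = c • ket S := by simp [ket]
    rw [this, map_smul, hA b hb, smul_zero]

noncomputable def G (r : ℤ) (χ : ℤ → ℂ) : Module.End ℂ (Fk (BB k)) :=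
  mkOp fun S => ∑ᶠ b, term r χ b (ket S)

theorem G_ev (r : ℤ) (χ : ℤ → ℂ) (v : Fk (BB k)) :
    ∃ T0 : Finset (ℤ × Fin k), ∀ T, T0 ⊆ T → G r χ v = ∑ b ∈ T, term r χ b v := by
  induction v using Finsupp.induction_linear with
  | zero => exact ⟨∅, by simp⟩
  | add x y hx hy =>
    obtain ⟨A, hA⟩ := hx
    obtain ⟨C, hC⟩ := hy
    refine ⟨A ∪ C, fun T hT => ?_⟩
    rw [map_add, hA T (Finset.union_subset_left hT), hC T (Finset.union_subset_right hT), ← Finset.sum_add_distrib]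
    simp
  | single S c =>
    obtain ⟨A, hA⟩ := term_fin_ket r χ S
    refine ⟨A, fun T hT => ?_⟩
    have : (Finsupp.single S c : Fk (BB k)) = c • ket S := by simp [ket]
    rw [this, map_smul]
    simp only [map_smul]
    rw [← Finset.smul_sum]
    congr 1
    rw [G, mkOp_ket]
    apply finsum_eq_sum_of_support_subset
    intro b hb
    by_contra hc
    exact hb (hA b (fun h => hc (hT h)))

theorem G_of_fin {r : ℤ} {χ : ℤ → ℂ} {v : Fk (BB k)} (T0 : Finset (ℤ × Fin k))
    (h : ∀ b, b ∉ T0 → term r χ b v = 0) : G r χ v = ∑ b ∈ T0, term r χ b v := by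
  obtain ⟨T, hT⟩ := G_ev r χ v
  rw [hT (T ∪ T0) Finset.subset_union_left]
  symm
  apply Finset.sum_subset Finset.subset_union_right
  intro b _ hb; exact h b hb

theorem term_u (r : ℤ) (χ : ℤ → ℂ) (b c : ℤ × Fin k) :
    term r χ b * u c - u c * term r χ b = if b = sh (-r) c then χ b.1 • u b else 0 := by
  have h1 := u_u b c
  have h2 := u_us c (sh r b)
  have e : (if b = sh (-r) c then χ b.1 • u b else 0) = χ b.1 • (if c = sh r b then u b else 0) := by
    have : b = sh (-r) c ↔ c = sh r b := by rw [eq_comm (a := c), sh_eq]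
    simp only [this]; split_ifs <;> simp
  rw [e]
  have h3 : (if c = sh r b then u b else 0) = u b * (if c = sh r b then 1 else 0) := by
    split_ifs <;> simp
  have h4 : (if c = sh r b then u b else 0) = (if c = sh r b then 1 else 0) * u b := by
    split_ifs <;> simp
  unfold term
  refine gl_smul' (R := Module.End ℂ (Fk (BB k))) _ _ _ _ ?_
  by_cases h5 : 0 ≤ b.1
  · rw [if_pos h5, h3]
    exact gl_t1 (R := Module.End ℂ (Fk (BB k))) _ _ _ _ h1 h2
  · rw [if_neg h5, h4]
    exact gl_t2 (R := Module.End ℂ (Fk (BB k))) _ _ _ _ h1 h2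

theorem term_us (r : ℤ) (χ : ℤ → ℂ) (b c : ℤ × Fin k) :
    term r χ b * us c - us c * term r χ b = if b = c then - (χ b.1 • us (sh r b)) else 0 := by
  have h1 := us_us (sh r b) c
  have h2 := u_us b c
  have e : (if b = c then - (χ b.1 • us (sh r b)) else 0) = χ b.1 • (if b = c then - us (sh r b) else 0) := by
    by_cases h : b = c
    · rw [if_pos h, if_pos h]; exact (smul_neg (χ b.1) (us (sh r b))).symm
    · rw [if_neg h, if_neg h]; exact (smul_zero (A := Module.End ℂ (Fk (BB k))) _).symm
  rw [e]
  have h3 : (if b = c then - us (sh r b) else 0) = - ((if b = c then 1 else 0) * us (sh r b)) := by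
    split_ifs
    · simp
    · rw [zero_mul]; exact (neg_zero (G := Module.End ℂ (Fk (BB k)))).symm
  have h4 : (if b = c then - us (sh r b) else 0) = - (us (sh r b) * (if b = c then 1 else 0)) := by
    split_ifs
    · simp
    · rw [mul_zero]; exact (neg_zero (G := Module.End ℂ (Fk (BB k)))).symm
  unfold term
  refine gl_smul' (R := Module.End ℂ (Fk (BB k))) _ _ _ _ ?_
  by_cases h5 : 0 ≤ b.1
  · rw [if_pos h5, h3]
    exact gl_t3 (R := Module.End ℂ (Fk (BB k))) _ _ _ _ h1 h2
  · rw [if_neg h5, h4]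
    exact gl_t4 (R := Module.End ℂ (Fk (BB k))) _ _ _ _ h1 h2

theorem G_comm_aux (r : ℤ) (χ : ℤ → ℂ) (Z : Module.End ℂ (Fk (BB k))) (c : ℤ × Fin k) (W : Module.End ℂ (Fk (BB k)))
    (h : ∀ b, term r χ b * Z - Z * term r χ b = if b = c then W else 0) :
    G r χ * Z - Z * G r χ = W := by
  refine LinearMap.ext fun v => ?_
  obtain ⟨A, hA⟩ := G_ev r χ v
  obtain ⟨C, hC⟩ := G_ev r χ (Z v)
  rw [LinearMap.sub_apply, Module.End.mul_apply, Module.End.mul_apply,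
    hA (A ∪ C ∪ {c}) (by intro x; simp +contextual), hC (A ∪ C ∪ {c}) (by intro x; simp +contextual),
    map_sum, ← Finset.sum_sub_distrib]
  have : ∀ b, term r χ b (Z v) - Z (term r χ b v) = if b = c then W v else 0 := by
    intro b
    have := LinearMap.congr_fun (h b) v
    rw [LinearMap.sub_apply, Module.End.mul_apply, Module.End.mul_apply] at this
    rw [this]; split_ifs <;> rfl
  simp only [this]
  rw [Finset.sum_ite_eq', if_pos (by simp)]

theorem G_u (r : ℤ) (χ : ℤ → ℂ) (c : ℤ × Fin k) :
    G r χ * u c - u c * G r χ = χ (c.1 - r) • u (sh (-r) c) := by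
  apply G_comm_aux r χ _ (sh (-r) c)
  intro b; rw [term_u]
  split_ifs with h
  · subst h; rfl
  · rfl

theorem G_us (r : ℤ) (χ : ℤ → ℂ) (c : ℤ × Fin k) :
    G r χ * us c - us c * G r χ = - χ c.1 • us (sh r c) := by
  apply G_comm_aux r χ _ c
  intro b; rw [term_us]
  split_ifs with h
  · subst h; exact (neg_smul (M := Module.End ℂ (Fk (BB k))) (χ b.1) (us (sh r b))).symm
  · rfl

theorem adj_u (c : ℤ × Fin k) (x y : Fk (BB k)) : Hf x (u c y) = Hf (us c x) y := by
  unfold u us; split_ifs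
  · exact adj_cr _ _ _
  · exact adj_an _ _ _
theorem adj_us (c : ℤ × Fin k) (x y : Fk (BB k)) : Hf x (us c y) = Hf (u c x) y := by
  unfold u us; split_ifs
  · exact adj_an _ _ _
  · exact adj_cr _ _ _

theorem adj_term (r : ℤ) (χ : ℤ → ℂ) (b : ℤ × Fin k) (x y : Fk (BB k)) :
    Hf x (term r χ b y) = Hf (term (-r) (fun p => (starRingEnd ℂ) (χ (p - r))) (sh r b) x) y := by
  unfold term
  have e : sh (-r) (sh r b) = b := by ext <;> simp [sh]
  simp only [LinearMap.smul_apply, Hf_smul_right, Hf_smul_left, e]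
  congr 1
  · simp [sh]
  have h2 := u_us (sh r b) b
  have key : (if 0 ≤ (sh r b).1 then u (sh r b) * us b else -(us b * u (sh r b)))
     = if 0 ≤ b.1 then u (sh r b) * us b else -(us b * u (sh r b)) := by
    by_cases hr : r = 0
    · subst hr
      have : sh 0 b = b := by ext <;> simp [sh]
      rw [this]
    · rw [if_neg] at h2
      · rw [gl_neg (R := Module.End ℂ (Fk (BB k))) _ _ h2]; simp
      · intro h; apply hr; have := congrArg Prod.fst h; simpa [sh] using this
  rw [key]
  split_ifs
  · simp only [Module.End.mul_apply, adj_u, adj_us]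
  · simp only [LinearMap.neg_apply, Hf_neg_right, Hf_neg_left, Module.End.mul_apply, adj_u, adj_us]

theorem adj_G (r : ℤ) (χ : ℤ → ℂ) (x y : Fk (BB k)) :
    Hf x (G r χ y) = Hf (G (-r) (fun p => (starRingEnd ℂ) (χ (p - r))) x) y := by
  obtain ⟨A, hA⟩ := G_ev r χ y
  obtain ⟨C, hC⟩ := G_ev (-r) (fun p => (starRingEnd ℂ) (χ (p - r))) x
  rw [hA (A ∪ C.image (sh (-r))) Finset.subset_union_left]
  have hinj : Function.Injective (sh r : ℤ × Fin k → _) := by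
    intro a b h; rw [sh_eq] at h; rw [h]; ext <;> simp [sh]
  rw [hC ((A ∪ C.image (sh (-r))).image (sh r))]
  · rw [Hf_sum_right, Hf_sum_left, Finset.sum_image hinj.injOn]
    apply Finset.sum_congr rfl
    intro b _; exact adj_term r χ b x y
  · intro c hc
    refine Finset.mem_image.2 ⟨sh (-r) c, Finset.mem_union_right _ (Finset.mem_image_of_mem _ hc), ?_⟩
    ext <;> simp [sh]

theorem an_vac (b : BB k) : an b vac = 0 := by rw [vac, an_ket]; simp
theorem us_vac {c : ℤ × Fin k} (h : 0 ≤ c.1) : us c vac = 0 := by unfold us; rw [if_pos h, an_vac]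
theorem u_vac {c : ℤ × Fin k} (h : ¬ 0 ≤ c.1) : u c vac = 0 := by unfold u; rw [if_neg h, an_vac]

theorem term_vac {r : ℤ} {χ : ℤ → ℂ} {b : ℤ × Fin k} (h : ¬ (0 ≤ b.1 ∧ b.1 < -r)) :
    term r χ b vac = 0 := by
  unfold term
  split_ifs with h1
  · have : us (sh r b) vac = 0 := us_vac (by simp [sh]; omega)
    simp [this]
  · simp [u_vac h1]

theorem G_vac {r : ℤ} (h : 0 ≤ r) (χ : ℤ → ℂ) : G r χ (vac : Fk (BB k)) = 0 := by
  rw [G_of_fin ∅]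
  · simp
  · intro b _; exact term_vac (by omega)

theorem G_emp {r : ℤ} (h : r ≤ 0) (χ : ℤ → ℂ) (y : Fk (BB k)) : G r χ y ∅ = 0 := by
  have h1 := adj_G r χ vac y
  rw [G_vac (by omega), Hf_zero_left, vac, Hf_ket_left] at h1
  exact h1

theorem u_emp {c : ℤ × Fin k} (h : 0 ≤ c.1) (y : Fk (BB k)) : u c y ∅ = 0 := by
  have h1 := adj_u c vac y
  rw [us_vac h, Hf_zero_left, vac, Hf_ket_left] at h1
  exact h1
theorem us_emp {c : ℤ × Fin k} (h : ¬ 0 ≤ c.1) (y : Fk (BB k)) : us c y ∅ = 0 := by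
  have h1 := adj_us c vac y
  rw [u_vac h, Hf_zero_left, vac, Hf_ket_left] at h1
  exact h1

theorem lam (r r' : ℤ) (χ χ' : ℤ → ℂ) :
    (G r χ (G r' χ' (vac : Fk (BB k)))) ∅
      = if 0 < r ∧ r' = -r then k * ∑ p ∈ Finset.Ico 0 r, χ' p * χ (p - r) else 0 := by
  by_cases hr : r ≤ 0
  · rw [G_emp hr, if_neg]; omega
  by_cases hr' : 0 ≤ r'
  · rw [G_vac hr', if_neg]; simp
    omega
  have e1 : G r' χ' (vac : Fk (BB k)) = ∑ b ∈ Finset.Ico 0 (-r') ×ˢ Finset.univ, term r' χ' b vac := by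
    apply G_of_fin
    intro b hb; apply term_vac
    simpa using hb
  rw [e1, map_sum, Finsupp.finsetSum_apply]
  have e2 : ∀ b ∈ Finset.Ico 0 (-r') ×ˢ (Finset.univ : Finset (Fin k)), (G r χ (term r' χ' b vac)) ∅
      = if r' = -r then χ' b.1 * χ (b.1 - r) else 0 := by
    rintro ⟨b, i⟩ hb
    simp only [Finset.mem_product, Finset.mem_Ico, Finset.mem_univ, and_true] at hb
    have h1 := LinearMap.congr_fun (G_u r χ (b, i)) (us (sh r' (b,i)) vac)
    simp only [LinearMap.sub_apply, Module.End.mul_apply, LinearMap.smul_apply] at h1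
    unfold term
    rw [if_pos hb.1, LinearMap.smul_apply, map_smul, Module.End.mul_apply, eq_add_of_sub_eq h1]
    have h2 := LinearMap.congr_fun (u_us (sh (-r) (b,i)) (sh r' (b,i))) vac
    simp only [LinearMap.add_apply, Module.End.mul_apply] at h2
    rw [eq_sub_of_add_eq h2]
    have h3 : (sh (-r) (b,i) = sh r' (b,i)) ↔ r' = -r := by
      simp only [sh, Prod.mk.injEq, and_true]; constructor <;> intro h <;> omega
    simp only [h3, Finsupp.smul_apply, Finsupp.add_apply, Finsupp.sub_apply]
    rw [u_emp hb.1, us_emp (by simp [sh]; omega)]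
    split_ifs <;> simp [vac, ket]
  rw [Finset.sum_congr rfl e2]
  split_ifs with h1 h2 h2
  · subst h1
    rw [Finset.sum_product]
    simp [Finset.mul_sum]
  · exfalso; omega
  · exfalso; omega
  · simp

theorem G_G (r r' : ℤ) (χ χ' : ℤ → ℂ) :
    (G r χ * G r' χ' - G r' χ' * G r χ : Module.End ℂ (Fk (BB k))) =
     G (r + r') (fun p => χ p * χ' (p + r) - χ' p * χ (p + r'))
     + ((G r χ (G r' χ' (vac : Fk (BB k)))) ∅ - (G r' χ' (G r χ (vac : Fk (BB k)))) ∅) • 1 := by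
  set ψ : ℤ → ℂ := (fun p => χ p * χ' (p + r) - χ' p * χ (p + r')) with hψ
  set Z : Module.End ℂ (Fk (BB k)) := G r χ * G r' χ' - G r' χ' * G r χ - G (r + r') ψ with hZ
  have hu : ∀ c, Commute Z (u c) := by
    intro c
    have h1 := G_u r χ c
    have h2 := G_u r' χ' c
    have h3 : G r χ * (χ' (c.1 - r') • u (sh (-r') c)) - (χ' (c.1 - r') • u (sh (-r') c)) * G r χ =
        (χ' (c.1 - r') * χ (c.1 - r' - r)) • u (sh (-(r + r')) c) := by
      rw [gl_smul (R := Module.End ℂ (Fk (BB k))) _ _ _ _ (G_u _ _ _), smul_smul]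
      congr 2
      ext <;> simp [sh]; ring
    have h4 : G r' χ' * (χ (c.1 - r) • u (sh (-r) c)) - (χ (c.1 - r) • u (sh (-r) c)) * G r' χ' =
        (χ (c.1 - r) * χ' (c.1 - r - r')) • u (sh (-(r + r')) c) := by
      rw [gl_smul (R := Module.End ℂ (Fk (BB k))) _ _ _ _ (G_u _ _ _), smul_smul]
      congr 2
      ext <;> simp [sh]; ring
    have h5 := jac (R := Module.End ℂ (Fk (BB k))) _ _ _ _ _ _ _ h1 h2 h3 h4
    have h6 := G_u (r + r') ψ c
    have h7 : ψ (c.1 - (r + r')) = χ' (c.1 - r') * χ (c.1 - r' - r) - χ (c.1 - r) * χ' (c.1 - r - r') := by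
      simp only [hψ]
      rw [show c.1 - (r + r') + r = c.1 - r' by ring, show c.1 - (r + r') + r' = c.1 - r by ring,
        show c.1 - r' - r = c.1 - (r + r') by ring, show c.1 - r - r' = c.1 - (r + r') by ring]
      ring
    rw [← gl_subsmul (R := Module.End ℂ (Fk (BB k))) _ _ _ _ h7] at h6
    exact gl_fin (R := Module.End ℂ (Fk (BB k))) _ _ _ _ _ h5 h6
  have hus : ∀ c, Commute Z (us c) := by
    intro c
    have h1 := G_us r χ c
    have h2 := G_us r' χ' c
    have h3 : G r χ * (- χ' c.1 • us (sh r' c)) - (- χ' c.1 • us (sh r' c)) * G r χ =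
        (χ' c.1 * χ (c.1 + r')) • us (sh (r + r') c) := by
      rw [gl_smul (R := Module.End ℂ (Fk (BB k))) _ _ _ _ (G_us _ _ _), smul_smul]
      congr 1
      · simp [sh]
      congr 1
      ext <;> simp [sh]; ring
    have h4 : G r' χ' * (- χ c.1 • us (sh r c)) - (- χ c.1 • us (sh r c)) * G r' χ' =
        (χ c.1 * χ' (c.1 + r)) • us (sh (r + r') c) := by
      rw [gl_smul (R := Module.End ℂ (Fk (BB k))) _ _ _ _ (G_us _ _ _), smul_smul]
      congr 1
      · simp [sh]
      congr 1
      ext <;> simp [sh]; ring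
    have h5 := jac (R := Module.End ℂ (Fk (BB k))) _ _ _ _ _ _ _ h1 h2 h3 h4
    have h6 := G_us (r + r') ψ c
    have h7 : - ψ c.1 = χ' c.1 * χ (c.1 + r') - χ c.1 * χ' (c.1 + r) := by
      simp only [hψ]; ring
    rw [← gl_subsmul (R := Module.End ℂ (Fk (BB k))) _ _ _ _ h7] at h6
    exact gl_fin (R := Module.End ℂ (Fk (BB k))) _ _ _ _ _ h5 h6
  have hs := scalar_of_commute Z
    (fun b => by
      have h1 := hu (ofLex b); have h2 := hus (ofLex b)
      unfold u at h1; unfold us at h2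
      split_ifs at h1 h2
      · exact h1
      · exact h2)
    (fun b => by
      have h1 := hu (ofLex b); have h2 := hus (ofLex b)
      unfold u at h1; unfold us at h2
      split_ifs at h1 h2
      · exact h2
      · exact h1)
  have hv : Z (ket ∅) ∅ = (G r χ (G r' χ' (vac : Fk (BB k)))) ∅ - (G r' χ' (G r χ (vac : Fk (BB k)))) ∅ := by
    have : G (r + r') ψ (vac : Fk (BB k)) ∅ = 0 := by
      rcases le_total (r + r') 0 with h | h
      · exact G_emp h _ _
      · rw [G_vac h]; rfl
    rw [hZ]
    simp only [LinearMap.sub_apply, Module.End.mul_apply, Finsupp.sub_apply]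
    rw [vac] at this
    rw [this]; simp [vac]
  rw [← hv, ← hs]; exact gl_last (R := Module.End ℂ (Fk (BB k))) _ _ _ hZ.symm
end Ferm
end PV

namespace PV
set_option linter.unusedSectionVars false
set_option linter.unusedSimpArgs false
set_option linter.unusedVariables false
open Finset

def res : SL2Gen → SL2Gen → SL2Gen
  | .e, .e => .e
  | .e, .h => .e
  | .e, .f => .h
  | .h, .e => .e
  | .h, .h => .h
  | .h, .f => .f
  | .f, .e => .h
  | .f, .h => .f
  | .f, .f => .f

noncomputable def brk : SL2Gen → SL2Gen → ℂ
  | .e, .e => 0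
  | .e, .h => -2
  | .e, .f => 1
  | .h, .e => 2
  | .h, .h => 0
  | .h, .f => -2
  | .f, .e => -1
  | .f, .h => 2
  | .f, .f => 0

noncomputable def kap : SL2Gen → SL2Gen → ℂ
  | .e, .f => 1
  | .f, .e => 1
  | .h, .h => 2
  | _, _ => 0

noncomputable def cen (k : ℕ) (g g' : SL2Gen) (m n : ℤ) : ℂ := if m + n = 0 then (m : ℂ) * k * kap g g' else 0

def Rep (k : ℕ) {M : Type*} [AddCommGroup M] [Module ℂ M] (X : SL2Gen → ℤ → Module.End ℂ M) : Prop :=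
  ∀ g g' m n v, X g m (X g' n v) = X g' n (X g m v) + (brk g g' • X (res g g') (m + n) v + cen k g g' m n • v)

theorem Rep.of6 {k : ℕ} {M : Type*} [AddCommGroup M] [Module ℂ M] (X : SL2Gen → ℤ → Module.End ℂ M)
    (h : ∀ g g', (g, g') ∈ ([(.e,.e),(.f,.f),(.h,.e),(.h,.f),(.e,.f),(.h,.h)] : List (SL2Gen × SL2Gen)) → ∀ m n v,
     X g m (X g' n v) = X g' n (X g m v) + (brk g g' • X (res g g') (m + n) v + cen k g g' m n • v)) : Rep k X := by
  have aux : ∀ g g', (∀ m n v,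
     X g m (X g' n v) = X g' n (X g m v) + (brk g g' • X (res g g') (m + n) v + cen k g g' m n • v)) → brk g' g = - brk g g' →
     res g' g = res g g' → kap g' g = kap g g' → (∀ m n v,
     X g' m (X g n v) = X g n (X g' m v) + (brk g' g • X (res g' g) (m + n) v + cen k g' g m n • v)) := by
    intro g g' h1 h2 h3 h4 m n v
    rw [h1 n m v, h2, h3, add_comm n m]
    have : cen k g' g m n = - cen k g g' n m := by
      unfold cen; rw [h4, add_comm n m]
      split_ifs with h5
      · rw [eq_neg_of_add_eq_zero_left h5]; push_cast; ring
      · simp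
    rw [this, neg_smul, neg_smul]; abel
  intro g g'
  cases g <;> cases g'
  all_goals first
    | (refine h _ _ ?_; simp; done)
    | (refine aux _ _ (h _ _ ?_) ?_ rfl rfl
       · simp
       · simp [brk])

noncomputable def ev (p : ℤ) : ℂ := if Even p then 1 else 0
noncomputable def od (p : ℤ) : ℂ := if Even p then 0 else 1
noncomputable def sn (p : ℤ) : ℂ := if Even p then 1 else -1

noncomputable def FX (k : ℕ) : SL2Gen → ℤ → Module.End ℂ (Fk (BB k))
  | .e, n => G (2 * n + 1) ev
  | .h, n => G (2 * n) sn
  | .f, n => G (2 * n - 1) od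

theorem G_smul_chi {k : ℕ} (r : ℤ) (c : ℂ) (χ : ℤ → ℂ) (v : Fk (BB k)) : G r (fun p => c * χ p) v = c • G r χ v := by
  obtain ⟨A, hA⟩ := G_ev r χ v
  obtain ⟨C, hC⟩ := G_ev r (fun p => c * χ p) v
  rw [hA (A ∪ C) Finset.subset_union_left, hC (A ∪ C) Finset.subset_union_right, Finset.smul_sum]
  apply Finset.sum_congr rfl
  intro b _
  unfold term
  rw [LinearMap.smul_apply, LinearMap.smul_apply, smul_smul]

theorem G_G' {k : ℕ} (r r' s : ℤ) (χ χ' ψ : ℤ → ℂ) (c d: ℂ) (hs : r + r' = s)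
    (h : ∀ p, χ p * χ' (p + r) - χ' p * χ (p + r') = c * ψ p)
    (hd : (if 0 < r ∧ r' = -r then (k:ℂ) * ∑ p ∈ Finset.Ico 0 r, χ' p * χ (p - r) else 0)
      - (if 0 < r' ∧ r = -r' then (k:ℂ) * ∑ p ∈ Finset.Ico 0 r', χ p * χ' (p - r') else 0) = d) (v : Fk (BB k)) :
    G r χ (G r' χ' v) = G r' χ' (G r χ v) + (c • G s ψ v + d • v) := by
  have h1 := LinearMap.congr_fun (G_G (k := k) r r' χ χ') v
  rw [lam, lam, hd] at h1
  have h2 : (fun p => χ p * χ' (p + r) - χ' p * χ (p + r')) = fun p => c * ψ p := funext h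
  rw [h2] at h1
  simp only [LinearMap.sub_apply, Module.End.mul_apply, LinearMap.add_apply, LinearMap.smul_apply, G_smul_chi, hs, Module.End.one_apply] at h1
  rw [sub_eq_iff_eq_add'] at h1
  exact h1

theorem even_shift (p r : ℤ) (hr : Even r) : Even (p + r) ↔ Even p := by
  rw [Int.even_add]; simp [hr]
theorem even_shift' (p r : ℤ) (hr : ¬ Even r) : Even (p + r) ↔ ¬ Even p := by
  rw [Int.even_add]; simp only [hr, iff_false]
theorem even_sub (p r : ℤ) (hr : Even r) : Even (p - r) ↔ Even p := by
  rw [Int.even_sub]; simp [hr]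
theorem even_sub' (p r : ℤ) (hr : ¬ Even r) : Even (p - r) ↔ ¬ Even p := by
  rw [Int.even_sub]; simp only [hr, iff_false]

theorem sum_od (m : ℕ) : ∑ p ∈ Finset.Ico (0:ℤ) (2 * m + 1), od p = m := by
  induction m with
  | zero =>
    have : Finset.Ico (0:ℤ) (2 * (0:ℕ) + 1) = {0} := by ext x; simp; omega
    rw [this]; simp [od]
  | succ m ih =>
    have : Finset.Ico (0:ℤ) (2 * (m+1 : ℕ) + 1) = insert (2 * (m:ℤ) + 2) (insert (2 * (m:ℤ) + 1) (Finset.Ico (0:ℤ) (2 * m + 1))) := by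
      ext x; simp; omega
    rw [this, Finset.sum_insert (by simp), Finset.sum_insert (by simp), ih]
    have e1 : Even (2 * (m:ℤ) + 2) := ⟨m + 1, by ring⟩
    have e2 : ¬ Even (2 * (m:ℤ) + 1) := by rw [Int.not_even_iff_odd]; exact ⟨m, by ring⟩
    simp only [od, if_pos e1, if_neg e2]; push_cast; ring

theorem sum_ev (m : ℕ) : ∑ p ∈ Finset.Ico (0:ℤ) (2 * m + 1), ev p = m + 1 := by
  induction m with
  | zero =>
    have : Finset.Ico (0:ℤ) (2 * (0:ℕ) + 1) = {0} := by ext x; simp; omega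
    rw [this, Finset.sum_singleton]; simp [ev]
  | succ m ih =>
    have : Finset.Ico (0:ℤ) (2 * (m+1 : ℕ) + 1) = insert (2 * (m:ℤ) + 2) (insert (2 * (m:ℤ) + 1) (Finset.Ico (0:ℤ) (2 * m + 1))) := by
      ext x; simp; omega
    rw [this, Finset.sum_insert (by simp), Finset.sum_insert (by simp), ih]
    have e1 : Even (2 * (m:ℤ) + 2) := ⟨m + 1, by ring⟩
    have e2 : ¬ Even (2 * (m:ℤ) + 1) := by rw [Int.not_even_iff_odd]; exact ⟨m, by ring⟩
    simp only [ev, if_pos e1, if_neg e2]; push_cast; ring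

theorem ev2 (m : ℤ) : Even (2 * m) := even_two_mul m
theorem ev21 (m : ℤ) : ¬ Even (2 * m + 1) := by rw [Int.not_even_iff_odd]; exact ⟨m, by ring⟩
theorem ev21' (m : ℤ) : ¬ Even (2 * m - 1) := by rw [Int.not_even_iff_odd]; exact ⟨m - 1, by ring⟩

theorem FX_rep (k : ℕ) : Rep k (FX k) := by
  apply Rep.of6
  intro g g' hg
  simp only [List.mem_cons, Prod.mk.injEq, List.not_mem_nil, or_false] at hg
  intro m n v
  rcases hg with ⟨rfl, rfl⟩ | ⟨rfl, rfl⟩ | ⟨rfl, rfl⟩ | ⟨rfl, rfl⟩ | ⟨rfl, rfl⟩ | ⟨rfl, rfl⟩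
  · have := G_G' (k := k) (2 * m + 1) (2 * n + 1) _ ev ev ev 0 0 rfl (fun p => by
      simp only [ev, even_shift' _ _ (ev21 _)]; split_ifs <;> simp) (by
      have : ∀ p r, ev p * ev (p - (2 * r + 1)) = 0 := by
        intro p r; simp only [ev, even_sub' _ _ (ev21 _)]; split_ifs <;> simp
      simp [this]) v
    simpa [FX, res, brk, cen, kap] using this
  · have := G_G' (k := k) (2 * m - 1) (2 * n - 1) _ od od od 0 0 rfl (fun p => by
      simp only [od, even_shift' _ _ (ev21' _)]; split_ifs <;> simp) (by
      have : ∀ p r, od p * od (p - (2 * r - 1)) = 0 := by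
        intro p r; simp only [od, even_sub' _ _ (ev21' _)]; split_ifs <;> simp
      simp [this]) v
    simpa [FX, res, brk, cen, kap] using this
  · have := G_G' (k := k) (2 * m) (2 * n + 1) (2 * (m + n) + 1) sn ev ev 2 0 (by ring) (fun p => by
      simp only [ev, sn, even_shift' _ _ (ev21 _), even_shift _ _ (ev2 _)]; split_ifs <;> norm_num) (by
      rw [if_neg (by omega), if_neg (by omega)]; simp) v
    simpa [FX, res, brk, cen, kap] using this
  · have := G_G' (k := k) (2 * m) (2 * n - 1) (2 * (m + n) - 1) sn od od (-2) 0 (by ring) (fun p => by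
      simp only [od, sn, even_shift' _ _ (ev21' _), even_shift _ _ (ev2 _)]; split_ifs <;> norm_num) (by
      rw [if_neg (by omega), if_neg (by omega)]; simp) v
    simpa [FX, res, brk, cen, kap] using this
  · have := G_G' (k := k) (2 * m + 1) (2 * n - 1) (2 * (m + n)) ev od sn 1 (cen k .e .f m n) (by ring) (fun p => by
      simp only [od, ev, sn, even_shift' _ _ (ev21' _), even_shift' _ _ (ev21 _)]; split_ifs <;> norm_num) (by
      have h1 : ∀ p r, od p * ev (p - (2 * r + 1)) = od p := by
        intro p r; simp only [od, ev, even_sub' _ _ (ev21 _)]; split_ifs <;> simp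
      have h2 : ∀ p r, ev p * od (p - (2 * r - 1)) = ev p := by
        intro p r; simp only [od, ev, even_sub' _ _ (ev21' _)]; split_ifs <;> simp
      simp only [h1, h2]
      unfold cen
      by_cases hmn : m + n = 0
      · rw [if_pos hmn]
        rcases le_or_gt 0 m with hm | hm
        · rw [if_pos (by omega), if_neg (by omega)]
          obtain ⟨a, rfl⟩ := Int.eq_ofNat_of_zero_le hm
          rw [sum_od]; simp [kap, mul_comm]
        · rw [if_neg (by omega), if_pos (by omega)]
          obtain ⟨a, ha⟩ := Int.eq_ofNat_of_zero_le (show 0 ≤ n - 1 by omega)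
          rw [show 2 * n - 1 = 2 * (a:ℤ) + 1 by omega, sum_ev, show m = - ((a:ℤ) + 1) by omega]; 
          push_cast; simp [kap]; ring
      · rw [if_neg (by omega), if_neg (by omega), if_neg hmn]; simp) v
    simpa [FX, res, brk] using this
  · have := G_G' (k := k) (2 * m) (2 * n) (2 * (m + n)) sn sn sn 0 (cen k .h .h m n) (by ring) (fun p => by
      simp only [sn, even_shift _ _ (ev2 _)]; split_ifs <;> norm_num) (by
      have h1 : ∀ p r, sn p * sn (p - (2 * r)) = 1 := by
        intro p r; simp only [sn, even_sub _ _ (ev2 _)]; split_ifs <;> simp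
      simp only [h1]
      unfold cen
      by_cases hmn : m + n = 0
      · rw [if_pos hmn]
        rcases lt_trichotomy 0 m with hm | hm | hm
        · rw [if_pos (by omega), if_neg (by omega)]
          obtain ⟨a, rfl⟩ := Int.eq_ofNat_of_zero_le hm.le
          simp only [kap, Finset.sum_const, Int.card_Ico]
          rw [show (2 * (a:ℤ) - 0).toNat = 2 * a by omega]
          simp; ring
        · subst hm; rw [if_neg (by omega), if_neg (by omega)]; simp
        · rw [if_neg (by omega), if_pos (by omega)]
          obtain ⟨a, ha⟩ := Int.eq_ofNat_of_zero_le (show 0 ≤ n by omega)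
          rw [ha, show m = - (a:ℤ) by omega]; 
          simp only [kap, Finset.sum_const, Int.card_Ico]
          rw [show (2 * (a:ℤ) - 0).toNat = 2 * a by omega]
          push_cast; simp; ring
      · rw [if_neg (by omega), if_neg (by omega), if_neg hmn]; simp) v
    simpa [FX, res, brk] using this

theorem FX_vac (k : ℕ) (g : SL2Gen) (n : ℤ) (hn : 0 ≤ n) : g = .f ∧ n = 0 ∨ FX k g n vac = 0 := by
  cases g
  · right; exact G_vac (by omega) _
  · right; exact G_vac (by omega) _
  · rcases hn.eq_or_lt with h | h
    · left; exact ⟨rfl, h.symm⟩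
    · right; exact G_vac (by omega) _

theorem FX_vac' (k : ℕ) (g : SL2Gen) (n : ℤ) (hn : 0 ≤ n) : FX k g n vac = 0 := by
  rcases FX_vac k g n hn with ⟨rfl, rfl⟩ | h
  · show G _ _ _ = _
    rw [G_of_fin (({0} : Finset ℤ) ×ˢ Finset.univ)]
    · apply Finset.sum_eq_zero
      rintro ⟨b, i⟩ hb
      simp at hb; subst hb
      simp [term, od]
    · intro b hb; apply term_vac
      simp [Prod.ext_iff] at hb; omega
  · exact h

def star' : SL2Gen → SL2Gen
  | .e => .f
  | .h => .h
  | .f => .e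

theorem FX_adj (k : ℕ) (g : SL2Gen) (n : ℤ) (x y : Fk (BB k)) :
    Hf x (FX k g n y) = Hf (FX k (star' g) (-n) x) y := by
  cases g
  · show Hf x (G _ _ y) = Hf (G _ _ x) y
    rw [adj_G, show -(2 * n + 1) = 2 * (-n) - 1 by ring]
    congr 3; ext p
    simp only [ev, od, even_sub' _ _ (ev21 _)]; split_ifs <;> simp
  · show Hf x (G _ _ y) = Hf (G _ _ x) y
    rw [adj_G, show -(2 * n) = 2 * (-n) by ring]
    congr 3; ext p
    simp only [sn, even_sub _ _ (ev2 _)]; split_ifs <;> simp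
  · show Hf x (G _ _ y) = Hf (G _ _ x) y
    rw [adj_G, show -(2 * n - 1) = 2 * (-n) + 1 by ring]
    congr 3; ext p
    simp only [ev, od, even_sub' _ _ (ev21' _)]; split_ifs <;> simp
end PV

namespace PV
set_option linter.unusedSectionVars false
set_option linter.unusedSimpArgs false
set_option linter.unusedVariables false
open Finset

abbrev Var := SL2Gen × ℕ

def wt (l : List Var) : ℤ := ((l.map wtVar).sum : ℕ)
theorem wt_nil : wt [] = 0 := rfl
theorem wt_cons (x : Var) (l : List Var) : wt (x :: l) = wt l + ((x.2:ℤ) + 1) := by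
  simp [wt, wtVar]; ring
theorem wt_perm {l l' : List Var} (h : l.Perm l') : wt l = wt l' := by
  unfold wt; rw [(h.map _).sum_eq]

section
variable {M : Type*} [AddCommGroup M] [Module ℂ M]

def Xv (X : SL2Gen → ℤ → Module.End ℂ M) (x : Var) : Module.End ℂ M := X x.1 (-((x.2:ℤ) + 1))
def wd (X : SL2Gen → ℤ → Module.End ℂ M) (v0 : M) : List Var → M
  | [] => v0
  | x :: l => Xv X x (wd X v0 l)

def W (X : SL2Gen → ℤ → Module.End ℂ M) (v0 : M) (n : ℕ) (d : ℤ) : Submodule ℂ M :=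
  Submodule.span ℂ {v | ∃ l : List Var, l.length < n ∧ wt l = d ∧ wd X v0 l = v}

variable {X : SL2Gen → ℤ → Module.End ℂ M} {v0 : M}

theorem wd_mem_W {l : List Var} {n : ℕ} {d : ℤ} (h : l.length < n) (h' : wt l = d) : wd X v0 l ∈ W X v0 n d :=
  Submodule.subset_span ⟨l, h, h', rfl⟩

theorem W_mono {n n' : ℕ} {d : ℤ} (h : n ≤ n') : W X v0 n d ≤ W X v0 n' d := by
  apply Submodule.span_mono
  rintro v ⟨l, h1, h2, h3⟩
  exact ⟨l, by omega, h2, h3⟩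

theorem Xv_W (x : Var) {n : ℕ} {d d' : ℤ} {v : M} (hd : d' = d + (x.2 + 1)) (h : v ∈ W X v0 n d) : Xv X x v ∈ W X v0 (n+1) d' := by
  induction h using Submodule.span_induction with
  | mem v hv =>
    obtain ⟨l, h1, h2, rfl⟩ := hv
    apply wd_mem_W (l := x :: l)
    · simp; omega
    · rw [wt_cons, h2, hd]
  | zero => simp
  | add a b _ _ ha hb => rw [map_add]; exact add_mem ha hb
  | smul c a _ ha => rw [map_smul]; exact Submodule.smul_mem _ _ ha


theorem X_wd {k : ℕ} (hX : Rep k X) (h0 : ∀ g (n : ℤ), 0 ≤ n → X g n v0 = 0) (l : List Var) : ∀ (g : SL2Gen) (n : ℕ), X g n (wd X v0 l) ∈ W X v0 (l.length + 1) (wt l - n) := by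
  induction l with
  | nil => intro g n; simp [wd, h0]
  | cons x l ih =>
    intro g n
    show X g n (X x.1 (-((x.2:ℤ) + 1)) (wd X v0 l)) ∈ _
    rw [hX]
    refine add_mem ?_ (add_mem (Submodule.smul_mem _ _ ?_) ?_)
    · exact Xv_W x (by rw [wt_cons]; ring) (ih g n)
    · rcases le_or_gt 0 ((n:ℤ) + -((x.2:ℤ) + 1)) with h | h
      · obtain ⟨a, ha⟩ := Int.eq_ofNat_of_zero_le h
        rw [ha]
        have := ih (res g x.1) a
        have h2 : wt (x :: l) - n = wt l - a := by rw [wt_cons]; omega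
        rw [h2]
        exact W_mono (by simp) this
      · obtain ⟨a, ha⟩ := Int.eq_ofNat_of_zero_le (show 0 ≤ (x.2:ℤ) - n by omega)
        have h := wd_mem_W (l := (res g x.1, a) :: l) (X := X) (v0 := v0) (n := (x :: l).length + 1) (d := wt (x :: l) - n) (by simp) (by rw [wt_cons, wt_cons]; simp; omega)
        convert h using 1
        show _ = X (res g x.1) _ _
        congr 2; simp; omega
    · unfold cen
      split_ifs with h
      · apply Submodule.smul_mem
        apply wd_mem_W
        · simp
        · rw [wt_cons]; omega
      · simp

theorem X0_W {k : ℕ} (hX : Rep k X) (h0 : ∀ g (n : ℤ), 0 ≤ n → X g n v0 = 0) (g : SL2Gen) {n : ℕ} {d : ℤ} {v : M} (h : v ∈ W X v0 n d) : X g 0 v ∈ W X v0 n d := by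
  induction h using Submodule.span_induction with
  | mem v hv =>
    obtain ⟨l, h1, h2, rfl⟩ := hv
    have := X_wd hX h0 l g 0
    simp only [Nat.cast_zero, sub_zero, h2] at this
    exact W_mono (by omega) this
  | zero => simp
  | add a b _ _ ha hb => rw [map_add]; exact add_mem ha hb
  | smul c a _ ha => rw [map_smul]; exact Submodule.smul_mem _ _ ha

theorem wd_perm {k : ℕ} (hX : Rep k X) (h0 : ∀ g (n : ℤ), 0 ≤ n → X g n v0 = 0) {l l' : List Var} (h : l.Perm l') : wd X v0 l - wd X v0 l' ∈ W X v0 l.length (wt l) := by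
  induction h with
  | nil => simp
  | cons x _ ih =>
    show Xv X x _ - Xv X x _ ∈ _
    rw [← map_sub]
    exact Xv_W x (by rw [wt_cons]) ih
  | swap x y l =>
    show X _ _ (X _ _ _) - X _ _ (X _ _ _) ∈ _
    rw [hX, add_sub_cancel_left]
    refine add_mem (Submodule.smul_mem _ _ ?_) ?_
    · have := wd_mem_W (l := (res y.1 x.1, y.2 + x.2 + 1) :: l) (X := X) (v0 := v0) (n := (y :: x :: l).length) (d := wt (y :: x :: l)) (by simp) (by simp only [wt_cons]; push_cast; ring)
      convert this using 1
      show _ = X _ _ _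
      congr 2
    · unfold cen
      rw [if_neg (by omega)]; simp
  | trans h1 h2 ih1 ih2 =>
    rw [← h1.length_eq, ← wt_perm h1] at ih2
    have := add_mem ih1 ih2
    simpa using this

/-- all words -/
def Wall (X : SL2Gen → ℤ → Module.End ℂ M) (v0 : M) : Submodule ℂ M := Submodule.span ℂ (Set.range (wd X v0))

theorem W_le_Wall (n : ℕ) (d : ℤ) : W X v0 n d ≤ Wall X v0 := by
  apply Submodule.span_mono
  rintro v ⟨l, _, _, h3⟩
  exact ⟨l, h3⟩

theorem X_Wall {k : ℕ} (hX : Rep k X) (h0 : ∀ g (n : ℤ), 0 ≤ n → X g n v0 = 0) (g : SL2Gen) (n : ℤ) {v : M} (h : v ∈ Wall X v0) : X g n v ∈ Wall X v0 := by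
  induction h using Submodule.span_induction with
  | mem v hv =>
    obtain ⟨l, rfl⟩ := hv
    rcases le_or_gt 0 n with h | h
    · obtain ⟨a, rfl⟩ := Int.eq_ofNat_of_zero_le h
      exact W_le_Wall _ _ (X_wd hX h0 l g a)
    · obtain ⟨a, ha⟩ := Int.eq_ofNat_of_zero_le (show 0 ≤ -n - 1 by omega)
      refine Submodule.subset_span ⟨(g, a) :: l, ?_⟩
      show X g _ _ = _
      congr 2; simp; omega
  | zero => simp
  | add a b _ _ ha hb => rw [map_add]; exact add_mem ha hb
  | smul c a _ ha => rw [map_smul]; exact Submodule.smul_mem _ _ ha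

/-! polynomials -/
noncomputable def pm (l : List Var) : PolySL2 := (l.map MvPolynomial.X).prod

theorem pm_cons (x : Var) (l : List Var) : pm (x :: l) = MvPolynomial.X x * pm l := by simp [pm]

theorem monomial_eq_pm (s : Var →₀ ℕ) : MvPolynomial.monomial s (1:ℂ) = pm s.toMultiset.toList := by
  unfold pm
  rw [← Multiset.prod_coe, ← Multiset.map_coe, Multiset.coe_toList]
  rw [MvPolynomial.monomial_eq, Finsupp.toMultiset_map, Finsupp.prod_toMultiset]
  simp
  rw [Finsupp.prod_mapDomain_index (by simp) (by intro b m₁ m₂; exact pow_add _ _ _)]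

theorem pm_eq_monomial (l : List Var) : pm l = MvPolynomial.monomial (Multiset.toFinsupp (l : Multiset Var)) (1:ℂ) := by
  rw [monomial_eq_pm]
  unfold pm
  apply List.Perm.prod_eq
  apply List.Perm.map
  rw [← Multiset.coe_eq_coe]; simp

noncomputable def Th (X : SL2Gen → ℤ → Module.End ℂ M) (v0 : M) : PolySL2 →ₗ[ℂ] M :=
  (MvPolynomial.basisMonomials Var ℂ).constr ℂ (fun s => wd X v0 s.toMultiset.toList)

theorem Th_mon (s : Var →₀ ℕ) : Th X v0 (MvPolynomial.monomial s 1) = wd X v0 s.toMultiset.toList := by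
  have := (MvPolynomial.basisMonomials Var ℂ).constr_basis ℂ (fun s => wd X v0 s.toMultiset.toList) s
  rwa [MvPolynomial.coe_basisMonomials] at this

theorem Th_pm {k : ℕ} (hX : Rep k X) (h0 : ∀ g (n : ℤ), 0 ≤ n → X g n v0 = 0) (l : List Var) : Th X v0 (pm l) - wd X v0 l ∈ W X v0 l.length (wt l) := by
  rw [pm_eq_monomial, Th_mon]
  have hp : List.Perm l (Multiset.toFinsupp (l : Multiset Var)).toMultiset.toList := by
    rw [← Multiset.coe_eq_coe]; simp
  have := neg_mem (wd_perm hX h0 hp)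
  simpa using this

noncomputable def PP (n : ℕ) (d : ℤ) : Submodule ℂ PolySL2 := Submodule.span ℂ {p | ∃ l : List Var, l.length = n ∧ wt l = d ∧ pm l = p}

def Rel (X : SL2Gen → ℤ → Module.End ℂ M) (v0 : M) (n : ℕ) (d : ℤ) (q : PolySL2) (w : M) : Prop :=
  q ∈ PP n d ∧ Th X v0 q - w ∈ W X v0 n d

theorem Rel_pm {k : ℕ} (hX : Rep k X) (h0 : ∀ g (n : ℤ), 0 ≤ n → X g n v0 = 0) (l : List Var) : Rel X v0 l.length (wt l) (pm l) (wd X v0 l) :=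
  ⟨Submodule.subset_span ⟨l, rfl, rfl, rfl⟩, Th_pm hX h0 l⟩

theorem Rel.zero (n : ℕ) (d : ℤ) : Rel X v0 n d 0 0 := ⟨zero_mem _, by simp⟩
theorem Rel.add {n : ℕ} {d : ℤ} {q q' : PolySL2} {w w' : M} (h : Rel X v0 n d q w) (h' : Rel X v0 n d q' w') :
    Rel X v0 n d (q + q') (w + w') := ⟨add_mem h.1 h'.1, by
      have := add_mem h.2 h'.2
      rw [map_add]; convert this using 1; abel⟩
theorem Rel.smul {n : ℕ} {d : ℤ} {q : PolySL2} {w : M} (c : ℂ) (h : Rel X v0 n d q w) :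
    Rel X v0 n d (c • q) (c • w) := ⟨Submodule.smul_mem _ _ h.1, by
      have := Submodule.smul_mem _ c h.2
      rw [map_smul]; rwa [smul_sub] at this⟩
theorem Rel.congr {n : ℕ} {d : ℤ} {q : PolySL2} {w w' : M} (h : Rel X v0 n d q w) (hw : w - w' ∈ W X v0 n d) :
    Rel X v0 n d q w' := ⟨h.1, by have := add_mem h.2 hw; simpa using this⟩

theorem Rel.sum {ι : Type*} (T : Finset ι) {n : ℕ} {d : ℤ} {q : ι → PolySL2} {w : ι → M} (h : ∀ i ∈ T, Rel X v0 n d (q i) (w i)) :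
    Rel X v0 n d (∑ i ∈ T, q i) (∑ i ∈ T, w i) := by
  classical
  induction T using Finset.induction_on with
  | empty => simpa using Rel.zero n d
  | insert a T ha ih =>
    rw [Finset.sum_insert ha, Finset.sum_insert ha]
    exact (h a (by simp)).add (ih fun i hi => h i (by simp [hi]))

/-- induction principle: linear operations respecting Rel -/
theorem Rel_lin {k : ℕ} (hX : Rep k X) (h0 : ∀ g (n : ℤ), 0 ≤ n → X g n v0 = 0) {A : PolySL2 →ₗ[ℂ] PolySL2} {C : M →ₗ[ℂ] M} {n n' : ℕ} {d d' : ℤ}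
    (hpm : ∀ l : List Var, l.length = n → wt l = d → Rel X v0 n' d' (A (pm l)) (C (wd X v0 l)))
    (hC : ∀ v ∈ W X v0 n d, C v ∈ W X v0 n' d')
    {q : PolySL2} {w : M} (h : Rel X v0 n d q w) : Rel X v0 n' d' (A q) (C w) := by
  have h1 := h.1
  have h2 := h.2
  clear h
  have key : Rel X v0 n' d' (A q) (C (Th X v0 q)) := by
    clear h2
    induction h1 using Submodule.span_induction with
    | mem v hv =>
      obtain ⟨l, hl1, hl2, rfl⟩ := hv
      refine (hpm l hl1 hl2).congr ?_
      rw [← map_sub]; apply hC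
      have := neg_mem (Th_pm hX h0 l)
      rw [hl1, hl2] at this; simpa using this
    | zero => simpa using Rel.zero n' d'
    | add a b ha hb iha ihb => rw [map_add, map_add, map_add]; exact iha.add ihb
    | smul c a _ ha => rw [map_smul, map_smul, map_smul]; exact ha.smul c
  refine key.congr ?_
  rw [← map_sub]; exact hC _ h2

theorem Rel.X_mul {k : ℕ} (hX : Rep k X) (h0 : ∀ g (n : ℤ), 0 ≤ n → X g n v0 = 0) (x : Var) {n : ℕ} {d d' : ℤ} {q : PolySL2} {w : M} (hd : d' = d + (x.2 + 1)) (h : Rel X v0 n d q w) :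
    Rel X v0 (n+1) d' (MvPolynomial.X x * q) (Xv X x w) := by
  refine Rel_lin hX h0 (A := LinearMap.mulLeft ℂ (MvPolynomial.X x)) (C := Xv X x) ?_ (fun v hv => Xv_W x hd hv) h
  intro l h1 h2
  have := Rel_pm hX h0 (x :: l)
  rw [wt_cons, pm_cons, h2, ← hd] at this
  rw [List.length_cons, h1] at this
  exact this

noncomputable def ad : SL2Gen → Derivation ℂ PolySL2 PolySL2
  | .e => adE
  | .h => adH
  | .f => adF

theorem ad_X (g : SL2Gen) (x : Var) : ad g (MvPolynomial.X x) = brk g x.1 • MvPolynomial.X (res g x.1, x.2) := by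
  obtain ⟨y, m⟩ := x
  cases g <;> cases y <;> simp [ad, adE, adH, adF, brk, res, MvPolynomial.mkDerivation_X]

theorem Rel.ad {k : ℕ} (hX : Rep k X) (h0 : ∀ g (n : ℤ), 0 ≤ n → X g n v0 = 0) (g : SL2Gen) {n : ℕ} {d : ℤ} {q : PolySL2} {w : M} (h : Rel X v0 n d q w) :
    Rel X v0 n d (ad g q) (X g 0 w) := by
  refine Rel_lin hX h0 (A := (PV.ad g).toLinearMap) (C := X g 0) ?_ (fun v hv => X0_W hX h0 g hv) h
  intro l h1 h2
  subst h1 h2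
  clear h
  induction l with
  | nil => 
    have : (PV.ad g) (pm []) = 0 := by simp [pm]
    have h3 : X g 0 (wd X v0 []) = 0 := h0 g 0 le_rfl
    rw [h3]; show Rel X v0 _ _ ((PV.ad g) (pm [])) 0
    rw [this]; exact Rel.zero _ _
  | cons x l ih =>
    show Rel X v0 _ _ ((PV.ad g) (pm (x :: l))) (X g 0 (X x.1 _ (wd X v0 l)))
    rw [pm_cons, Derivation.leibniz, ad_X, hX]
    simp only [smul_eq_mul, zero_add]
    have hc : cen k g x.1 0 (-((x.2:ℤ)+1)) = 0 := by unfold cen; rw [if_neg (by omega)]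
    rw [hc, zero_smul, add_zero, mul_smul_comm, mul_comm (pm l)]
    refine Rel.add ?_ (Rel.smul _ ?_)
    · exact Rel.X_mul hX h0 x (wt_cons _ _) ih
    · exact Rel.X_mul hX h0 (res g x.1, x.2) (wt_cons _ _) (Rel_pm hX h0 l)

end
end PV

namespace PV
set_option linter.unusedSectionVars false
set_option linter.unusedSimpArgs false
set_option linter.unusedVariables false
open Finset

theorem wd_map {M N : Type*} [AddCommGroup M] [Module ℂ M] [AddCommGroup N] [Module ℂ N]
    {X : SL2Gen → ℤ → Module.End ℂ M} {Y : SL2Gen → ℤ → Module.End ℂ N} (φ : M →ₗ[ℂ] N)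
    (h : ∀ g n v, φ (X g n v) = Y g n (φ v)) (v0 : M) (l : List Var) : φ (wd X v0 l) = wd Y (φ v0) l := by
  induction l with
  | nil => rfl
  | cons x l ih =>
    show φ (X _ _ _) = Y _ _ _
    rw [h, ih]

theorem Wall_ind {M N : Type*} [AddCommGroup M] [Module ℂ M] [AddCommGroup N] [Module ℂ N]
    {X : SL2Gen → ℤ → Module.End ℂ (M × N)} {v0 : M × N} (φ : N → ℂ) (h1 : φ 0 = 0)
    (h2 : ∀ a b, φ (a + b) = φ a + φ b) (h3 : ∀ (c : ℂ) a, φ a = 0 → φ (c • a) = 0)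
    (h : ∀ l, φ (wd X v0 l).2 = 0) : ∀ z ∈ Wall X v0, φ z.2 = 0 := by
  intro z hz
  induction hz using Submodule.span_induction with
  | mem z hz => obtain ⟨l, rfl⟩ := hz; exact h l
  | zero => exact h1
  | add a b _ _ ha hb => rw [Prod.snd_add, h2, ha, hb, add_zero]
  | smul c a _ ha => rw [Prod.smul_snd]; exact h3 _ _ ha

theorem graph_map {M N : Type*} [AddCommGroup M] [Module ℂ M] [AddCommGroup N] [Module ℂ N]
    (Q : Submodule ℂ (M × N)) (h1 : ∀ y, ((0 : M), y) ∈ Q → y = 0) (h2 : ∀ v, ∃ y, (v, y) ∈ Q) :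
    ∃ j : M →ₗ[ℂ] N, (∀ v, (v, j v) ∈ Q) ∧ ∀ v y, (v, y) ∈ Q → j v = y := by
  choose f hf using h2
  have hu : ∀ v y, (v, y) ∈ Q → f v = y := by
    intro v y h
    have := sub_mem (hf v) h
    rw [Prod.mk_sub_mk, sub_self] at this
    exact sub_eq_zero.1 (h1 _ this)
  refine ⟨{ toFun := f, map_add' := fun x y => hu _ _ ?_, map_smul' := fun c x => hu _ _ ?_ }, hf, hu⟩
  · exact add_mem (hf x) (hf y)
  · exact Submodule.smul_mem _ c (hf x)

section
variable {k : ℕ} (S : SL2VacuumModule k)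

def VX : SL2Gen → ℤ → Module.End ℂ S.V
  | .e => S.E
  | .h => S.Hh
  | .f => S.F

theorem VX_rep : Rep k (VX S) := by
  apply Rep.of6
  intro g g' hg
  simp only [List.mem_cons, Prod.mk.injEq, List.not_mem_nil, or_false] at hg
  intro m n v
  rcases hg with ⟨rfl, rfl⟩ | ⟨rfl, rfl⟩ | ⟨rfl, rfl⟩ | ⟨rfl, rfl⟩ | ⟨rfl, rfl⟩ | ⟨rfl, rfl⟩
  · have := LinearMap.congr_fun (S.EE m n).eq v
    simpa [VX, res, brk, cen, kap] using this
  · have := LinearMap.congr_fun (S.FF m n).eq v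
    simpa [VX, res, brk, cen, kap] using this
  · have := LinearMap.congr_fun (S.HE m n) v
    simp only [LinearMap.sub_apply, Module.End.mul_apply, LinearMap.smul_apply] at this
    rw [sub_eq_iff_eq_add'] at this
    simpa [VX, res, brk, cen, kap] using this
  · have := LinearMap.congr_fun (S.HF m n) v
    simp only [LinearMap.sub_apply, Module.End.mul_apply, LinearMap.smul_apply] at this
    rw [sub_eq_iff_eq_add'] at this
    simpa [VX, res, brk, cen, kap] using this
  · have := LinearMap.congr_fun (S.EF m n) v
    simp only [LinearMap.sub_apply, Module.End.mul_apply, LinearMap.smul_apply, LinearMap.add_apply, Module.End.one_apply] at this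
    rw [sub_eq_iff_eq_add'] at this
    simpa [VX, res, brk, cen, kap] using this
  · have := LinearMap.congr_fun (S.HH m n) v
    simp only [LinearMap.sub_apply, Module.End.mul_apply, LinearMap.smul_apply, LinearMap.add_apply, Module.End.one_apply] at this
    rw [sub_eq_iff_eq_add'] at this
    have h2 : cen k .h .h m n = (if m + n = 0 then ((2 * m * k : ℤ) : ℂ) else 0) := by
      unfold cen kap; split_ifs
      · push_cast; ring
      · rfl
    rw [h2]
    simpa [VX, res, brk] using this

theorem VX_vac (g : SL2Gen) (n : ℤ) (h : 0 ≤ n) : VX S g n S.hwv = 0 := by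
  cases g
  · exact (S.hwv_hw n h).1
  · exact (S.hwv_hw n h).2.1
  · exact (S.hwv_hw n h).2.2

theorem VX_D (g : SL2Gen) (n : ℤ) (v : S.V) : S.D (VX S g n v) = VX S g n (S.D v) + (n:ℂ) • VX S g n v := by
  rw [← sub_eq_iff_eq_add']
  cases g
  · exact LinearMap.congr_fun (S.DE n) v
  · exact LinearMap.congr_fun (S.DH n) v
  · exact LinearMap.congr_fun (S.DF n) v

theorem D_wd (l : List Var) : S.D (wd (VX S) S.hwv l) = ((- wt l : ℤ) : ℂ) • wd (VX S) S.hwv l := by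
  induction l with
  | nil => simp [wd, wt_nil, S.hwv_deg]
  | cons x l ih =>
    show S.D (VX S _ _ _) = _ • VX S _ _ _
    rw [VX_D, ih, map_smul, ← add_smul, wt_cons]
    congr 1; push_cast; ring

theorem VX_irred (U : Submodule ℂ S.V) (h : ∀ g n, ∀ u ∈ U, VX S g n u ∈ U) : U = ⊥ ∨ U = ⊤ :=
  S.irred U fun n u hu => ⟨h .e n u hu, h .h n u hu, h .f n u hu⟩

theorem V_Wall : Wall (VX S) S.hwv = ⊤ := by
  rcases VX_irred S _ (fun g n u hu => X_Wall (VX_rep S) (VX_vac S) g n hu) with h | h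
  · exfalso
    have : S.hwv ∈ Wall (VX S) S.hwv := Submodule.subset_span ⟨[], rfl⟩
    rw [h] at this
    exact S.hwv_ne (by simpa using this)
  · exact h

def Wne : Submodule ℂ S.V := Submodule.span ℂ {v | ∃ l : List Var, l ≠ [] ∧ wd (VX S) S.hwv l = v}

theorem hwv_not_Wne : S.hwv ∉ Wne S := by
  intro h
  have h1 : Wne S ≤ ⨆ μ ≠ (0:ℂ), Module.End.eigenspace S.D μ := by
    apply Submodule.span_le.2
    rintro v ⟨l, hl, rfl⟩
    have hw : ((- wt l : ℤ) : ℂ) ≠ 0 := by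
      cases l with
      | nil => simp at hl
      | cons x l =>
        rw [wt_cons]
        have : 0 ≤ wt l := by unfold wt; positivity
        norm_cast; omega
    have : wd (VX S) S.hwv l ∈ Module.End.eigenspace S.D ((- wt l : ℤ) : ℂ) := by
      rw [Module.End.mem_eigenspace_iff]; exact D_wd S l
    exact Submodule.mem_iSup_of_mem _ (Submodule.mem_iSup_of_mem hw this)
  have h2 : S.hwv ∈ Module.End.eigenspace S.D 0 := by
    rw [Module.End.mem_eigenspace_iff, S.hwv_deg]; simp
  have h3 := (Module.End.eigenspaces_iSupIndep S.D) 0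
  exact S.hwv_ne (by simpa using (Submodule.disjoint_def.1 h3) _ h2 (h1 h))

noncomputable def PX : SL2Gen → ℤ → Module.End ℂ (S.V × Fk (BB k)) := fun g n => (VX S g n).prodMap (FX k g n)

theorem PX_rep : Rep k (PX S) := by
  intro g g' m n v
  ext1
  · exact VX_rep S g g' m n v.1
  · exact FX_rep k g g' m n v.2

noncomputable def pv0 : S.V × Fk (BB k) := (S.hwv, vac)

theorem PX_vac (g : SL2Gen) (n : ℤ) (h : 0 ≤ n) : PX S g n (pv0 S) = 0 := by
  ext1
  · exact VX_vac S g n h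
  · exact FX_vac' k g n h

noncomputable abbrev Qs : Submodule ℂ (S.V × Fk (BB k)) := Wall (PX S) (pv0 S)

theorem wd_fst (l : List Var) : (wd (PX S) (pv0 S) l).1 = wd (VX S) S.hwv l :=
  wd_map (LinearMap.fst ℂ S.V (Fk (BB k))) (fun _ _ _ => rfl) _ l
theorem wd_snd (l : List Var) : (wd (PX S) (pv0 S) l).2 = wd (FX k) vac l :=
  wd_map (LinearMap.snd ℂ S.V (Fk (BB k))) (fun _ _ _ => rfl) _ l

theorem Qs_X (g : SL2Gen) (n : ℤ) {z : S.V × Fk (BB k)} (h : z ∈ Qs S) : PX S g n z ∈ Qs S :=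
  X_Wall (PX_rep S) (PX_vac S) g n h

theorem Qs_c {z : S.V × Fk (BB k)} (h : z ∈ Qs S) : z.1 - (z.2 ∅) • S.hwv ∈ Wne S := by
  induction h using Submodule.span_induction with
  | mem z hz =>
    obtain ⟨l, rfl⟩ := hz
    rw [wd_fst, wd_snd]
    cases l with
    | nil => simp [wd, vac, ket]
    | cons x l =>
      have : (wd (FX k) vac (x :: l)) ∅ = 0 := by
        show (FX k _ _ _) ∅ = 0
        rw [← Hf_ket_left, FX_adj]
        have := FX_vac' k (star' x.1) ((x.2:ℤ)+1) (by positivity)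
        rw [vac] at this
        rw [neg_neg, this, Hf_zero_left]
      rw [this, zero_smul, sub_zero]
      exact Submodule.subset_span ⟨x :: l, by simp, rfl⟩
  | zero => simp
  | add a b _ _ ha hb =>
    have := add_mem ha hb
    convert this using 1
    simp only [Prod.fst_add, Prod.snd_add, Finsupp.add_apply, add_smul]; abel
  | smul c a _ ha =>
    have := Submodule.smul_mem _ c ha
    convert this using 1
    simp only [Prod.smul_fst, Prod.smul_snd, Finsupp.smul_apply, smul_eq_mul, smul_sub, mul_smul]

theorem PX_zero_fst (g : SL2Gen) (n : ℤ) (y : Fk (BB k)) :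
    PX S g n ((0 : S.V), y) = ((0 : S.V), FX k g n y) :=
  Prod.ext (LinearMap.map_zero (VX S g n)) rfl

theorem PX_zero_snd (g : SL2Gen) (n : ℤ) (v : S.V) :
    PX S g n (v, (0 : Fk (BB k))) = (VX S g n v, (0 : Fk (BB k))) :=
  Prod.ext rfl (LinearMap.map_zero (FX k g n))

theorem Qs_aux1 (y : Fk (BB k)) (hy : ((0 : S.V), y) ∈ Qs S) : y ∅ = 0 := by
  by_contra hc
  have := Qs_c S hy
  simp only [zero_sub, Submodule.neg_mem_iff] at this
  rw [Submodule.smul_mem_iff _ hc] at this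
  exact hwv_not_Wne S this

theorem Qs_aux2 (l : List Var) : ∀ (y : Fk (BB k)), ((0 : S.V), y) ∈ Qs S → Hf (wd (FX k) vac l) y = 0 := by
  induction l with
  | nil => intro y hy; exact (Hf_ket_left _ _).trans (Qs_aux1 S y hy)
  | cons x l ih =>
    intro y hy
    have h1 := Qs_X S (star' x.1) (-(-((x.2:ℤ)+1))) hy
    rw [PX_zero_fst] at h1
    have h2 := ih _ h1
    have h3 := FX_adj (k := k) (g := x.1) (n := -((x.2:ℤ)+1)) (x := y) (y := wd (FX k) vac l)
    have h4 : Hf (FX k x.1 (-((x.2:ℤ)+1)) (wd (FX k) vac l)) y = 0 := by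
      rw [← Hf_conj, h3, Hf_conj]; exact h2
    exact h4

theorem Qs_snd_zero {y : Fk (BB k)} (h : ((0 : S.V), y) ∈ Qs S) : y = 0 := by
  have h3 := Wall_ind (X := PX S) (v0 := pv0 S) (fun x => Hf x y) (Hf_zero_left _) (fun a b => Hf_add_left _ _ _)
    (fun c a ha => by
      have : Hf (c • a) y = _ := Hf_smul_left _ _ _
      rw [this, ha, mul_zero]) (fun l => by rw [wd_snd]; exact Qs_aux2 S l y h) (0, y) h
  exact Hf_self_eq_zero h3

theorem Qs_fst_zero {v : S.V} (h : (v, (0 : Fk (BB k))) ∈ Qs S) : v = 0 := by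
  have := VX_irred S ((Qs S).comap (LinearMap.inl ℂ S.V (Fk (BB k)))) (fun g n u hu => by
    have h1 := Qs_X S g n (z := (u, 0)) hu
    rw [PX_zero_snd] at h1
    exact h1)
  rcases this with h1 | h1
  · have : v ∈ ((Qs S).comap (LinearMap.inl ℂ S.V (Fk (BB k)))) := h
    rw [h1] at this; simpa using this
  · exfalso
    have : S.hwv ∈ ((Qs S).comap (LinearMap.inl ℂ S.V (Fk (BB k)))) := by rw [h1]; trivial
    have h2 := Qs_c S (z := (S.hwv, 0)) this
    apply hwv_not_Wne S
    simpa using h2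

theorem exists_j : ∃ j : S.V →ₗ[ℂ] Fk (BB k), Function.Injective j ∧ j S.hwv = vac ∧ ∀ g n v, j (VX S g n v) = FX k g n (j v) := by
  obtain ⟨j, hj, hu⟩ := graph_map (Qs S) (fun y => Qs_snd_zero S) (fun v => by
    have hv : v ∈ Wall (VX S) S.hwv := by rw [V_Wall]; trivial
    induction hv using Submodule.span_induction with
    | mem v hv =>
      obtain ⟨l, rfl⟩ := hv
      refine ⟨(wd (PX S) (pv0 S) l).2, ?_⟩
      rw [← wd_fst]
      exact Submodule.subset_span ⟨l, rfl⟩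
    | zero => exact ⟨0, zero_mem (Qs S)⟩
    | add a b _ _ ha hb =>
      obtain ⟨y, hy⟩ := ha
      obtain ⟨z, hz⟩ := hb
      exact ⟨y + z, add_mem hy hz⟩
    | smul c a _ ha =>
      obtain ⟨y, hy⟩ := ha
      exact ⟨c • y, Submodule.smul_mem (Qs S) c hy⟩)
  refine ⟨j, ?_, ?_, ?_⟩
  · intro v w hvw
    have := sub_mem (hj v) (hj w)
    rw [Prod.mk_sub_mk, hvw, sub_self] at this
    exact sub_eq_zero.1 (Qs_fst_zero S this)
  · exact hu _ _ (Submodule.subset_span ⟨[], rfl⟩)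
  · intro g n v
    exact hu _ _ (Qs_X S g n (hj v))
end

theorem exists_proj {B : Type} [LinearOrder B] {V : Type*} [AddCommGroup V] [Module ℂ V] (j : V →ₗ[ℂ] Fk B)
    (hj : Function.Injective j) (U : Submodule ℂ V) [FiniteDimensional ℂ U] :
    ∃ Q : V →ₗ[ℂ] V, (∀ v, v - Q v ∈ U) ∧ ∀ v, ∀ w ∈ U, Hf (j w) (j (Q v)) = 0 := by
  let core : InnerProductSpace.Core ℂ V :=
    { inner := fun v w => Hf (j v) (j w)
      conj_inner_symm := fun x y => Hf_conj _ _
      re_inner_nonneg := fun x => by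
        rw [Hf_self]
        simp only [RCLike.re_to_complex, Complex.ofReal_re]
        positivity
      add_left := fun x y z => by rw [map_add, Hf_add_left]
      smul_left := fun x y r => by rw [map_smul, Hf_smul_left]
      definite := fun x h => hj (by rw [map_zero]; exact Hf_self_eq_zero h) }
  let _ : NormedAddCommGroup V := core.toNormedAddCommGroup
  let _ : InnerProductSpace ℂ V := InnerProductSpace.ofCore core.toCore
  refine ⟨LinearMap.id - (U.starProjection).toLinearMap, fun v => ?_, fun v w hw => ?_⟩
  · simp
  · have h1 := Submodule.sub_starProjection_mem_orthogonal (K := U) v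
    exact (Submodule.mem_orthogonal _ _).1 h1 w hw

theorem W_fin {M : Type*} [AddCommGroup M] [Module ℂ M] (X : SL2Gen → ℤ → Module.End ℂ M) (v0 : M) (n : ℕ) (d : ℤ) :
    FiniteDimensional ℂ (W X v0 n d) := by
  apply FiniteDimensional.span_of_finite
  have : Finite SL2Gen := Finite.of_surjective (fun i : Fin 3 => if i = 0 then SL2Gen.e else if i = 1 then SL2Gen.h else SL2Gen.f) (by
    intro g; cases g
    · exact ⟨0, by simp⟩
    · exact ⟨1, by simp⟩
    · exact ⟨2, by simp⟩)
  refine Set.Finite.subset ((List.finite_length_lt (SL2Gen × Fin d.toNat) n).image (fun l => wd X v0 (l.map (fun x => (x.1, (x.2:ℕ)))))) ?_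
  rintro v ⟨l, h1, h2, rfl⟩
  have key : ∀ l : List Var, ∀ D : ℕ, wt l ≤ D → ∃ l' : List (SL2Gen × Fin D), l'.map (fun x => (x.1, (x.2:ℕ))) = l := by
    intro l D
    induction l with
    | nil => intro _; exact ⟨[], rfl⟩
    | cons x l ih =>
      intro h
      rw [wt_cons] at h
      have h3 : 0 ≤ wt l := by unfold wt; positivity
      obtain ⟨l', hl'⟩ := ih (by omega)
      exact ⟨(x.1, ⟨x.2, by omega⟩) :: l', by simp [hl']⟩
  obtain ⟨l', rfl⟩ := key l d.toNat (by omega)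
  exact ⟨l', by simpa using h1, rfl⟩
end PV

namespace PV
set_option linter.unusedSectionVars false
set_option linter.unusedSimpArgs false
set_option linter.unusedVariables false
open Finset

section
variable {M : Type*} [AddCommGroup M] [Module ℂ M]
variable (X : SL2Gen → ℤ → Module.End ℂ M) (v0 : M)

def QP (Q : ℕ → ℤ → M →ₗ[ℂ] M) : Prop := ∀ n d, (∀ v, v - Q n d v ∈ W X v0 n d) ∧ (∀ v ∈ W X v0 n d, Q n d v = 0) ∧
    ∀ g v, Q n d (X g 0 v) = X g 0 (Q n d v)

noncomputable def Psi (Q : ℕ → ℤ → M →ₗ[ℂ] M) : PolySL2 →ₗ[ℂ] M :=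
  (MvPolynomial.basisMonomials Var ℂ).constr ℂ (fun s => Q s.toMultiset.toList.length (wt s.toMultiset.toList) (wd X v0 s.toMultiset.toList))

variable {X v0}
variable {Q : ℕ → ℤ → M →ₗ[ℂ] M}

theorem Psi_mon (s : Var →₀ ℕ) : Psi X v0 Q (MvPolynomial.monomial s 1) = Q s.toMultiset.toList.length (wt s.toMultiset.toList) (wd X v0 s.toMultiset.toList) := by
  have := (MvPolynomial.basisMonomials Var ℂ).constr_basis ℂ (fun s => Q s.toMultiset.toList.length (wt s.toMultiset.toList) (wd X v0 s.toMultiset.toList)) s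
  rwa [MvPolynomial.coe_basisMonomials] at this

theorem Psi_pm {k : ℕ} (hX : Rep k X) (h0 : ∀ g (n : ℤ), 0 ≤ n → X g n v0 = 0) (hQ : QP X v0 Q) (l : List Var) :
    Psi X v0 Q (pm l) = Q l.length (wt l) (wd X v0 l) := by
  rw [pm_eq_monomial, Psi_mon]
  have hp : List.Perm l (Multiset.toFinsupp (l : Multiset Var)).toMultiset.toList := by
    rw [← Multiset.coe_eq_coe]; simp
  rw [← hp.length_eq, ← wt_perm hp]
  rw [eq_comm, ← sub_eq_zero, ← map_sub]
  exact (hQ _ _).2.1 _ (wd_perm hX h0 hp)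

theorem Psi_PP {k : ℕ} (hX : Rep k X) (h0 : ∀ g (n : ℤ), 0 ≤ n → X g n v0 = 0) (hQ : QP X v0 Q) {n : ℕ} {d : ℤ} {q : PolySL2}
    (h : q ∈ PP n d) : Psi X v0 Q q = Q n d (Th X v0 q) := by
  induction h using Submodule.span_induction with
  | mem q hq =>
    obtain ⟨l, rfl, rfl, rfl⟩ := hq
    rw [Psi_pm hX h0 hQ, eq_comm, ← sub_eq_zero, ← map_sub]
    exact (hQ _ _).2.1 _ (Th_pm hX h0 l)
  | zero => simp
  | add a b _ _ ha hb => rw [map_add, map_add, map_add, ha, hb]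
  | smul c a _ ha => rw [map_smul, map_smul, map_smul, ha]

theorem Psi_Rel {k : ℕ} (hX : Rep k X) (h0 : ∀ g (n : ℤ), 0 ≤ n → X g n v0 = 0) (hQ : QP X v0 Q) {n : ℕ} {d : ℤ} {q : PolySL2} {w : M}
    (h : Rel X v0 n d q w) : Psi X v0 Q q = Q n d w := by
  rw [Psi_PP hX h0 hQ h.1, ← sub_eq_zero, ← map_sub]
  exact (hQ _ _).2.1 _ h.2

theorem poly_ind (p : PolySL2) : p ∈ Submodule.span ℂ (Set.range pm) := by
  induction p using MvPolynomial.induction_on' with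
  | monomial s c =>
    have : MvPolynomial.monomial s c = c • pm s.toMultiset.toList := by
      rw [← monomial_eq_pm, MvPolynomial.smul_monomial]; simp
    rw [this]
    exact Submodule.smul_mem _ _ (Submodule.subset_span ⟨_, rfl⟩)
  | add p q hp hq => exact add_mem hp hq

theorem Psi_ad {k : ℕ} (hX : Rep k X) (h0 : ∀ g (n : ℤ), 0 ≤ n → X g n v0 = 0) (hQ : QP X v0 Q) (g : SL2Gen) (p : PolySL2) :
    Psi X v0 Q (ad g p) = X g 0 (Psi X v0 Q p) := by
  have := poly_ind p
  induction this using Submodule.span_induction with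
  | mem q hq =>
    obtain ⟨l, rfl⟩ := hq
    have h1 := Rel_pm hX h0 l
    rw [Psi_Rel hX h0 hQ h1, Psi_Rel hX h0 hQ (h1.ad hX h0 g), (hQ _ _).2.2]
  | zero => simp
  | add a b _ _ ha hb => rw [map_add, map_add, map_add, ha, hb, map_add]
  | smul c a _ ha => rw [(ad g).map_smul, map_smul, map_smul, ha, map_smul]

theorem Psi_pm_sub {k : ℕ} (hX : Rep k X) (h0 : ∀ g (n : ℤ), 0 ≤ n → X g n v0 = 0) (hQ : QP X v0 Q) (l : List Var) :
    Psi X v0 Q (pm l) - wd X v0 l ∈ W X v0 l.length (wt l) := by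
  rw [Psi_pm hX h0 hQ]
  have := neg_mem ((hQ l.length (wt l)).1 (wd X v0 l))
  simpa using this

theorem Psi_surj {k : ℕ} (hX : Rep k X) (h0 : ∀ g (n : ℤ), 0 ≤ n → X g n v0 = 0) (hQ : QP X v0 Q) : 
    Wall X v0 ≤ LinearMap.range (Psi X v0 Q) := by
  have key : ∀ n d, W X v0 n d ≤ LinearMap.range (Psi X v0 Q) := by
    intro n
    induction n with
    | zero =>
      intro d
      apply Submodule.span_le.2
      rintro v ⟨l, h1, h2, rfl⟩
      omega
    | succ n ih =>
      intro d
      apply Submodule.span_le.2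
      rintro v ⟨l, h1, h2, rfl⟩
      have h3 := ih (wt l) (W_mono (by omega) (Psi_pm_sub hX h0 hQ l))
      have := sub_mem (LinearMap.mem_range_self (Psi X v0 Q) (pm l)) h3
      simpa using this
  apply Submodule.span_le.2
  rintro v ⟨l, rfl⟩
  exact key (l.length+1) (wt l) (wd_mem_W (by omega) rfl)

theorem Psi_D {k : ℕ} (hX : Rep k X) (h0 : ∀ g (n : ℤ), 0 ≤ n → X g n v0 = 0) (hQ : QP X v0 Q) (D : Module.End ℂ M)
    (hD : ∀ l, D (wd X v0 l) = ((- wt l : ℤ) : ℂ) • wd X v0 l) (p : PolySL2) (d : ℕ) (hp : p.IsWeightedHomogeneous wtVar d) :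
    D (Psi X v0 Q p) = ((-(d : ℤ) : ℤ) : ℂ) • Psi X v0 Q p := by
  have hW : ∀ n (d : ℤ), ∀ v ∈ W X v0 n d, D v = ((-(d : ℤ) : ℤ) : ℂ) • v := by
    intro n d v hv
    induction hv using Submodule.span_induction with
    | mem v hv =>
      obtain ⟨l, h1, rfl, rfl⟩ := hv; exact hD l
    | zero => simp
    | add a b _ _ ha hb => rw [map_add, ha, hb, smul_add]
    | smul c a _ ha => rw [map_smul, ha, smul_comm]
  rw [MvPolynomial.as_sum p, map_sum, map_sum, Finset.smul_sum]
  apply Finset.sum_congr rfl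
  intro s hs
  have hw : wt s.toMultiset.toList = d := by
    have := hp (MvPolynomial.mem_support_iff.1 hs)
    rw [← this, wt, ← Multiset.sum_coe, ← Multiset.map_coe, Multiset.coe_toList, Finsupp.weight_apply]
    rw [Finsupp.toMultiset_map, Finsupp.sum_toMultiset]
    rw [Finsupp.sum_mapDomain_index (by simp) (by intros; simp [add_mul])]
  have : MvPolynomial.monomial s (p.coeff s) = (p.coeff s) • pm s.toMultiset.toList := by
      rw [← monomial_eq_pm, MvPolynomial.smul_monomial]; simp
  rw [this, map_smul, map_smul, smul_comm]
  congr 1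
  have h1 := W_mono (Nat.le_succ _) (Psi_pm_sub hX h0 hQ s.toMultiset.toList)
  have h2 := add_mem h1 (wd_mem_W (X := X) (v0 := v0) (Nat.lt_succ_self _) (rfl : wt s.toMultiset.toList = _))
  rw [sub_add_cancel] at h2
  rw [hW _ _ _ h2, hw]

theorem Psi_I {k : ℕ} (hX : Rep k X) (h0 : ∀ g (n : ℤ), 0 ≤ n → X g n v0 = 0) (hQ : QP X v0 Q) 
    (hgen : ∀ d : ℕ, Rel X v0 (k+1) ((d:ℤ) + (k + 1)) (eGen k d) 0) (p : PolySL2) (hp : p ∈ idealSL2 k) : Psi X v0 Q p = 0 := by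
  let J : Submodule ℂ PolySL2 := Submodule.span ℂ {q | ∃ n d, Rel X v0 n d q 0}
  have hJ : ∀ q ∈ J, Psi X v0 Q q = 0 := by
    intro q hq
    induction hq using Submodule.span_induction with
    | mem q hq =>
      obtain ⟨n, d, h⟩ := hq
      rw [Psi_Rel hX h0 hQ h, map_zero]
    | zero => simp
    | add a b _ _ ha hb => rw [map_add, ha, hb, add_zero]
    | smul c a _ ha => rw [map_smul, ha, smul_zero]
  have hJX : ∀ x, ∀ q ∈ J, MvPolynomial.X x * q ∈ J := by
    intro x q hq
    induction hq using Submodule.span_induction with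
    | mem q hq =>
      obtain ⟨n, d, h⟩ := hq
      have := h.X_mul hX h0 x rfl
      rw [map_zero] at this
      exact Submodule.subset_span ⟨_, _, this⟩
    | zero => simp
    | add a b _ _ ha hb => rw [mul_add]; exact add_mem ha hb
    | smul c a _ ha => rw [mul_smul_comm]; exact Submodule.smul_mem _ _ ha
  have hJad : ∀ g, ∀ q ∈ J, ad g q ∈ J := by
    intro x q hq
    induction hq using Submodule.span_induction with
    | mem q hq =>
      obtain ⟨n, d, h⟩ := hq
      have := h.ad hX h0 x
      rw [map_zero] at this
      exact Submodule.subset_span ⟨_, _, this⟩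
    | zero => simp
    | add a b _ _ ha hb => rw [map_add]; exact add_mem ha hb
    | smul c a _ ha => rw [(ad x).map_smul]; exact Submodule.smul_mem _ _ ha
  have hJm : ∀ r, ∀ q ∈ J, r * q ∈ J := by
    intro r
    induction r using MvPolynomial.induction_on with
    | C c => intro q hq; rw [MvPolynomial.C_mul']; exact Submodule.smul_mem _ _ hq
    | add a b ha hb => intro q hq; rw [add_mul]; exact add_mem (ha q hq) (hb q hq)
    | mul_X a x ha => intro q hq; rw [mul_assoc]; exact ha _ (hJX x q hq)
  have hg : gClosure {p : PolySL2 | ∃ d : ℕ, p = eGen k d} ≤ J := by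
    apply sInf_le
    refine ⟨?_, fun p hp => ⟨hJad .e p hp, hJad .h p hp, hJad .f p hp⟩⟩
    rintro p ⟨d, rfl⟩
    exact Submodule.subset_span ⟨_, _, hgen d⟩
  apply hJ
  unfold idealSL2 at hp
  induction hp using Submodule.span_induction with
  | mem q hq => exact hg hq
  | zero => exact zero_mem _
  | add a b _ _ ha hb => exact add_mem ha hb
  | smul c a _ ha => rw [smul_eq_mul]; exact hJm _ _ ha
end

theorem exists_Q {k : ℕ} {V : Type*} [AddCommGroup V] [Module ℂ V] {X : SL2Gen → ℤ → Module.End ℂ V} {v0 : V}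
    (hX : Rep k X) (h0 : ∀ g (n : ℤ), 0 ≤ n → X g n v0 = 0)
    (j : V →ₗ[ℂ] Fk (BB k)) (hj : Function.Injective j) (hjX : ∀ g n v, j (X g n v) = FX k g n (j v)) :
    ∃ Q, QP X v0 Q := by
  have : ∀ n d, ∃ Q : V →ₗ[ℂ] V, (∀ v, v - Q v ∈ W X v0 n d) ∧ ∀ v, ∀ w ∈ W X v0 n d, Hf (j w) (j (Q v)) = 0 := by
    intro n d
    have := W_fin X v0 n d
    exact exists_proj j hj _
  choose Q hQ1 hQ2 using this
  have hz : ∀ n d v, v ∈ W X v0 n d → (∀ w ∈ W X v0 n d, Hf (j w) (j v) = 0) → v = 0 := by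
    intro n d v h1 h2
    apply hj
    rw [map_zero]
    exact Hf_self_eq_zero (h2 v h1)
  refine ⟨Q, fun n d => ⟨hQ1 n d, fun v hv => hz n d _ ?_ (hQ2 n d v), fun g v => ?_⟩⟩
  · have := sub_mem hv (hQ1 n d v)
    simpa using this
  · rw [← sub_eq_zero]
    apply hz n d
    · have h1 := hQ1 n d (X g 0 v)
      have h2 := X0_W hX h0 g (hQ1 n d v)
      have := sub_mem h2 h1
      rw [map_sub] at this
      convert this using 1; abel
    · intro w hw
      rw [map_sub, sub_eq_add_neg, Hf_add_right, Hf_neg_right, hQ2 n d _ w hw, hjX, FX_adj, ← hjX]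
      rw [hQ2 n d _ _ (by rw [neg_zero]; exact X0_W hX h0 _ hw)]
      simp
end PV

namespace PV
set_option linter.unusedSectionVars false
set_option linter.unusedSimpArgs false
set_option linter.unusedVariables false
open Finset

/-! combinatorics of monomials -/
def ta : SL2Gen → ℤ
  | .e => 0
  | .h => 1
  | .f => 2
def Nv (x : Var) : ℤ := 2 * x.2 + ta x.1

def LC (f : Var → ℤ) (t : Var →₀ ℕ) : ℤ := t.sum fun x n => (n:ℤ) * f x

theorem LC_add (f : Var → ℤ) (s t : Var →₀ ℕ) : LC f (s + t) = LC f s + LC f t := by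
  unfold LC
  classical
  rw [Finsupp.sum_add_index' (by simp) (by intros; push_cast; ring)]
theorem LC_zero (f : Var → ℤ) : LC f 0 = 0 := by simp [LC]
theorem LC_single (f : Var → ℤ) (x : Var) (n : ℕ) : LC f (Finsupp.single x n) = n * f x := by
  unfold LC
  rw [Finsupp.sum_single_index (by simp)]
theorem LC_sum {ι : Type*} (f : Var → ℤ) (T : Finset ι) (t : ι → Var →₀ ℕ) : LC f (∑ i ∈ T, t i) = ∑ i ∈ T, LC f (t i) := by
  classical
  induction T using Finset.induction_on with
  | empty => simp [LC_zero]
  | insert a T ha ih => rw [Finset.sum_insert ha, Finset.sum_insert ha, LC_add, ih]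
theorem LC_fn (f g : Var → ℤ) (t : Var →₀ ℕ) : LC (fun x => f x + g x) t = LC f t + LC g t := by
  simp only [LC, Finsupp.sum, mul_add, Finset.sum_add_distrib]
theorem LC_fsmul (c : ℤ) (f : Var → ℤ) (t : Var →₀ ℕ) : LC (fun x => c * f x) t = c * LC f t := by
  simp only [LC, Finsupp.sum, Finset.mul_sum]
  exact Finset.sum_congr rfl fun x _ => by ring

def IsTri (x1 x2 x3 : Var) : Prop := ∃ m : ℕ,
  (x1 = (.e, m+1) ∧ x2 = (.f, m) ∧ x3 = (.h, m+1)) ∨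
  (x1 = (.e, m+1) ∧ x2 = (.f, m) ∧ x3 = (.h, m)) ∨
  (x1 = (.e, m) ∧ x2 = (.h, m) ∧ x3 = (.e, m+1)) ∨
  (x1 = (.f, m) ∧ x2 = (.h, m+1) ∧ x3 = (.f, m+1))

def Adm (k : ℕ) (s : Var →₀ ℕ) : Prop := ∀ x1 x2 x3, IsTri x1 x2 x3 → s x1 + s x2 + s x3 ≤ k

theorem sq_gap (a : ℤ) : 0 ≤ a * (a - 1) ∧ (a * (a-1) = 0 ↔ a = 0 ∨ a = 1) := by
  constructor
  · rcases le_or_gt a 0 with h | h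
    · nlinarith
    · nlinarith
  · rw [mul_eq_zero, sub_eq_zero]

theorem sq_odd (a : ℤ) : 0 ≤ (2*a+1)*(2*a+1) - 1 ∧ ((2*a+1)*(2*a+1) - 1 = 0 ↔ a = 0 ∨ a = -1) := by
  have : (2*a+1)*(2*a+1) - 1 = 4 * (a * (a+1)) := by ring
  rw [this]
  constructor
  · rcases le_or_gt 0 a with h | h
    · positivity
    · nlinarith
  · constructor
    · intro h
      have : a * (a+1) = 0 := by omega
      rcases mul_eq_zero.1 this with h | h
      · left; exact h
      · right; omega
    · rintro (rfl | rfl) <;> norm_num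

theorem tri_gamma {x1 x2 x3 : Var} (h : IsTri x1 x2 x3) : ∃ α β δ : ℤ, ∀ x, 0 ≤ Nv x * Nv x + (α * Nv x + (β * ta x.1 + δ * 1)) ∧
    (Nv x * Nv x + (α * Nv x + (β * ta x.1 + δ * 1)) = 0 ↔ x = x1 ∨ x = x2 ∨ x = x3) := by
  obtain ⟨m, h⟩ := h
  rcases h with ⟨rfl, rfl, rfl⟩ | ⟨rfl, rfl, rfl⟩ | ⟨rfl, rfl, rfl⟩ | ⟨rfl, rfl, rfl⟩
  · refine ⟨-2*(2*m+2)-1, 0, (2*m+2)*(2*m+3), fun x => ?_⟩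
    have h := sq_gap (Nv x - (2*m+2))
    have e : Nv x * Nv x + ((-2*(2*m+2)-1) * Nv x + (0 * ta x.1 + (2*m+2)*(2*m+3) * 1)) = (Nv x - (2*m+2)) * (Nv x - (2*m+2) - 1) := by ring
    rw [e]; refine ⟨h.1, h.2.trans ?_⟩
    obtain ⟨g, n⟩ := x
    cases g <;> simp [Nv, ta] <;> omega
  · refine ⟨-2*(2*m+1)-1, 0, (2*m+1)*(2*m+2), fun x => ?_⟩
    have h := sq_gap (Nv x - (2*m+1))
    have e : Nv x * Nv x + ((-2*(2*m+1)-1) * Nv x + (0 * ta x.1 + (2*m+1)*(2*m+2) * 1)) = (Nv x - (2*m+1)) * (Nv x - (2*m+1) - 1) := by ring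
    rw [e]; refine ⟨h.1, h.2.trans ?_⟩
    obtain ⟨g, n⟩ := x
    cases g <;> simp [Nv, ta] <;> omega
  · refine ⟨-2*(2*m+1), 1, (2*m+1)*(2*m+1)-1, fun x => ?_⟩
    have e : Nv x * Nv x + (-2*(2*m+1) * Nv x + (1 * ta x.1 + ((2*m+1)*(2*m+1)-1) * 1)) = (Nv x - (2*m+1)) * (Nv x - (2*m+1)) - (1 - ta x.1) := by ring
    rw [e]
    obtain ⟨g, n⟩ := x
    cases g <;> simp only [Nv, ta]
    · have h := sq_odd (n - m - 1)
      have e2 : (2 * (n:ℤ) + 0 - (2*m+1)) * (2 * (n:ℤ) + 0 - (2*m+1)) - (1 - 0) = (2*(n-m-1)+1)*(2*(n-m-1)+1)-1 := by ring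
      rw [e2]
      refine ⟨h.1, h.2.trans ?_⟩
      simp; omega
    · refine ⟨by nlinarith [mul_self_nonneg (2 * (n:ℤ) + 1 - (2*m+1))], ?_⟩
      rw [sub_self, sub_zero, mul_self_eq_zero]
      simp; omega
    · refine ⟨by nlinarith [mul_self_nonneg (2 * (n:ℤ) + 2 - (2*m+1))], ?_⟩
      constructor
      · intro h; nlinarith [mul_self_nonneg (2 * (n:ℤ) + 2 - (2*m+1))]
      · simp
  · refine ⟨-2*(2*m+3), -1, (2*m+3)*(2*m+3)+1, fun x => ?_⟩
    have e : Nv x * Nv x + (-2*(2*m+3) * Nv x + (-1 * ta x.1 + ((2*m+3)*(2*m+3)+1) * 1)) = (Nv x - (2*m+3)) * (Nv x - (2*m+3)) - (ta x.1 - 1) := by ring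
    rw [e]
    obtain ⟨g, n⟩ := x
    cases g <;> simp only [Nv, ta]
    · refine ⟨by nlinarith [mul_self_nonneg (2 * (n:ℤ) + 0 - (2*m+3))], ?_⟩
      constructor
      · intro h; nlinarith [mul_self_nonneg (2 * (n:ℤ) + 0 - (2*m+3))]
      · simp
    · refine ⟨by nlinarith [mul_self_nonneg (2 * (n:ℤ) + 1 - (2*m+3))], ?_⟩
      rw [sub_self, sub_zero, mul_self_eq_zero]
      simp; omega
    · have h := sq_odd (n - m - 1)
      have e2 : (2 * (n:ℤ) + 2 - (2*m+3)) * (2 * (n:ℤ) + 2 - (2*m+3)) - (2 - 1) = (2*(n-m-1)+1)*(2*(n-m-1)+1)-1 := by ring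
      rw [e2]
      refine ⟨h.1, h.2.trans ?_⟩
      simp; omega

theorem tri_ne {x1 x2 x3 : Var} (h : IsTri x1 x2 x3) : x1 ≠ x2 ∧ x1 ≠ x3 ∧ x2 ≠ x3 := by
  obtain ⟨m, h⟩ := h
  rcases h with ⟨rfl, rfl, rfl⟩ | ⟨rfl, rfl, rfl⟩ | ⟨rfl, rfl, rfl⟩ | ⟨rfl, rfl, rfl⟩ <;> simp

theorem tri_indep {x1 x2 x3 : Var} (h : IsTri x1 x2 x3) (a b c : ℤ) (h1 : a + b + c = 0)
    (h2 : a * Nv x1 + b * Nv x2 + c * Nv x3 = 0) (h3 : a * ta x1.1 + b * ta x2.1 + c * ta x3.1 = 0) : a = 0 ∧ b = 0 ∧ c = 0 := by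
  obtain ⟨m, h⟩ := h
  have key : a * (Nv x1 - 2 * m) + b * (Nv x2 - 2*m) + c * (Nv x3 - 2*m) = 0 := by linear_combination h2 - 2 * m * h1
  rcases h with ⟨rfl, rfl, rfl⟩ | ⟨rfl, rfl, rfl⟩ | ⟨rfl, rfl, rfl⟩ | ⟨rfl, rfl, rfl⟩ <;> simp only [Nv, ta] at key h3 <;> push_cast at key <;>
    ring_nf at key <;> omega

def Sup3 (x1 x2 x3 : Var) (t : Var →₀ ℕ) : Prop := t = Finsupp.single x1 (t x1) + Finsupp.single x2 (t x2) + Finsupp.single x3 (t x3)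

theorem sup3_of {x1 x2 x3 : Var} (h : IsTri x1 x2 x3) (t : Var →₀ ℕ) (ht : ∀ x, t x ≠ 0 → x = x1 ∨ x = x2 ∨ x = x3) : Sup3 x1 x2 x3 t := by
  obtain ⟨h1, h2, h3⟩ := tri_ne h
  unfold Sup3
  ext x
  simp only [Finsupp.add_apply, Finsupp.single_apply]
  by_cases hx : t x = 0
  · split_ifs <;> simp_all
  · rcases ht x hx with rfl | rfl | rfl <;> simp_all [Ne.symm]

def Sq (t : Var →₀ ℕ) : ℤ := LC (fun x => Nv x * Nv x) t

theorem tri_min {x1 x2 x3 : Var} (h : IsTri x1 x2 x3) (r t : Var →₀ ℕ) (hr : Sup3 x1 x2 x3 r)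
    (h1 : LC (fun _ => 1) t = LC (fun _ => 1) r) (h2 : LC Nv t = LC Nv r) (h3 : LC (fun x => ta x.1) t = LC (fun x => ta x.1) r) :
    t ≠ r → Sq r < Sq t := by
  obtain ⟨α, β, δ, hg⟩ := tri_gamma h
  have hs : ∀ t, LC (fun x => Nv x * Nv x + (α * Nv x + (β * ta x.1 + δ * 1))) t = Sq t + (α * LC Nv t + (β * LC (fun x => ta x.1) t + δ * LC (fun _ => 1) t)) := by
    intro t
    rw [LC_fn, LC_fn, LC_fn, LC_fsmul, LC_fsmul, LC_fsmul]; rfl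
  have hr0 : LC (fun x => Nv x * Nv x + (α * Nv x + (β * ta x.1 + δ * 1))) r = 0 := by
    rw [hr, LC_add, LC_add, LC_single, LC_single, LC_single, (hg x1).2.2 (by simp), (hg x2).2.2 (by simp), (hg x3).2.2 (by simp)]
    ring
  intro hne
  have ht0 : 0 < LC (fun x => Nv x * Nv x + (α * Nv x + (β * ta x.1 + δ * 1))) t := by
    by_contra hle
    apply hne
    have hz : ∀ x ∈ t.support, (t x : ℤ) * (Nv x * Nv x + (α * Nv x + (β * ta x.1 + δ * 1))) = 0 := by
      have hnn : ∀ x ∈ t.support, 0 ≤ (t x : ℤ) * (Nv x * Nv x + (α * Nv x + (β * ta x.1 + δ * 1))) := fun x _ => mul_nonneg (by positivity) (hg x).1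
      refine (Finset.sum_eq_zero_iff_of_nonneg hnn).1 (le_antisymm ?_ (Finset.sum_nonneg hnn))
      exact not_lt.1 hle
    have ht : Sup3 x1 x2 x3 t := by
      apply sup3_of h
      intro x hx
      have := hz x (by simpa using hx)
      rw [mul_eq_zero] at this
      exact (hg x).2.1 (this.resolve_left (by exact_mod_cast hx))
    rw [ht, hr] at h1 h2 h3
    simp only [LC_add, LC_single] at h1 h2 h3
    have := tri_indep h ((t x1 : ℤ) - r x1) (t x2 - r x2) (t x3 - r x3) (by linear_combination h1) (by linear_combination h2) (by linear_combination h3)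
    have e1 : t x1 = r x1 := by omega
    have e2 : t x2 = r x2 := by omega
    have e3 : t x3 = r x3 := by omega
    calc t = _ := ht
      _ = _ := by rw [e1, e2, e3]
      _ = r := hr.symm
  rw [hs] at ht0 hr0
  rw [h1, h2, h3] at ht0
  linarith

/-! the relations -/
noncomputable def ys (x : Var) : PolySL2 := match x.1 with
  | .e => MvPolynomial.X x
  | .h => (-1:ℂ) • MvPolynomial.X x
  | .f => (-1:ℂ) • MvPolynomial.X x

noncomputable def yc : SL2Gen → ℂ
  | .e => 1
  | .h => -1
  | .f => -1
theorem ys_eq (x : Var) : ys x = yc x.1 • MvPolynomial.X x := by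
  obtain ⟨g, m⟩ := x
  cases g <;> simp [ys, yc]
theorem yc_ne (g : SL2Gen) : yc g ≠ 0 := by cases g <;> simp [yc]

noncomputable instance : Fintype SL2Gen := ⟨{.e, .h, .f}, fun x => by cases x <;> simp⟩
theorem sum_gen {M : Type*} [AddCommMonoid M] (F : SL2Gen → M) : ∑ g, F g = F .e + F .h + F .f := by
  have : (Finset.univ : Finset SL2Gen) = {.e, .h, .f} := rfl
  rw [this, Finset.sum_insert (by simp), Finset.sum_insert (by simp), Finset.sum_singleton, add_assoc]

def tan : SL2Gen → ℕ
  | .e => 0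
  | .h => 1
  | .f => 2
theorem tan_ta (g : SL2Gen) : ((tan g : ℕ) : ℤ) = ta g := by cases g <;> rfl

open Polynomial in
noncomputable def Yp (m : ℕ) : Polynomial PolySL2 := ∑ g : SL2Gen, Polynomial.monomial (tan g) (ys (g, m))

def Fl (q : Polynomial PolySL2) : Prop := ∀ j, adF (q.coeff j) = (Polynomial.derivative q).coeff j

theorem Fl.mul {p q : Polynomial PolySL2} (hp : Fl p) (hq : Fl q) : Fl (p * q) := by
  intro j
  rw [Polynomial.derivative_mul, Polynomial.coeff_add, Polynomial.coeff_mul, Polynomial.coeff_mul, Polynomial.coeff_mul, map_sum, ← Finset.sum_add_distrib]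
  apply Finset.sum_congr rfl
  intro x _
  rw [Derivation.leibniz, hp, hq, smul_eq_mul, smul_eq_mul]; ring
theorem Fl.one : Fl 1 := by
  intro j
  rw [Polynomial.derivative_one, Polynomial.coeff_one]
  split_ifs <;> simp
theorem Fl.sum {ι : Type*} (T : Finset ι) (q : ι → Polynomial PolySL2) (h : ∀ i ∈ T, Fl (q i)) : Fl (∑ i ∈ T, q i) := by
  intro j
  rw [Polynomial.derivative_sum, Polynomial.finsetSum_coeff, Polynomial.finsetSum_coeff, map_sum]
  exact Finset.sum_congr rfl fun i hi => h i hi j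
theorem Fl.prod {ι : Type*} (T : Finset ι) (q : ι → Polynomial PolySL2) (h : ∀ i ∈ T, Fl (q i)) : Fl (∏ i ∈ T, q i) := by
  classical
  induction T using Finset.induction_on with
  | empty => simpa using Fl.one
  | insert a T ha ih =>
    rw [Finset.prod_insert ha]
    exact (h a (by simp)).mul (ih fun i hi => h i (by simp [hi]))
theorem Fl_Yp (m : ℕ) : Fl (Yp m) := by
  intro j
  unfold Yp
  rw [sum_gen]
  simp only [tan, ys, Polynomial.derivative_add, Polynomial.derivative_monomial, Polynomial.coeff_add, Polynomial.coeff_monomial]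
  rcases j with _ | _ | _ | j
  · simp [adF, MvPolynomial.mkDerivation_X]
  · simp [adF, MvPolynomial.mkDerivation_X, MvPolynomial.smul_eq_C_mul]
    rw [show (MvPolynomial.C (2:ℂ) : PolySL2) = 2 from map_ofNat _ 2]; ring
  · simp [adF, MvPolynomial.mkDerivation_X]
  · simp

def MS (k d : ℕ) : Finset (Fin (k+1) → ℕ) := (Fintype.piFinset fun _ : Fin (k + 1) => Finset.range (d + 1)).filter
      (fun m => ∑ i, m i = d)

noncomputable def Qd (k d : ℕ) : Polynomial PolySL2 := ∑ m ∈ MS k d, ∏ i, Yp (m i)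

theorem Qd_coeff (k d j : ℕ) : (Qd k d).coeff j = ∑ m ∈ MS k d, ∑ g : Fin (k+1) → SL2Gen, if ∑ i, tan (g i) = j then ∏ i, ys (g i, m i) else 0 := by
  unfold Qd
  rw [Polynomial.finsetSum_coeff]
  apply Finset.sum_congr rfl
  intro m _
  unfold Yp
  rw [Finset.prod_univ_sum, Polynomial.finsetSum_coeff, Fintype.piFinset_univ]
  apply Finset.sum_congr rfl
  intro g _
  have : ∀ T : Finset (Fin (k+1)), ∏ i ∈ T, Polynomial.monomial (tan (g i)) (ys (g i, m i)) = Polynomial.monomial (∑ i ∈ T, tan (g i)) (∏ i ∈ T, ys (g i, m i)) := by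
    intro T
    induction T using Finset.induction_on with
    | empty => simp
    | insert a T ha ih => rw [Finset.prod_insert ha, ih, Polynomial.monomial_mul_monomial, Finset.sum_insert ha, Finset.prod_insert ha]
  rw [this, Polynomial.coeff_monomial]

theorem tan_zero (g : SL2Gen) : tan g = 0 ↔ g = .e := by cases g <;> simp [tan]

theorem Qd_zero (k d : ℕ) : (Qd k d).coeff 0 = eGen k d := by
  rw [Qd_coeff]
  unfold eGen
  apply Finset.sum_congr rfl
  intro m _
  rw [Finset.sum_eq_single (fun _ => SL2Gen.e)]
  · simp [tan, ys]
  · intro g _ hg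
    rw [if_neg]
    intro h
    rw [Finset.sum_eq_zero_iff] at h
    exact hg (funext fun i => (tan_zero _).1 (h i (by simp)))
  · simp

theorem Qd_mem (k d j : ℕ) : (Qd k d).coeff j ∈ gClosure {p : PolySL2 | ∃ d : ℕ, p = eGen k d} := by
  have hst : ∀ p ∈ gClosure {p : PolySL2 | ∃ d : ℕ, p = eGen k d}, adF p ∈ gClosure {p : PolySL2 | ∃ d : ℕ, p = eGen k d} := by
    intro p hp
    unfold gClosure at *
    rw [Submodule.mem_sInf] at *
    intro U hU
    exact (hU.2 p (hp U hU)).2.2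
  induction j with
  | zero =>
    rw [Qd_zero]
    unfold gClosure
    rw [Submodule.mem_sInf]
    intro U hU
    exact hU.1 ⟨d, rfl⟩
  | succ j ih =>
    have h1 : Fl (Qd k d) := Fl.sum _ _ fun m _ => Fl.prod _ _ fun i _ => Fl_Yp _
    have h2 := hst _ ih
    rw [h1 j, Polynomial.coeff_derivative] at h2
    have : (Qd k d).coeff (j+1) = ((j:ℂ)+1)⁻¹ • ((Qd k d).coeff (j+1) * ((j:PolySL2)+1)) := by
      have e : (Qd k d).coeff (j+1) * ((j:PolySL2)+1) = ((j:ℂ)+1) • (Qd k d).coeff (j+1) := by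
        rw [MvPolynomial.smul_eq_C_mul]; simp; ring
      rw [e, smul_smul, inv_mul_cancel₀ (by exact_mod_cast Nat.succ_ne_zero j), one_smul]
    rw [this]
    exact Submodule.smul_mem _ _ h2

theorem Qd_ideal (k d j : ℕ) : (Qd k d).coeff j ∈ idealSL2 k := Ideal.subset_span (Qd_mem k d j)
end PV

namespace PV
set_option linter.unusedSectionVars false
set_option linter.unusedSimpArgs false
set_option linter.unusedVariables false
open Finset

noncomputable def fs {n : ℕ} (a : Fin n → Var) : Var →₀ ℕ := ∑ i, Finsupp.single (a i) 1

theorem fs_LC {n : ℕ} (a : Fin n → Var) (f : Var → ℤ) : LC f (fs a) = ∑ i, f (a i) := by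
  unfold fs
  rw [LC_sum]
  exact Finset.sum_congr rfl fun i _ => by rw [LC_single]; simp

theorem fs_prod {n : ℕ} (a : Fin n → Var) : ∏ i, (MvPolynomial.X (a i) : PolySL2) = MvPolynomial.monomial (fs a) 1 := by
  unfold fs
  rw [MvPolynomial.monomial_sum_one]; rfl

theorem fs_surj (t : Var →₀ ℕ) {n : ℕ} (h : LC (fun _ => 1) t = n) : ∃ a : Fin n → Var, fs a = t := by
  have hl : t.toMultiset.toList.length = n := by
    have : (t.toMultiset.card : ℤ) = n := by
      rw [← h, Finsupp.card_toMultiset]; simp [LC, Finsupp.sum]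
    rw [Multiset.length_toList]; exact_mod_cast this
  subst hl
  refine ⟨fun i => t.toMultiset.toList.get i, ?_⟩
  unfold fs
  have h1 : ∀ l : List Var, ∑ i : Fin l.length, Finsupp.single (l.get i) 1 = Multiset.toFinsupp (l : Multiset Var) := by
    intro l
    induction l with
    | nil => simp
    | cons x l ih =>
      rw [← Multiset.cons_coe, ← Multiset.singleton_add, map_add, ← ih]
      simp [Fin.sum_univ_succ, Multiset.toFinsupp_singleton]
  rw [h1]; simp

theorem fs_sign {n : ℕ} (a : Fin n → Var) : ∏ i, yc (a i).1 = (fs a).prod (fun x m => yc x.1 ^ m) := by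
  unfold fs
  rw [← Finsupp.prod_finsetSum_index (by simp) (by intros; exact pow_add _ _ _)]
  exact Finset.prod_congr rfl fun i _ => by rw [Finsupp.prod_single_index (by simp)]; simp

theorem exists_parts (a b c n : ℕ) (h : n ≤ a + b + c) : ∃ a' b' c', a' ≤ a ∧ b' ≤ b ∧ c' ≤ c ∧ a' + b' + c' = n :=
  ⟨min a n, min b (n - min a n), n - min a n - min b (n - min a n), by omega, by omega, by omega, by omega⟩

noncomputable def TT (k : ℕ) : Submodule ℂ PolySL2 := (idealSL2 k).restrictScalars ℂ ⊔
  Submodule.span ℂ {p | ∃ s, Adm k s ∧ MvPolynomial.monomial s 1 = p}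

theorem Sq_le (t : Var →₀ ℕ) : Sq t ≤ (LC Nv t)^2 := by
  have hN : ∀ x, 0 ≤ Nv x := by
    rintro ⟨g, m⟩; cases g <;> simp [Nv, ta] <;> positivity
  induction t using Finsupp.induction_linear with
  | zero => simp [Sq, LC_zero]
  | add s t hs ht =>
    have e : Sq (s + t) = Sq s + Sq t := LC_add _ _ _
    have h1 : 0 ≤ LC Nv s := Finset.sum_nonneg fun x _ => mul_nonneg (by positivity) (hN x)
    have h2 : 0 ≤ LC Nv t := Finset.sum_nonneg fun x _ => mul_nonneg (by positivity) (hN x)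
    rw [e, LC_add]
    nlinarith [mul_nonneg h1 h2]
  | single x n =>
    unfold Sq
    rw [LC_single, LC_single]
    have h := hN x
    have : (n:ℤ) ≤ n^2 := by rcases n with _ | n; simp; push_cast; nlinarith
    nlinarith [mul_self_nonneg (Nv x)]

theorem TT_step (k : ℕ) (s : Var →₀ ℕ) (hs : ¬ Adm k s)
    (ih : ∀ t, LC Nv t = LC Nv s → Sq s < Sq t → MvPolynomial.monomial t 1 ∈ TT k) : MvPolynomial.monomial s 1 ∈ TT k := by
  classical
  unfold Adm at hs
  push Not at hs
  obtain ⟨x1, x2, x3, htri, hgt⟩ := hs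
  obtain ⟨a', b', c', ha, hb, hc, hsum⟩ := exists_parts (s x1) (s x2) (s x3) (k+1) (by omega)
  obtain ⟨n1, n2, n3⟩ := tri_ne htri
  set r : Var →₀ ℕ := Finsupp.single x1 a' + Finsupp.single x2 b' + Finsupp.single x3 c' with hr
  have hr1 : r x1 = a' := by simp [hr, Finsupp.single_apply, n1, n2, n3, n1.symm, n2.symm, n3.symm]
  have hr2 : r x2 = b' := by simp [hr, Finsupp.single_apply, n1, n2, n3, n1.symm, n2.symm, n3.symm]
  have hr3 : r x3 = c' := by simp [hr, Finsupp.single_apply, n1, n2, n3, n1.symm, n2.symm, n3.symm]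
  have hsup : Sup3 x1 x2 x3 r := by unfold Sup3; rw [hr1, hr2, hr3]
  have hle : r ≤ s := by
    intro x
    rw [hr]
    simp only [Finsupp.add_apply, Finsupp.single_apply]
    split_ifs <;> simp_all
  obtain ⟨u, rfl⟩ := exists_add_of_le hle
  have hdeg : LC (fun _ => 1) r = ((k + 1 : ℕ) : ℤ) := by
    rw [hr]; simp only [LC_add, LC_single]; push_cast [← hsum]; ring
  obtain ⟨a, hfa⟩ := fs_surj r hdeg
  -- the relation
  have hI := Qd_ideal k (∑ i, (a i).2) (∑ i, tan (a i).1)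
  rw [Qd_coeff] at hI
  set d := ∑ i, (a i).2 with hd
  set j := ∑ i, tan (a i).1 with hj
  have hI2 := Ideal.mul_mem_right (MvPolynomial.monomial u 1) _ hI
  have key : ∀ m ∈ MS k d, ∀ g : Fin (k+1) → SL2Gen, ∃ c : ℂ, ∃ q ∈ TT k,
      (c = 0 ∨ c = ∏ i, yc (a i).1) ∧ (g = (fun i => (a i).1) → m = (fun i => (a i).2) → c = ∏ i, yc (a i).1) ∧ 
      ((if ∑ i, tan (g i) = j then ∏ i, ys (g i, m i) else 0) * MvPolynomial.monomial u 1 = c • MvPolynomial.monomial (r + u) 1 + q) := by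
    intro m hm g
    by_cases hg : ∑ i, tan (g i) = j
    · rw [if_pos hg]
      have e1 : ∏ i, ys (g i, m i) = (∏ i, yc (g i)) • MvPolynomial.monomial (fs fun i => (g i, m i)) 1 := by
        rw [← fs_prod, ← Finset.prod_smul]
        exact Finset.prod_congr rfl fun i _ => ys_eq _
      have e2 : (∏ i, ys (g i, m i)) * MvPolynomial.monomial u 1 = (∏ i, yc (g i)) • MvPolynomial.monomial ((fs fun i => (g i, m i)) + u) 1 := by
        rw [e1, smul_mul_assoc, MvPolynomial.monomial_mul]; simp
      rw [e2]
      by_cases hrr : (fs fun i => (g i, m i)) = r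
      · refine ⟨∏ i, yc (g i), 0, zero_mem _, ?_, ?_, ?_⟩
        · right
          have h1 := fs_sign (fun i => (g i, m i))
          rw [hrr, ← hfa, ← fs_sign] at h1
          exact h1
        · rintro rfl _; rfl
        · rw [hrr, add_zero]
      · refine ⟨0, _, ?_, Or.inl rfl, ?_, by rw [zero_smul, zero_add]⟩
        · apply Submodule.smul_mem
          have hmd : ∑ i, m i = d := by
            have := hm
            simp only [MS, Finset.mem_filter] at this
            exact this.2
          have h1 : LC (fun _ => 1) (fs fun i => (g i, m i)) = LC (fun _ => 1) r := by rw [hdeg, fs_LC]; simp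
          have h3 : LC (fun x => ta x.1) (fs fun i => (g i, m i)) = LC (fun x => ta x.1) r := by
            rw [← hfa, fs_LC, fs_LC]
            simp only [← tan_ta]
            exact_mod_cast hg
          have h2 : LC Nv (fs fun i => (g i, m i)) = LC Nv r := by
            have e : ∀ t, LC Nv t = 2 * LC (fun x => (x.2 : ℤ)) t + LC (fun x => ta x.1) t := by
              intro t
              rw [← LC_fsmul, ← LC_fn]; rfl
            rw [e, e, h3]
            congr 2
            rw [← hfa, fs_LC, fs_LC]
            exact_mod_cast hmd
          apply ih
          · rw [LC_add, LC_add, h2]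
          · have := tri_min htri r _ hsup h1 h2 h3 hrr
            unfold Sq at *
            rw [LC_add _ r u, LC_add _ (fs fun i => (g i, m i)) u]; omega
        · intro h1 h2
          exfalso; apply hrr
          rw [← hfa, h1, h2]
    · rw [if_neg hg]
      refine ⟨0, 0, zero_mem _, Or.inl rfl, ?_, by simp⟩
      rintro rfl _
      exact absurd rfl hg
  have hma : (fun i => (a i).2) ∈ MS k d := by
    simp only [MS, Finset.mem_filter, Fintype.mem_piFinset, Finset.mem_range]
    refine ⟨fun i => ?_, hd.symm⟩
    rw [hd]
    exact Nat.lt_succ_of_le (Finset.single_le_sum (f := fun i => (a i).2) (fun _ _ => Nat.zero_le _) (Finset.mem_univ i))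
  set ε := ∏ i, yc (a i).1 with hε
  have hε0 : ε ≠ 0 := Finset.prod_ne_zero_iff.2 fun i _ => yc_ne _
  choose! c q hq hc hc1 he using key
  have hfin : (∑ m ∈ MS k d, ∑ g : Fin (k+1) → SL2Gen, c m g) • (MvPolynomial.monomial (r + u) 1 : PolySL2) ∈ TT k := by
    have h1 : (∑ m ∈ MS k d, ∑ g : Fin (k+1) → SL2Gen, if ∑ i, tan (g i) = j then ∏ i, ys (g i, m i) else 0) * MvPolynomial.monomial u 1
        = (∑ m ∈ MS k d, ∑ g : Fin (k+1) → SL2Gen, c m g) • (MvPolynomial.monomial (r + u) 1 : PolySL2) + ∑ m ∈ MS k d, ∑ g : Fin (k+1) → SL2Gen, q m g := by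
      rw [Finset.sum_mul, Finset.sum_smul, ← Finset.sum_add_distrib]
      apply Finset.sum_congr rfl
      intro m hm
      rw [Finset.sum_mul, Finset.sum_smul, ← Finset.sum_add_distrib]
      exact Finset.sum_congr rfl fun g _ => he m hm g
    rw [h1] at hI2
    have h2 : ∑ m ∈ MS k d, ∑ g : Fin (k+1) → SL2Gen, q m g ∈ TT k := sum_mem fun m hm => sum_mem fun g _ => hq m hm g
    have h3 : (∑ m ∈ MS k d, ∑ g : Fin (k+1) → SL2Gen, c m g) • (MvPolynomial.monomial (r + u) 1 : PolySL2) + ∑ m ∈ MS k d, ∑ g : Fin (k+1) → SL2Gen, q m g ∈ TT k :=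
      Submodule.mem_sup_left hI2
    have := sub_mem h3 h2
    simpa using this
  have hne : (∑ m ∈ MS k d, ∑ g : Fin (k+1) → SL2Gen, c m g) ≠ 0 := by
    have h1 : ∀ m ∈ MS k d, ∀ g, c m g = ε * (if c m g = 0 then (0:ℕ) else 1 : ℕ) := by
      intro m hm g
      rcases hc m hm g with h | h
      · simp [h]
      · rw [h, if_neg hε0]; simp
    have h2 : (∑ m ∈ MS k d, ∑ g : Fin (k+1) → SL2Gen, c m g) = ε * ((∑ m ∈ MS k d, ∑ g : Fin (k+1) → SL2Gen, (if c m g = 0 then (0:ℕ) else 1) : ℕ) : ℂ) := by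
      push_cast [Finset.mul_sum]
      refine Finset.sum_congr rfl fun m hm => Finset.sum_congr rfl fun g _ => ?_
      have := h1 m hm g
      push_cast at this
      exact this
    rw [h2]
    apply mul_ne_zero hε0
    rw [Nat.cast_ne_zero]
    intro h3
    rw [Finset.sum_eq_zero_iff] at h3
    have h4 := h3 _ hma
    rw [Finset.sum_eq_zero_iff] at h4
    have h5 := h4 (fun i => (a i).1) (by simp)
    rw [if_neg (by rw [hc1 _ hma _ rfl rfl]; exact hε0)] at h5
    exact one_ne_zero h5
  exact (Submodule.smul_mem_iff _ hne).1 hfin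

theorem TT_mon (k : ℕ) (n : ℕ) : ∀ s, (LC Nv s)^2 < Sq s + n → MvPolynomial.monomial s 1 ∈ TT k := by
  induction n with
  | zero => intro s hs; have := Sq_le s; simp at hs; omega
  | succ n ih =>
    intro s hs
    by_cases h : Adm k s
    · exact Submodule.mem_sup_right (Submodule.subset_span ⟨s, h, rfl⟩)
    · apply TT_step k s h
      intro t h1 h2
      apply ih
      rw [h1]; push_cast at hs; linarith

theorem TT_top (k : ℕ) (p : PolySL2) : p ∈ TT k := by
  induction p using MvPolynomial.induction_on' with
  | monomial s c =>
    have : MvPolynomial.monomial s c = c • (MvPolynomial.monomial s 1 : PolySL2) := by rw [MvPolynomial.smul_monomial]; simp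
    rw [this]
    exact Submodule.smul_mem _ _ (TT_mon k (((LC Nv s)^2 - Sq s).toNat + 1) s (by push_cast; omega))
  | add p q hp hq => exact add_mem hp hq
end PV

namespace PV
set_option linter.unusedSectionVars false
set_option linter.unusedSimpArgs false
set_option linter.unusedVariables false
open Finset

theorem subset_step {k : ℕ} (A B H : Finset (Fin k)) (hAB : Disjoint A B) (hAH : Disjoint A H) (hBH : Disjoint B H)
    (a' b' h' : ℕ) (h1 : a' + b' + h' ≤ k) (h2 : H.card + a' + b' ≤ k) (h3 : A.card + H.card + a' ≤ k) (h4 : B.card + H.card + b' ≤ k) :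
    ∃ A' B' H' : Finset (Fin k), A'.card = a' ∧ B'.card = b' ∧ H'.card = h' ∧ Disjoint A' B' ∧ Disjoint A' H' ∧ Disjoint B' H' ∧
      Disjoint A' A ∧ Disjoint A' H ∧ Disjoint B' B ∧ Disjoint B' H := by
  classical
  suffices h : ∃ A' B' : Finset (Fin k), A'.card = a' ∧ B'.card = b' ∧ Disjoint A' B' ∧ 
      Disjoint A' A ∧ Disjoint A' H ∧ Disjoint B' B ∧ Disjoint B' H by
    obtain ⟨A', B', h5, h6, h7, h8, h9, h10, h11⟩ := h
    have : h' ≤ (A' ∪ B')ᶜ.card := by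
      rw [Finset.card_compl, Fintype.card_fin]
      have := Finset.card_union_le A' B'
      omega
    obtain ⟨H', hH, hc⟩ := Finset.exists_subset_card_eq this
    have hH2 : ∀ x ∈ H', x ∉ A' ∧ x ∉ B' := by
      intro x hx
      have := hH hx
      simp at this; exact this
    refine ⟨A', B', H', h5, h6, hc, h7, ?_, ?_, h8, h9, h10, h11⟩
    · exact Finset.disjoint_right.2 fun x hx => (hH2 x hx).1
    · exact Finset.disjoint_right.2 fun x hx => (hH2 x hx).2
  by_cases hab : a' ≤ B.card
  · obtain ⟨A', hA, hc⟩ := Finset.exists_subset_card_eq hab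
    have : b' ≤ (B ∪ H)ᶜ.card := by
      rw [Finset.card_compl, Fintype.card_fin]
      have := Finset.card_union_le B H
      omega
    obtain ⟨B', hB, hc'⟩ := Finset.exists_subset_card_eq this
    have hB2 : ∀ x ∈ B', x ∉ B ∧ x ∉ H := by
      intro x hx
      have := hB hx
      simp at this; exact this
    refine ⟨A', B', hc, hc', ?_, ?_, ?_, ?_, ?_⟩
    · exact Finset.disjoint_right.2 fun x hx hx' => (hB2 x hx).1 (hA hx')
    · exact (hAB.symm).mono_left hA
    · exact hBH.mono_left hA
    · exact Finset.disjoint_left.2 fun x hx => (hB2 x hx).1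
    · exact Finset.disjoint_left.2 fun x hx => (hB2 x hx).2
  · have hsub : B ⊆ (A ∪ H)ᶜ := by
      intro x hx
      simp only [Finset.mem_compl, Finset.mem_union, not_or]
      exact ⟨fun h => (Finset.disjoint_left.1 hAB h) hx, fun h => (Finset.disjoint_left.1 hBH hx) h⟩
    have : a' ≤ (A ∪ H)ᶜ.card := by
      rw [Finset.card_compl, Fintype.card_fin]
      have := Finset.card_union_le A H
      omega
    obtain ⟨A', hA1, hA2, hc⟩ := Finset.exists_subsuperset_card_eq hsub (by omega) this
    have : b' ≤ (A' ∪ H)ᶜ.card := by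
      rw [Finset.card_compl, Fintype.card_fin]
      have := Finset.card_union_le A' H
      omega
    obtain ⟨B', hB, hc'⟩ := Finset.exists_subset_card_eq this
    have hB2 : ∀ x ∈ B', x ∉ A' ∧ x ∉ H := by
      intro x hx
      have := hB hx
      simp at this; exact this
    have hA3 : ∀ x ∈ A', x ∉ A ∧ x ∉ H := by
      intro x hx
      have := hA2 hx
      simp at this; exact this
    refine ⟨A', B', hc, hc', ?_, ?_, ?_, ?_, ?_⟩
    · exact Finset.disjoint_right.2 fun x hx hx' => (hB2 x hx).1 hx'
    · exact Finset.disjoint_left.2 fun x hx => (hA3 x hx).1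
    · exact Finset.disjoint_left.2 fun x hx => (hA3 x hx).2
    · exact Finset.disjoint_left.2 fun x hx hx' => (hB2 x hx).1 (hA1 hx')
    · exact Finset.disjoint_left.2 fun x hx => (hB2 x hx).2

theorem exists_seq {T : Type*} (P : ℕ → T → Prop) (R : T → T → Prop) (h0 : ∃ t, P 0 t)
    (hs : ∀ m t, P m t → ∃ t', P (m+1) t' ∧ R t t') : ∃ f : ℕ → T, (∀ m, P m (f m)) ∧ ∀ m, R (f m) (f (m+1)) := by
  choose! g hg1 hg2 using hs
  obtain ⟨t0, ht0⟩ := h0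
  let f : ℕ → T := fun m => Nat.rec t0 (fun m t => g m t) m
  have hf : ∀ m, P m (f m) := by
    intro m
    induction m with
    | zero => exact ht0
    | succ m ih => exact hg1 m _ ih
  exact ⟨f, hf, fun m => hg2 m _ (hf m)⟩

def Sep (x y : Var) : Prop := Nv x + 2 ≤ Nv y ∧ (Nv y = Nv x + 2 → (x.1 = .h ∧ y.1 = .h) ∨ (x.1 = .e ∧ y.1 = .f) ∨ (x.1 = .f ∧ y.1 = .e))

theorem exists_S (k : ℕ) (s : Var →₀ ℕ) (hs : Adm k s) : ∃ S : Var → Finset (Fin k), (∀ x, (S x).card = s x) ∧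
    ∀ i x y, i ∈ S x → i ∈ S y → x ≠ y → Nv x ≤ Nv y → Sep x y := by
  have A1 : ∀ m, s (.e, m+1) + s (.f, m) + s (.h, m+1) ≤ k := fun m => hs _ _ _ ⟨m, by simp⟩
  have A2 : ∀ m, s (.e, m+1) + s (.f, m) + s (.h, m) ≤ k := fun m => hs _ _ _ ⟨m, by simp⟩
  have A3 : ∀ m, s (.e, m) + s (.h, m) + s (.e, m+1) ≤ k := fun m => hs _ _ _ ⟨m, by simp⟩
  have A4 : ∀ m, s (.f, m) + s (.h, m+1) + s (.f, m+1) ≤ k := fun m => hs _ _ _ ⟨m, by simp⟩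
  obtain ⟨f, hf1, hf2⟩ := exists_seq (T := Finset (Fin k) × Finset (Fin k) × Finset (Fin k))
    (fun m t => t.1.card = s (.e, m) ∧ t.2.1.card = (if m = 0 then 0 else s (.f, m-1)) ∧ t.2.2.card = s (.h, m) ∧
      Disjoint t.1 t.2.1 ∧ Disjoint t.1 t.2.2 ∧ Disjoint t.2.1 t.2.2)
    (fun t t' => Disjoint t'.1 t.1 ∧ Disjoint t'.1 t.2.2 ∧ Disjoint t'.2.1 t.2.1 ∧ Disjoint t'.2.1 t.2.2)
    (by
      have h3 := A3 0
      obtain ⟨A', B', H', h1, h2, h3, h4, h5, h6, h7⟩ := subset_step (k := k) ∅ ∅ ∅ (by simp) (by simp) (by simp) (s (.e, 0)) 0 (s (.h, 0)) (by omega) (by simp; omega) (by simp; omega) (by simp)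
      exact ⟨(A', B', H'), h1, by simpa using h2, h3, h4, h5, h6⟩)
    (by
      rintro m ⟨A, B, H⟩ ⟨h1, h2, h3, h4, h5, h6⟩
      dsimp only at *
      have a1 := A1 m
      have a2 := A2 m
      have a3 := A3 m
      have a4 : B.card + H.card + s (.f, m) ≤ k := by
        rw [h2, h3]
        rcases m with _ | m
        · simp; omega
        · have := A4 m; simpa using this
      obtain ⟨A', B', H', h1', h2', h3', h4', h5', h6', h7⟩ := subset_step (k := k) A B H h4 h5 h6 (s (.e, m+1)) (s (.f, m)) (s (.h, m+1)) (by omega) (by omega) (by omega) (by omega)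
      exact ⟨(A', B', H'), ⟨h1', by simpa using h2', h3', h4', h5', h6'⟩, h7⟩)
  have dj : ∀ {A B : Finset (Fin k)} {i}, Disjoint A B → i ∈ A → i ∈ B → False := fun h h1 h2 => Finset.disjoint_left.1 h h1 h2
  refine ⟨fun x => match x.1 with
    | .e => (f x.2).1
    | .h => (f x.2).2.2
    | .f => (f (x.2+1)).2.1, ?_, ?_⟩
  · rintro ⟨g, m⟩
    cases g
    · exact (hf1 m).1
    · exact (hf1 m).2.2.1
    · have := (hf1 (m+1)).2.1
      simpa using this
  · rintro i ⟨g, m⟩ ⟨g', m'⟩ hx hy hne hN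
    by_contra hsep
    cases g <;> cases g' <;> simp [Sep, Nv, ta] at hx hy hne hN hsep
    · obtain rfl : m' = m + 1 := by omega
      exact dj (hf2 m).1 hy hx
    · obtain rfl : m' = m := by omega
      exact dj (hf1 m').2.2.2.2.1 hx hy
    · obtain rfl : m = m' + 1 := by omega
      exact dj (hf1 _).2.2.2.1 hx hy
    · obtain rfl : m' = m + 1 := by omega
      exact dj (hf2 m).2.1 hy hx
    · omega
    · obtain rfl : m' = m := by omega
      exact dj (hf2 m').2.2.2 hy hx
    · obtain rfl : m' = m + 1 := by omega
      exact dj (hf1 _).2.2.2.1 hy hx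
    · obtain rfl : m' = m + 1 := by omega
      exact dj (hf1 _).2.2.2.2.2 hx hy
    · obtain rfl : m' = m + 1 := by omega
      exact dj (hf2 _).2.2.1 hy hx

/-- parity compatibility -/
def Par : SL2Gen → ℤ → Prop
  | .e, p => p % 2 = 0
  | .h, _ => True
  | .f, p => p % 2 = 1

theorem exists_chain (C : Finset Var) : (∀ x ∈ C, ∀ y ∈ C, x ≠ y → Nv x ≤ Nv y → Sep x y) → ∃ p : Var → ℤ, 
    (∀ x ∈ C, 0 ≤ p x ∧ p x ≤ Nv x ∧ Par x.1 (p x)) ∧ ∀ x ∈ C, ∀ y ∈ C, Nv x < Nv y → p x < p y ∧ Nv x - p x < Nv y - p y := by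
  classical
  induction C using Finset.induction_on_max_value (f := Nv) with
  | empty => intro _; exact ⟨fun _ => 0, by simp, by simp⟩
  | insert y C hy hmax ih =>
    intro hC
    obtain ⟨p, hp1, hp2⟩ := ih (fun x hx z hz => hC x (by simp [hx]) z (by simp [hz]))
    suffices h : ∃ r : ℤ, 0 ≤ r ∧ r ≤ Nv y ∧ Par y.1 r ∧ ∀ x ∈ C, p x < r ∧ Nv x - p x < Nv y - r by
      obtain ⟨r, hr1, hr2, hr3, hr4⟩ := h
      have hne : ∀ x ∈ C, x ≠ y := fun x hx => by rintro rfl; exact hy hx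
      refine ⟨Function.update p y r, ?_, ?_⟩
      · intro x hx
        rw [Finset.mem_insert] at hx
        rcases hx with rfl | hx
        · rw [Function.update_self]; exact ⟨hr1, hr2, hr3⟩
        · rw [Function.update_of_ne (hne x hx)]; exact hp1 x hx
      · intro x hx z hz hxz
        rw [Finset.mem_insert] at hx hz
        rcases hx with rfl | hx
        · rcases hz with rfl | hz
          · omega
          · have := hmax z hz; omega
        · rw [Function.update_of_ne (hne x hx)]
          rcases hz with rfl | hz
          · rw [Function.update_self]; exact hr4 x hx
          · rw [Function.update_of_ne (hne z hz)]; exact hp2 x hx z hz hxz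
    rcases C.eq_empty_or_nonempty with rfl | hCn
    · obtain ⟨g, m⟩ := y
      cases g
      · exact ⟨0, by simp [Nv, ta, Par]⟩
      · exact ⟨0, by simp [Nv, ta, Par]; omega⟩
      · exact ⟨1, by simp [Nv, ta, Par]; omega⟩
    · obtain ⟨z, hz, hzm⟩ := Finset.exists_max_image C Nv hCn
      have hzy := hC z (by simp [hz]) y (by simp) (by rintro rfl; exact hy hz) (hmax z hz)
      obtain ⟨pz1, pz2, pz3⟩ := hp1 z hz
      suffices h : ∃ r : ℤ, p z < r ∧ Nv z - p z < Nv y - r ∧ Par y.1 r by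
        obtain ⟨r, h1, h2, h3⟩ := h
        refine ⟨r, by omega, by omega, h3, fun x hx => ?_⟩
        by_cases hxz : x = z
        · rw [hxz]; exact ⟨h1, h2⟩
        · have h4 := hC x (by simp [hx]) z (by simp [hz]) hxz (hzm x hx)
          have h5 := hp2 x hx z hz (by have := h4.1; omega)
          omega
      obtain ⟨h1, h2⟩ := hzy
      obtain ⟨g, m⟩ := y
      obtain ⟨g', m'⟩ := z
      by_cases hc : Par g (p (g', m') + 1)
      · exact ⟨p (g', m') + 1, by omega, by omega, hc⟩
      · refine ⟨p (g', m') + 2, by omega, ?_, ?_⟩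
        · have : Nv (g, m) ≠ Nv (g', m') + 2 := by
            intro h
            rcases h2 h with ⟨rfl, rfl⟩ | ⟨rfl, rfl⟩ | ⟨rfl, rfl⟩ <;> simp [Par] at hc pz3 <;> omega
          omega
        · cases g <;> simp [Par] at hc ⊢ <;> omega

/-- the pairing data -/
theorem exists_pairing (k : ℕ) (s : Var →₀ ℕ) (hs : Adm k s) : ∃ (n : ℕ) (a : Fin n → Var) (p q : Fin n → ℤ) (c : Fin n → Fin k),
    fs a = s ∧ (∀ i, 0 ≤ p i ∧ 0 ≤ q i ∧ p i + q i = Nv (a i) ∧ Par (a i).1 (p i)) ∧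
    ∀ i j, i ≠ j → c i = c j → (p i < p j ∧ q i < q j) ∨ (p j < p i ∧ q j < q i) := by
  classical
  obtain ⟨S, hS1, hS2⟩ := exists_S k s hs
  let C : Fin k → Finset Var := fun i => s.support.filter (fun x => i ∈ S x)
  have hC : ∀ i x, i ∈ S x → x ∈ C i := by
    intro i x hx
    simp only [C, Finset.mem_filter, Finsupp.mem_support_iff, hx, and_true]
    rw [← hS1, Finset.card_ne_zero]; exact ⟨i, hx⟩
  have hC' : ∀ i x, x ∈ C i → i ∈ S x := by
    intro i x hx
    simp only [C, Finset.mem_filter] at hx; exact hx.2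
  have := fun i => exists_chain (C i) (fun x hx y hy => hS2 i x y (hC' _ _ hx) (hC' _ _ hy))
  choose P hP1 hP2 using this
  let I := Σ x : s.support, {i // i ∈ S x.1}
  let eqv : Fin (Fintype.card I) ≃ I := (Fintype.equivFin I).symm
  refine ⟨Fintype.card I, fun i => (eqv i).1.1, fun i => P (eqv i).2.1 (eqv i).1.1, fun i => Nv (eqv i).1.1 - P (eqv i).2.1 (eqv i).1.1, fun i => (eqv i).2.1, ?_, ?_, ?_⟩
  · unfold fs
    rw [Equiv.sum_comp eqv (fun z : I => Finsupp.single z.1.1 1), Fintype.sum_sigma]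
    simp only [Finset.sum_const, Finset.card_univ, Fintype.card_coe, Finsupp.smul_single, smul_eq_mul, mul_one, hS1]
    rw [Finset.sum_coe_sort s.support (fun x => Finsupp.single x (s x))]
    exact s.sum_single
  · intro i
    obtain ⟨h1, h2, h3⟩ := hP1 _ _ (hC _ _ (eqv i).2.2)
    exact ⟨h1, by show 0 ≤ Nv _ - P _ _; omega, by dsimp only; ring, h3⟩
  · intro i j hij hc
    dsimp only at hc ⊢
    have hx := (eqv i).2.2
    have hy := (eqv j).2.2
    have hne : (eqv i).1.1 ≠ (eqv j).1.1 := by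
      intro h
      apply hij
      apply eqv.injective
      rcases h1 : eqv i with ⟨⟨x, hx⟩, ⟨a, ha⟩⟩
      rcases h2 : eqv j with ⟨⟨y, hy⟩, ⟨b, hb⟩⟩
      rw [h1, h2] at h hc
      dsimp only at h hc
      subst h hc; rfl
    rw [← hc] at hy ⊢
    rcases lt_trichotomy (Nv (eqv i).1.1) (Nv (eqv j).1.1) with h | h | h
    · left; exact hP2 _ _ (hC _ _ hx) _ (hC _ _ hy) h
    · exfalso
      have := (hS2 _ _ _ hx hy hne h.le).1
      omega
    · right; exact hP2 _ _ (hC _ _ hy) _ (hC _ _ hx) h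
end PV

namespace PV
set_option linter.unusedSectionVars false
set_option linter.unusedSimpArgs false
set_option linter.unusedVariables false
open Finset

theorem gl_sn {R : Type*} [Ring R] [Algebra ℂ R] (c : ℂ) (x : R) : c • (-x) = (-c) • x := by rw [smul_neg, neg_smul]

section Cre
variable {k : ℕ}

abbrev Tr (k : ℕ) := ℕ × ℕ × Fin k

def vr (t : Tr k) : Var :=
  if (t.1 + t.2.1) % 2 = 1 then (.h, (t.1 + t.2.1) / 2)
  else if t.1 % 2 = 0 then (.e, (t.1 + t.2.1) / 2)
  else (.f, (t.1 + t.2.1) / 2 - 1)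

noncomputable def sgt (t : Tr k) : ℂ := if (t.1 + t.2.1) % 2 = 1 ∧ t.1 % 2 = 1 then -1 else 1

theorem sgt_ne (t : Tr k) : sgt t ≠ 0 := by unfold sgt; split_ifs <;> simp

def cA (t : Tr k) : BB k := bb ((t.1 : ℤ), t.2.2)
def cB (t : Tr k) : BB k := bb (-1 - (t.2.1 : ℤ), t.2.2)

theorem vr_Nv (t : Tr k) : Nv (vr t) = t.1 + t.2.1 := by
  unfold vr
  split_ifs <;> simp [Nv, ta] <;> omega

theorem vr_iff (t : Tr k) (x : Var) : vr t = x ↔ ((t.1:ℤ) + t.2.1 = Nv x ∧ Par x.1 t.1) := by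
  obtain ⟨g, m⟩ := x
  unfold vr
  cases g <;> split_ifs <;> simp [Nv, ta, Par] <;> omega

def prs (x : Var) : Finset (Tr k) := ((range (2 * x.2 + 3)) ×ˢ ((range (2 * x.2 + 3)) ×ˢ univ)).filter (fun t => vr t = x)

theorem mem_prs (t : Tr k) (x : Var) : t ∈ prs x ↔ vr t = x := by
  unfold prs
  rw [mem_filter]
  refine ⟨fun h => h.2, fun h => ⟨?_, h⟩⟩
  have := vr_Nv t
  rw [h] at this
  obtain ⟨g, m⟩ := x
  simp only [mem_product, mem_range, mem_univ, and_true]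
  cases g <;> simp [Nv, ta] at this <;> constructor <;> omega

noncomputable def tau (t : Tr k) : Module.End ℂ (Fk (BB k)) := cr (cA t) * cr (cB t)
noncomputable def Cx (x : Var) : Module.End ℂ (Fk (BB k)) := ∑ t ∈ prs x, sgt t • tau t

theorem Cx_apply (x : Var) (v : Fk (BB k)) : Cx x v = ∑ t ∈ prs x, sgt t • tau t v := by
  unfold Cx
  rw [LinearMap.sum_apply]; rfl

noncomputable def chi : SL2Gen → ℤ → ℂ
  | .e => ev
  | .h => sn
  | .f => od

theorem Xv_FX (x : Var) : Xv (FX k) x = G (-1 - Nv x) (chi x.1) := by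
  obtain ⟨g, m⟩ := x
  cases g <;> simp only [Xv, FX, chi, Nv, ta] <;> congr 1 <;> ring

theorem chi_sgt (t : Tr k) : chi (vr t).1 t.1 = sgt t := by
  unfold vr sgt
  by_cases h1 : (t.1 + t.2.1) % 2 = 1 <;> by_cases h2 : t.1 % 2 = 0 <;>
    simp [h1, h2, chi, ev, sn, od, Nat.even_iff]

theorem chi_zero (g : SL2Gen) (p : ℤ) (h : ¬ Par g p) : chi g p = 0 := by
  cases g <;> simp [Par, chi, ev, sn, od, Int.even_iff] at h ⊢ <;> omega

theorem term_cre (t : Tr k) : term (-1 - Nv (vr t)) (chi (vr t).1) ((t.1:ℤ), t.2.2) = sgt t • tau t := by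
  unfold term tau u us sh
  rw [vr_Nv, chi_sgt]
  dsimp only
  rw [if_pos (by omega), if_pos (by omega), if_neg (by omega)]
  have : (t.1:ℤ) + (-1 - (t.1 + t.2.1)) = -1 - (t.2.1:ℤ) := by ring
  rw [this]; rfl

theorem FX_split (x : Var) (v : Fk (BB k)) : ∃ T1 : Finset (ℤ × Fin k), (∀ b ∈ T1, ¬ (0 ≤ b.1 ∧ b.1 ≤ Nv x)) ∧
    Xv (FX k) x v = Cx x v + ∑ b ∈ T1, term (-1 - Nv x) (chi x.1) b v := by
  classical
  obtain ⟨T0, hT0⟩ := G_ev (-1 - Nv x) (chi x.1) v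
  let T := T0 ∪ (prs x).image (fun t : Tr k => ((t.1:ℤ), t.2.2))
  refine ⟨T.filter (fun b => ¬ (0 ≤ b.1 ∧ b.1 ≤ Nv x)), fun b hb => (mem_filter.1 hb).2, ?_⟩
  rw [Xv_FX, hT0 T subset_union_left, ← Finset.sum_filter_add_sum_filter_not T (fun b => (0 ≤ b.1 ∧ b.1 ≤ Nv x))]
  congr 1
  rw [Cx_apply]
  symm
  apply Finset.sum_of_injOn (fun t : Tr k => ((t.1:ℤ), t.2.2))
  · intro t ht t' ht' h
    rw [mem_coe, mem_prs] at ht ht'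
    have h1 := vr_Nv t
    have h2 := vr_Nv t'
    rw [ht] at h1
    rw [ht', h1] at h2
    obtain ⟨p, q, i⟩ := t
    obtain ⟨p', q', i'⟩ := t'
    simp at h h2 ⊢
    omega
  · intro t ht
    rw [mem_coe] at ht ⊢
    rw [mem_filter]
    refine ⟨mem_union_right _ (mem_image_of_mem _ ht), ?_⟩
    rw [mem_prs] at ht
    have h1 := vr_Nv t
    rw [ht] at h1
    dsimp only
    omega
  · rintro ⟨p, i⟩ hb hn
    rw [mem_filter] at hb
    obtain ⟨hb, h1, h2⟩ := hb
    dsimp only at h1 h2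
    have : chi x.1 p = 0 := by
      apply chi_zero
      intro hp
      apply hn
      refine ⟨(p.toNat, (Nv x - p).toNat, i), ?_, ?_⟩
      · rw [mem_coe, mem_prs, vr_iff]
        dsimp only
        rw [Int.toNat_of_nonneg h1, Int.toNat_of_nonneg (by omega)]
        exact ⟨by ring, hp⟩
      · dsimp only; rw [Int.toNat_of_nonneg h1]
    unfold term
    dsimp only
    rw [this, zero_smul]; rfl
  · intro t ht
    rw [mem_prs] at ht
    subst ht
    rw [term_cre]; rfl

theorem card_cr_an (b c : BB k) (S : Finset (BB k)) : ∃ (a : ℂ) (T : Finset (BB k)), T.card = S.card ∧ cr b (an c (ket S)) = a • ket T := by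
  rw [an_ket]
  split_ifs with h1
  · rw [map_smul, cr_ket]
    split_ifs with h2
    · exact ⟨0, S, rfl, by simp⟩
    · refine ⟨_, insert b (S.erase c), ?_, (smul_smul _ _ _)⟩
      rw [card_insert_of_notMem h2, card_erase_of_mem h1]
      have := Finset.card_pos.2 ⟨c, h1⟩
      omega
  · exact ⟨0, S, rfl, by simp⟩

theorem term_non {r : ℤ} (hr : r < 0) (χ : ℤ → ℂ) (b : ℤ × Fin k) (hb : ¬ (0 ≤ b.1 ∧ b.1 ≤ -1 - r)) : 
    ∃ (a : ℂ) (b1 b2 : ℤ × Fin k), (0 ≤ b.1 → b2 = sh r b ∧ 0 ≤ b2.1) ∧ (¬ 0 ≤ b.1 → b2 = b) ∧ term r χ b = a • (cr (bb b1) * an (bb b2)) ∧ (a ≠ 0 → χ b.1 ≠ 0):= by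
  unfold term
  by_cases h : 0 ≤ b.1
  · refine ⟨χ b.1, b, sh r b, fun _ => ⟨rfl, ?_⟩, fun h' => absurd h h', ?_, id⟩
    · unfold sh; dsimp only; omega
    · rw [if_pos h, u, us, if_pos h, if_pos (by unfold sh; dsimp only; omega)]
  · refine ⟨-χ b.1, sh r b, b, fun h' => absurd h' h, fun _ => rfl, ?_, fun h => by simpa using h⟩
    rw [if_neg h, u, us, if_neg h, if_neg (by unfold sh; dsimp only; omega)]
    exact gl_sn (R := Module.End ℂ (Fk (BB k))) _ _

theorem Nv_nonneg (x : Var) : 0 ≤ Nv x := by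
  obtain ⟨g, m⟩ := x
  cases g <;> simp [Nv, ta] <;> positivity

theorem sup_ind {N : Submodule ℂ (Fk (BB k))} {s : Set (Finset (BB k))} (A : Module.End ℂ (Fk (BB k))) (h : ∀ S ∈ s, A (ket S) ∈ N)
    (v : Fk (BB k)) (hv : v ∈ Finsupp.supported ℂ ℂ s) : A v ∈ N := by
  rw [Finsupp.supported_eq_span_single] at hv
  induction hv using Submodule.span_induction with
  | mem v hv => obtain ⟨S, hS, rfl⟩ := hv; exact h S hS
  | zero => rw [map_zero]; exact zero_mem _
  | add x y _ _ hx hy => rw [map_add]; exact add_mem hx hy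
  | smul c x _ hx => rw [map_smul]; exact Submodule.smul_mem _ _ hx

theorem ket_mem {s : Set (Finset (BB k))} {S : Finset (BB k)} (h : S ∈ s) : ket S ∈ Finsupp.supported ℂ ℂ s :=
  Finsupp.single_mem_supported ℂ 1 h

/-- vectors supported on sets of cardinality smaller than `2n` -/
def Ln (k n : ℕ) : Submodule ℂ (Fk (BB k)) := Finsupp.supported ℂ ℂ {S | S.card < 2 * n}

theorem Ln_apply {n : ℕ} {v : Fk (BB k)} (h : v ∈ Ln k n) (S : Finset (BB k)) (hS : 2 * n ≤ S.card) : v S = 0 := by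
  by_contra h0
  have := (Finsupp.mem_supported ℂ v).1 h (Finsupp.mem_support_iff.2 h0)
  simp at this; omega

theorem D_Ln (x : Var) (n : ℕ) (v : Fk (BB k)) (hv : v ∈ Ln k n) : Xv (FX k) x v - Cx x v ∈ Ln k n := by
  refine sup_ind (Xv (FX k) x - Cx x) ?_ v hv
  intro S hS
  obtain ⟨T1, h1, h2⟩ := FX_split x (ket S)
  rw [LinearMap.sub_apply, h2, add_sub_cancel_left]
  refine Submodule.sum_mem _ fun b hb => ?_
  have hN := Nv_nonneg x
  obtain ⟨a, b1, b2, _, _, h3, _⟩ := term_non (r := -1 - Nv x) (by omega) (chi x.1) b (by have := h1 b hb; omega)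
  obtain ⟨a', T, h4, h5⟩ := card_cr_an (bb b1) (bb b2) S
  rw [h3, LinearMap.smul_apply, Module.End.mul_apply, h5]
  refine Submodule.smul_mem _ _ (Submodule.smul_mem _ _ (ket_mem ?_))
  simp only [Set.mem_ofPred_eq] at hS ⊢
  omega

theorem cr_card (b : BB k) (S : Finset (BB k)) : ∃ (a : ℂ) (T : Finset (BB k)), T.card = S.card + 1 ∧ cr b (ket S) = a • ket T ∨ cr b (ket S) = 0 := by
  rw [cr_ket]
  split_ifs with h
  · exact ⟨0, S, Or.inr rfl⟩
  · exact ⟨_, _, Or.inl ⟨card_insert_of_notMem h, rfl⟩⟩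

theorem tau_Ln (t : Tr k) (n : ℕ) (v : Fk (BB k)) (hv : v ∈ Ln k n) : tau t v ∈ Ln k (n+1) := by
  refine sup_ind (tau t) ?_ v hv
  intro S hS
  unfold tau
  rw [Module.End.mul_apply]
  obtain ⟨a, T, h | h⟩ := cr_card (cB t) S
  · obtain ⟨a', T', h' | h'⟩ := cr_card (cA t) T
    · rw [h.2, map_smul, h'.2]
      refine Submodule.smul_mem _ _ (Submodule.smul_mem _ _ (ket_mem ?_))
      simp only [Set.mem_ofPred_eq] at hS ⊢
      omega
    · rw [h.2, map_smul, h', smul_zero]; exact zero_mem _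
  · rw [h, map_zero]; exact zero_mem _

theorem Cx_Ln (x : Var) (n : ℕ) (v : Fk (BB k)) (hv : v ∈ Ln k n) : Cx x v ∈ Ln k (n+1) := by
  rw [Cx_apply]
  exact Submodule.sum_mem _ fun t _ => Submodule.smul_mem _ _ (tau_Ln t n v hv)

theorem Ln_mono {m n : ℕ} (h : m ≤ n) : Ln k m ≤ Ln k n := by
  apply Finsupp.supported_mono
  intro S hS
  simp only [Set.mem_ofPred_eq] at hS ⊢
  omega

noncomputable def Cw (k : ℕ) : List Var → Fk (BB k)
  | [] => vac
  | x :: l => Cx x (Cw k l)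

theorem wd_Ln (l : List Var) : wd (FX k) vac l ∈ Ln k (l.length + 1) ∧ wd (FX k) vac l - Cw k l ∈ Ln k l.length := by
  induction l with
  | nil =>
    refine ⟨ket_mem ?_, ?_⟩
    · simp
    · rw [wd, Cw, sub_self]; exact zero_mem _
  | cons x l ih =>
    have h1 := Cx_Ln x _ _ ih.1
    have h2 := D_Ln x _ _ ih.1
    have h3 := Cx_Ln x _ _ ih.2
    rw [wd, Cw, List.length_cons]
    constructor
    · have := add_mem (Ln_mono (Nat.le_succ _) h2) h1
      rwa [sub_add_cancel] at this
    · have := add_mem h2 h3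
      rwa [map_sub, sub_add_sub_cancel] at this

/-- the e-sector -/
def Ek (k : ℕ) : Submodule ℂ (Fk (BB k)) := Finsupp.supported ℂ ℂ {S | ∀ b ∈ S, (0 ≤ (ofLex b).1 ↔ (ofLex b).1 % 2 = 0)}

theorem e_C (m : ℕ) (v : Fk (BB k)) (hv : v ∈ Ek k) : Xv (FX k) (.e, m) v = Cx (.e, m) v := by
  rw [← sub_eq_zero]
  refine (Submodule.mem_bot ℂ).1 (sup_ind (Xv (FX k) (.e, m) - Cx (.e, m)) ?_ v hv)
  intro S hS
  obtain ⟨T1, h1, h2⟩ := FX_split (.e, m) (ket S)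
  rw [LinearMap.sub_apply, h2, add_sub_cancel_left]
  refine Submodule.sum_mem _ fun b hb => ?_
  have hN := Nv_nonneg (.e, m)
  obtain ⟨a, b1, b2, h4, h5, h3, h6⟩ := term_non (r := -1 - Nv (.e, m)) (by omega) (chi .e) b (by have := h1 b hb; omega)
  rw [h3, LinearMap.smul_apply, Module.End.mul_apply, Submodule.mem_bot]
  by_cases ha : a = 0
  · rw [ha, zero_smul]
  have hev : b.1 % 2 = 0 := by
    have := h6 ha
    simp [chi, ev, Int.even_iff] at this
    omega
  rw [an_ket, if_neg, map_zero, smul_zero]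
  intro hbS
  have h7 := hS _ hbS
  simp only [bb, ofLex_toLex] at h7
  by_cases h : 0 ≤ b.1
  · obtain ⟨h8, h9⟩ := h4 h
    have h10 := h7.1 h9
    rw [h8] at h10
    simp [sh, Nv, ta] at h10
    omega
  · have h8 := h5 h
    rw [h8] at h7
    omega

theorem cr_Ek (b : BB k) (hb : (0 ≤ (ofLex b).1 ↔ (ofLex b).1 % 2 = 0)) (v : Fk (BB k)) (hv : v ∈ Ek k) : cr b v ∈ Ek k := by
  refine sup_ind (cr b) ?_ v hv
  intro S hS
  rw [cr_ket]
  split_ifs with h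
  · exact zero_mem _
  · refine Submodule.smul_mem _ _ (ket_mem ?_)
    intro c hc
    rw [mem_insert] at hc
    rcases hc with rfl | hc
    · exact hb
    · exact hS c hc

theorem Cx_Ek (m : ℕ) (v : Fk (BB k)) (hv : v ∈ Ek k) : Cx (.e, m) v ∈ Ek k := by
  rw [Cx_apply]
  refine Submodule.sum_mem _ fun t ht => Submodule.smul_mem _ _ ?_
  rw [mem_prs, vr_iff] at ht
  simp [Nv, ta, Par] at ht
  refine cr_Ek _ ?_ _ (cr_Ek _ ?_ _ hv)
  · simp [cA, bb]; omega
  · simp [cB, bb]; omega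

theorem wd_e (l : List ℕ) : wd (FX k) vac (l.map fun m => (SL2Gen.e, m)) = Cw k (l.map fun m => (SL2Gen.e, m)) ∧ Cw k (l.map fun m => (SL2Gen.e, m)) ∈ Ek k := by
  induction l with
  | nil => exact ⟨rfl, ket_mem (by simp)⟩
  | cons m l ih =>
    rw [List.map_cons, wd, Cw, ih.1, e_C _ _ ih.2]
    exact ⟨rfl, Cx_Ek _ _ ih.2⟩

/-- product of creation operators on vacuum -/
noncomputable def crs (L : List (Tr k)) : Fk (BB k) := L.foldr (fun t v => tau t v) vac
theorem crs_cons (t : Tr k) (L : List (Tr k)) : crs (t :: L) = tau t (crs L) := rfl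

noncomputable def sgl (L : List (Tr k)) : ℂ := (L.map sgt).prod

def secs (k : ℕ) : List Var → Finset (List (Tr k))
  | [] => {[]}
  | x :: l => (prs x ×ˢ secs k l).map ⟨fun z => z.1 :: z.2, fun z z' h => by simpa [Prod.ext_iff] using h⟩

theorem mem_secs (l : List Var) : ∀ L : List (Tr k), L ∈ secs k l ↔ L.map vr = l := by
  induction l with
  | nil => intro L; simp [secs]
  | cons x l ih =>
    intro L
    rw [secs, mem_map]
    constructor
    · rintro ⟨⟨t, L'⟩, h, rfl⟩
      rw [mem_product, mem_prs, ih] at h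
      show vr t :: L'.map vr = _
      rw [h.1, h.2]
    · intro h
      cases L with
      | nil => simp at h
      | cons t L =>
        rw [List.map_cons, List.cons.injEq] at h
        exact ⟨(t, L), mem_product.2 ⟨(mem_prs _ _).2 h.1, (ih L).2 h.2⟩, rfl⟩

theorem Cw_expand (l : List Var) : Cw k l = ∑ L ∈ secs k l, sgl L • crs L := by
  induction l with
  | nil => rw [Cw, secs, sum_singleton]; simp [sgl, crs]
  | cons x l ih =>
    rw [Cw, secs, sum_map, sum_product, Cx_apply]
    refine sum_congr rfl fun t ht => ?_
    rw [ih, map_sum, smul_sum]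
    refine sum_congr rfl fun L hL => ?_
    show _ = sgl (t :: L) • crs (t :: L)
    rw [map_smul, smul_smul]
    simp only [crs_cons, sgl, List.map_cons, List.prod_cons]
end Cre
end PV

namespace PV
set_option linter.unusedSectionVars false
set_option linter.unusedSimpArgs false
set_option linter.unusedVariables false
open Finset

theorem perm_id {ι : Type*} [Fintype ι] (P : ι → ℤ) (hP : Function.Injective P) (ρ : Equiv.Perm ι)
    (h : ∀ i j, P i < P j → P (ρ i) < P (ρ j)) : ρ = 1 := by
  let : LinearOrder ι := LinearOrder.lift' P hP
  have hs : StrictMono ρ := fun i j hij => h i j hij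
  let e : ι ≃o ι := ⟨ρ, hs.le_iff_le⟩
  have he : e = OrderIso.refl ι := Subsingleton.elim _ _
  ext i
  exact congrArg (fun f : ι ≃o ι => f i) he

theorem rearr_strict {ι : Type*} [Fintype ι] (P Q : ι → ℤ) (h : ∀ i j, i ≠ j → (P i < P j ∧ Q i < Q j) ∨ (P j < P i ∧ Q j < Q i))
    (ρ : Equiv.Perm ι) : ∑ i, P i * Q (ρ i) ≤ ∑ i, P i * Q i ∧ (∑ i, P i * Q (ρ i) = ∑ i, P i * Q i → ρ = 1) := by
  have hm : Monovary P Q := by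
    intro i j hij
    have hne : i ≠ j := by rintro rfl; omega
    have := h i j hne
    omega
  refine ⟨hm.sum_mul_comp_perm_le_sum_mul, fun he => ?_⟩
  have hm' := hm.sum_mul_comp_perm_eq_sum_mul_iff.1 he
  apply perm_id P
  · intro i j hij
    by_contra hne
    have := h i j hne
    omega
  · intro i j hij
    have hne : i ≠ j := by rintro rfl; omega
    have h1 := h (ρ i) (ρ j) (ρ.injective.ne hne)
    have h2 := hm' (i := j) (j := i)
    simp only [Function.comp] at h2
    omega

theorem rearr {ι : Type*} [Fintype ι] (p q c : ι → ℤ) (hp : ∀ i, 0 ≤ p i) (hq : ∀ i, 0 ≤ q i)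
    (h : ∀ i j, i ≠ j → c i = c j → (p i < p j ∧ q i < q j) ∨ (p j < p i ∧ q j < q i))
    (ρ : Equiv.Perm ι) (hρ : ∀ i, c (ρ i) = c i) : ∑ i, p i * q (ρ i) ≤ ∑ i, p i * q i ∧ (∑ i, p i * q (ρ i) = ∑ i, p i * q i → ρ = 1) := by
  obtain ⟨K, hK⟩ : ∃ K : ℤ, ∀ i, p i < K ∧ q i < K := by
    refine ⟨1 + ∑ i, p i + ∑ i, q i, fun i => ?_⟩
    have h1 := Finset.single_le_sum (fun i _ => hp i) (mem_univ i)
    have h2 := Finset.single_le_sum (fun i _ => hq i) (mem_univ i)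
    have := hp i
    have := hq i
    constructor <;> omega
  have key := rearr_strict (fun i => p i + K * c i) (fun i => q i + K * c i) (by
    intro i j hij
    obtain ⟨h1, h2⟩ := hK i
    obtain ⟨h3, h4⟩ := hK j
    have := hp i
    have := hq i
    have := hp j
    have := hq j
    rcases lt_trichotomy (c i) (c j) with hc | hc | hc
    · left; constructor <;> nlinarith
    · have := h i j hij hc
      rw [hc]; omega
    · right; constructor <;> nlinarith) ρ
  have e1 : ∑ i, (p i + K * c i) * (q (ρ i) + K * c (ρ i)) = ∑ i, p i * q (ρ i) + (∑ i, (p i + K * c i) * (K * c i) + ∑ i, K * c i * q i) := by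
    have : ∑ i, K * c i * q i = ∑ i, K * c i * q (ρ i) := by
      rw [← Equiv.sum_comp ρ]
      exact sum_congr rfl fun i _ => by rw [hρ]
    rw [this, ← sum_add_distrib, ← sum_add_distrib]
    exact sum_congr rfl fun i _ => by rw [hρ]; ring
  have e2 : ∑ i, (p i + K * c i) * (q i + K * c i) = ∑ i, p i * q i + (∑ i, (p i + K * c i) * (K * c i) + ∑ i, K * c i * q i) := by
    rw [← sum_add_distrib, ← sum_add_distrib]
    exact sum_congr rfl fun i _ => by ring
  rw [e1, e2] at key
  exact ⟨by linarith [key.1], fun he => key.2 (by rw [he])⟩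

theorem exE {α β : Type*} [DecidableEq β] (A B : Finset α) (f : α → β) (hA : Set.InjOn f A) (hB : Set.InjOn f B) (h : A.image f = B.image f) :
    ∃ e : A ≃ B, ∀ a : A, f (e a) = f a := by
  have h1 : ∀ a : A, ∃ b : B, f b = f a := by
    intro a
    have : f a ∈ B.image f := h ▸ mem_image_of_mem f a.2
    obtain ⟨b, hb, hb'⟩ := mem_image.1 this
    exact ⟨⟨b, hb⟩, hb'⟩
  choose g hg using h1
  refine ⟨Equiv.ofBijective g ⟨?_, ?_⟩, hg⟩
  · intro a a' haa
    have : f a = f a' := by rw [← hg, ← hg, haa]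
    exact Subtype.ext (hA a.2 a'.2 this)
  · intro b
    have : f b ∈ A.image f := h ▸ mem_image_of_mem f b.2
    obtain ⟨a, ha, ha'⟩ := mem_image.1 this
    refine ⟨⟨a, ha⟩, Subtype.ext (hB (g _).2 b.2 ?_)⟩
    rw [hg, ha']

theorem ofFn_fs : ∀ {n : ℕ} (a : Fin n → Var), Multiset.toFinsupp ((List.ofFn a : List Var) : Multiset Var) = ∑ i, Finsupp.single (a i) 1
  | 0, a => by simp
  | n+1, a => by
    rw [List.ofFn_succ, ← Multiset.cons_coe, ← Multiset.singleton_add, map_add, ofFn_fs, Fin.sum_univ_succ, Multiset.toFinsupp_singleton]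

section Co
variable {k : ℕ}

theorem cA_eq {t t' : Tr k} : cA t = cA t' ↔ t.1 = t'.1 ∧ t.2.2 = t'.2.2 := by
  unfold cA; rw [bb_inj, Prod.ext_iff]; simp
theorem cB_eq {t t' : Tr k} : cB t = cB t' ↔ t.2.1 = t'.2.1 ∧ t.2.2 = t'.2.2 := by
  unfold cB; rw [bb_inj, Prod.ext_iff]; simp
theorem cA_cB {t t' : Tr k} : cA t ≠ cB t' := by
  unfold cA cB; rw [Ne, bb_inj, Prod.ext_iff]; simp; omega

def Cm (t t' : Tr k) : Prop := t.2.2 = t'.2.2 → (t.1 < t'.1 ∧ t.2.1 < t'.2.1) ∨ (t'.1 < t.1 ∧ t'.2.1 < t.2.1)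

theorem core (A B : Finset (Tr k)) (hA1 : Set.InjOn cA (A : Set (Tr k))) (hA2 : Set.InjOn cB (A : Set (Tr k)))
    (hB1 : Set.InjOn cA (B : Set (Tr k))) (hB2 : Set.InjOn cB (B : Set (Tr k)))
    (h1 : A.image cA = B.image cA) (h2 : A.image cB = B.image cB) (hC : ∀ t ∈ B, ∀ t' ∈ B, t ≠ t' → Cm t t') :
    ∑ t ∈ A, ((t.1:ℤ) + t.2.1) * ((t.1:ℤ) + t.2.1) ≤ ∑ t ∈ B, ((t.1:ℤ) + t.2.1) * ((t.1:ℤ) + t.2.1) ∧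
    (∑ t ∈ A, ((t.1:ℤ) + t.2.1) * ((t.1:ℤ) + t.2.1) = ∑ t ∈ B, ((t.1:ℤ) + t.2.1) * ((t.1:ℤ) + t.2.1) → A = B) := by
  obtain ⟨α, hα⟩ := exE A B cA hA1 hB1 h1
  obtain ⟨β, hβ⟩ := exE A B cB hA2 hB2 h2
  let ρ : Equiv.Perm B := α.symm.trans β
  have hβ' : ∀ a, β a = ρ (α a) := fun a => by simp [ρ]
  have hp : ∀ a, (a.1.1 : ℤ) = ((α a).1.1 : ℤ) := fun a => by rw [(cA_eq.1 (hα a)).1]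
  have hq : ∀ a, (a.1.2.1 : ℤ) = ((ρ (α a)).1.2.1 : ℤ) := fun a => by rw [← hβ', (cB_eq.1 (hβ a)).1]
  have hc : ∀ b : B, ((ρ b).1.2.2 : ℕ) = (b.1.2.2 : ℕ) := by
    intro b
    obtain ⟨a, rfl⟩ := α.surjective b
    rw [← hβ', (cB_eq.1 (hβ a)).2, (cA_eq.1 (hα a)).2]
  have e1 : ∑ t ∈ A, ((t.1:ℤ) + t.2.1) * ((t.1:ℤ) + t.2.1) = ∑ b : B, ((b.1.1 : ℤ) + ((ρ b).1.2.1 : ℤ)) * ((b.1.1 : ℤ) + ((ρ b).1.2.1 : ℤ)) := by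
    rw [← Finset.sum_coe_sort A, ← Equiv.sum_comp α]
    exact sum_congr rfl fun a _ => by rw [← hp, ← hq]
  have e2 : ∑ b : B, ((b.1.1 : ℤ) + ((ρ b).1.2.1 : ℤ)) * ((b.1.1 : ℤ) + ((ρ b).1.2.1 : ℤ)) = 
      2 * ∑ b : B, (b.1.1 : ℤ) * ((ρ b).1.2.1 : ℤ) + (∑ b : B, (b.1.1 : ℤ) * b.1.1 + ∑ b : B, (b.1.2.1 : ℤ) * b.1.2.1) := by
    rw [← Equiv.sum_comp ρ (fun b : B => (b.1.2.1 : ℤ) * b.1.2.1), mul_sum, ← sum_add_distrib, ← sum_add_distrib]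
    exact sum_congr rfl fun b _ => by ring
  have e3 : ∑ t ∈ B, ((t.1:ℤ) + t.2.1) * ((t.1:ℤ) + t.2.1) = 
      2 * ∑ b : B, (b.1.1 : ℤ) * (b.1.2.1 : ℤ) + (∑ b : B, (b.1.1 : ℤ) * b.1.1 + ∑ b : B, (b.1.2.1 : ℤ) * b.1.2.1) := by
    rw [← Finset.sum_coe_sort B, mul_sum, ← sum_add_distrib, ← sum_add_distrib]
    exact sum_congr rfl fun b _ => by ring
  have key := rearr (fun b : B => (b.1.1 : ℤ)) (fun b : B => (b.1.2.1 : ℤ)) (fun b : B => ((b.1.2.2 : ℕ) : ℤ)) (fun _ => by positivity) (fun _ => by positivity)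
    (by
      intro i j hij hc
      have := hC i.1 i.2 j.1 j.2 (fun h => hij (Subtype.ext h)) (by ext; exact_mod_cast hc)
      omega) ρ (fun b => by rw [hc])
  rw [e1, e2, e3]
  refine ⟨by linarith [key.1], fun he => ?_⟩
  have hρ := key.2 (by linarith)
  have hval : ∀ a, (α a).1 = a.1 := by
    intro a
    have h3 := cA_eq.1 (hα a)
    have h4 := cB_eq.1 (hβ a)
    rw [hβ', hρ, Equiv.Perm.one_apply] at h4
    exact Prod.ext h3.1 (Prod.ext h4.1 h3.2)
  ext t
  constructor
  · intro ht
    have := hval ⟨t, ht⟩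
    rw [← show (α ⟨t, ht⟩).1 = t from this]
    exact (α ⟨t, ht⟩).2
  · intro ht
    have := hval (α.symm ⟨t, ht⟩)
    rw [Equiv.apply_symm_apply] at this
    rw [show t = _ from this]
    exact (α.symm ⟨t, ht⟩).2

def cs (L : List (Tr k)) : List (BB k) := L.flatMap (fun t => [cA t, cB t])

theorem cs_cons (t : Tr k) (L : List (Tr k)) : cs (t :: L) = cA t :: cB t :: cs L := by simp [cs]

theorem mem_cs (L : List (Tr k)) (b : BB k) : b ∈ cs L ↔ ∃ t ∈ L, b = cA t ∨ b = cB t := by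
  simp [cs, List.mem_flatMap]

noncomputable def fo (K : List (BB k)) : Fk (BB k) := K.foldr (fun b v => cr b v) vac

theorem crs_fo (L : List (Tr k)) : crs L = fo (cs L) := by
  induction L with
  | nil => rfl
  | cons t L ih => rw [crs_cons, cs_cons, ih]; rfl

theorem fo_val (K : List (BB k)) : (K.Nodup → ∃ ε : ℂ, ε ≠ 0 ∧ fo K = ε • ket K.toFinset) ∧ (¬ K.Nodup → fo K = 0) := by
  induction K with
  | nil => exact ⟨fun _ => ⟨1, one_ne_zero, by simp [fo, vac]⟩, fun h => by simp at h⟩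
  | cons b K ih =>
    have e : fo (b :: K) = cr b (fo K) := rfl
    rw [List.nodup_cons]
    by_cases hK : K.Nodup
    · obtain ⟨ε, h1, h2⟩ := ih.1 hK
      rw [e, h2, map_smul, cr_ket]
      by_cases hb : b ∈ K
      · rw [if_pos (List.mem_toFinset.2 hb), smul_zero]
        exact ⟨fun h => absurd hb h.1, fun _ => rfl⟩
      · rw [if_neg (fun h => hb (List.mem_toFinset.1 h)), smul_smul]
        exact ⟨fun h => ⟨_, mul_ne_zero h1 (sg_ne _ _), by rw [List.toFinset_cons]⟩, fun h => absurd ⟨hb, hK⟩ h⟩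
    · rw [e, ih.2 hK, map_zero]
      exact ⟨fun h => absurd h.2 hK, fun _ => rfl⟩

theorem crs_coeff (L : List (Tr k)) (S : Finset (BB k)) : crs L S ≠ 0 ↔ (cs L).Nodup ∧ (cs L).toFinset = S := by
  rw [crs_fo]
  by_cases h : (cs L).Nodup
  · obtain ⟨ε, h1, h2⟩ := (fo_val _).1 h
    rw [h2, Finsupp.smul_apply, ket_apply]
    by_cases h3 : (cs L).toFinset = S
    · simp [h, h3, h1]
    · simp [h3]
  · rw [(fo_val _).2 h]
    simp [h]

theorem cs_inj (L : List (Tr k)) (h : (cs L).Nodup) : L.Nodup ∧ Set.InjOn cA (L.toFinset : Set (Tr k)) ∧ Set.InjOn cB (L.toFinset : Set (Tr k)) := by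
  unfold cs at h
  rw [List.nodup_flatMap] at h
  have h2 := h.2
  have hd : ∀ t ∈ L, ∀ t' ∈ L, t ≠ t' → List.Disjoint [cA t, cB t] [cA t', cB t'] := by
    have : Std.Symm (Function.onFun List.Disjoint fun t : Tr k => [cA t, cB t]) := ⟨fun a b h => h.symm⟩
    intro t ht t' ht' hne
    exact h2.forall ht ht' hne
  refine ⟨?_, ?_, ?_⟩
  · refine h2.imp ?_
    rintro a b hab rfl
    exact hab (a := cA a) (by simp) (by simp)
  · intro t ht t' ht' he
    by_contra hne
    exact hd t (by simpa using ht) t' (by simpa using ht') hne (a := cA t) (by simp) (by simp [he])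
  · intro t ht t' ht' he
    by_contra hne
    exact hd t (by simpa using ht) t' (by simpa using ht') hne (a := cB t) (by simp) (by simp [he])

theorem cs_nodup (M : List (Tr k)) (h : M.Pairwise Cm) : (cs M).Nodup := by
  unfold cs
  rw [List.nodup_flatMap]
  refine ⟨fun t _ => by simp [cA_cB], h.imp ?_⟩
  intro a b hab c hc hc'
  unfold Cm at hab
  simp only [List.mem_cons, List.not_mem_nil, or_false] at hc hc'
  rcases hc with rfl | rfl
  · rcases hc' with h | h
    · have := cA_eq.1 h
      have := hab this.2
      omega
    · exact cA_cB h
  · rcases hc' with h | h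
    · exact cA_cB h.symm
    · have := cB_eq.1 h
      have := hab this.2
      omega

def SL (L : List (Tr k)) : ℤ := (L.map fun t => ((t.1:ℤ) + t.2.1) * ((t.1:ℤ) + t.2.1)).sum

theorem SL_fin (L : List (Tr k)) (h : L.Nodup) : SL L = ∑ t ∈ L.toFinset, ((t.1:ℤ) + t.2.1) * ((t.1:ℤ) + t.2.1) := by
  rw [List.sum_toFinset _ h]; rfl

theorem im_A (L M : List (Tr k)) (h : (cs L).toFinset = (cs M).toFinset) : L.toFinset.image cA ⊆ M.toFinset.image cA ∧ L.toFinset.image cB ⊆ M.toFinset.image cB := by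
  constructor
  · intro b hb
    obtain ⟨t, ht, rfl⟩ := mem_image.1 hb
    have : cA t ∈ (cs M).toFinset := by
      rw [← h, List.mem_toFinset, mem_cs]; exact ⟨t, List.mem_toFinset.1 ht, Or.inl rfl⟩
    rw [List.mem_toFinset, mem_cs] at this
    obtain ⟨t', ht', h' | h'⟩ := this
    · rw [h']; exact mem_image_of_mem _ (List.mem_toFinset.2 ht')
    · exact absurd h' cA_cB
  · intro b hb
    obtain ⟨t, ht, rfl⟩ := mem_image.1 hb
    have : cB t ∈ (cs M).toFinset := by
      rw [← h, List.mem_toFinset, mem_cs]; exact ⟨t, List.mem_toFinset.1 ht, Or.inr rfl⟩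
    rw [List.mem_toFinset, mem_cs] at this
    obtain ⟨t', ht', h' | h'⟩ := this
    · exact absurd h'.symm cA_cB
    · rw [h']; exact mem_image_of_mem _ (List.mem_toFinset.2 ht')

theorem SL_max (L M : List (Tr k)) (hM : M.Pairwise Cm) (hL : (cs L).Nodup) (h : (cs L).toFinset = (cs M).toFinset) :
    SL L ≤ SL M ∧ (SL L = SL M → L.Perm M) := by
  obtain ⟨l1, l2, l3⟩ := cs_inj L hL
  obtain ⟨m1, m2, m3⟩ := cs_inj M (cs_nodup M hM)
  have h1 := im_A L M h
  have h2 := im_A M L h.symm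
  have := core L.toFinset M.toFinset l2 l3 m2 m3 (h1.1.antisymm h2.1) (h1.2.antisymm h2.2) (by
    have : Std.Symm (Cm (k := k)) := ⟨fun a b h h' => (h h'.symm).symm⟩
    intro t ht t' ht' hne
    exact hM.forall (List.mem_toFinset.1 ht) (List.mem_toFinset.1 ht') hne)
  rw [SL_fin L l1, SL_fin M m1]
  exact ⟨this.1, fun he => List.perm_of_nodup_nodup_toFinset_eq l1 m1 (this.2 he)⟩

theorem gl_tau {R : Type*} [Ring R] (a b c d : R) (h1 : a * c + c * a = 0) (h2 : a * d + d * a = 0) (h3 : b * c + c * b = 0) (h4 : b * d + d * b = 0) :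
    (a * b) * (c * d) = (c * d) * (a * b) := by
  have e1 : b * c = - (c * b) := eq_neg_of_add_eq_zero_left h3
  have e2 : a * c = - (c * a) := eq_neg_of_add_eq_zero_left h1
  have e3 : b * d = - (d * b) := eq_neg_of_add_eq_zero_left h4
  have e4 : a * d = - (d * a) := eq_neg_of_add_eq_zero_left h2
  calc (a * b) * (c * d) = a * (b * c) * d := by noncomm_ring
    _ = - (a * c * (b * d)) := by rw [e1]; noncomm_ring
    _ = - (c * (a * d) * b) := by rw [e2, e3]; noncomm_ring
    _ = _ := by rw [e4]; noncomm_ring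

theorem tau_comm (t t' : Tr k) : tau t * tau t' = tau t' * tau t :=
  gl_tau (R := Module.End ℂ (Fk (BB k))) _ _ _ _ (cr_cr _ _) (cr_cr _ _) (cr_cr _ _) (cr_cr _ _)

theorem crs_perm {L L' : List (Tr k)} (h : L.Perm L') : crs L = crs L' := by
  induction h with
  | nil => rfl
  | cons t _ ih => rw [crs_cons, crs_cons, ih]
  | swap t t' L =>
    simp only [crs_cons]
    rw [← Module.End.mul_apply, ← Module.End.mul_apply, tau_comm]
  | trans _ _ h1 h2 => rw [h1, h2]

theorem LC_list (f : Var → ℤ) (l : List Var) : LC f (Multiset.toFinsupp (l : Multiset Var)) = (l.map f).sum := by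
  induction l with
  | nil => simp [LC_zero]
  | cons x l ih =>
    rw [← Multiset.cons_coe, ← Multiset.singleton_add, map_add, LC_add, ih, Multiset.toFinsupp_singleton, LC_single]
    simp

theorem Sq_SL (L : List (Tr k)) : Sq (Multiset.toFinsupp ((L.map vr : List Var) : Multiset Var)) = SL L := by
  unfold Sq SL
  rw [LC_list, List.map_map]
  congr 1
  refine List.map_congr_left fun t _ => ?_
  simp only [Function.comp, vr_Nv]

theorem Cw_coeff (l : List Var) (S : Finset (BB k)) : Cw k l S = ∑ L ∈ secs k l, sgl L * crs L S := by
  rw [Cw_expand, Finsupp.finsetSum_apply]; rfl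

theorem key (s : Var →₀ ℕ) (hs : Adm k s) : ∃ (l0 : List Var) (S0 : Finset (BB k)), 
    Multiset.toFinsupp (l0 : Multiset Var) = s ∧ S0.card = 2 * l0.length ∧ Cw k l0 S0 ≠ 0 ∧ 
    ∀ l : List Var, Cw k l S0 ≠ 0 → Multiset.toFinsupp (l : Multiset Var) = s ∨ Sq (Multiset.toFinsupp (l : Multiset Var)) < Sq s := by
  classical
  obtain ⟨n, a, p, q, c, h1, h2, h3⟩ := exists_pairing k s hs
  let M : List (Tr k) := List.ofFn fun i => ((p i).toNat, (q i).toNat, c i)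
  have hMv : M.map vr = List.ofFn a := by
    rw [List.map_ofFn]
    congr 1
    funext i
    simp only [Function.comp]
    rw [vr_iff]
    obtain ⟨x1, x2, x3, x4⟩ := h2 i
    dsimp only
    rw [Int.toNat_of_nonneg x1, Int.toNat_of_nonneg x2]
    exact ⟨x3, x4⟩
  have hM : M.Pairwise Cm := by
    rw [List.pairwise_ofFn]
    intro i j hij
    have := h3 i j hij.ne
    intro hc
    have := this hc
    have := h2 i
    have := h2 j
    dsimp only
    omega
  have hfs : Multiset.toFinsupp ((List.ofFn a : List Var) : Multiset Var) = s := by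
    rw [← h1]
    unfold fs
    exact ofFn_fs a
  have hfs' := hfs
  rw [← hMv] at hfs'
  have hSq : Sq s = SL M := by rw [← hfs', Sq_SL]
  refine ⟨M.map vr, (cs M).toFinset, hfs', ?_, ?_, ?_⟩
  · rw [List.toFinset_card_of_nodup (cs_nodup M hM), List.length_map]
    simp [cs, List.length_flatMap]; ring
  · have hterm : ∀ L ∈ secs k (M.map vr), sgl L * crs L (cs M).toFinset = if L.Perm M then sgl M * crs M (cs M).toFinset else 0 := by
      intro L hL
      rw [mem_secs] at hL
      split_ifs with hp
      · rw [crs_perm hp]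
        congr 1
        exact (hp.map sgt).prod_eq
      · by_contra h0
        have h4 := (crs_coeff L _).1 (right_ne_zero_of_mul h0)
        refine hp ((SL_max L M hM h4.1 h4.2).2 ?_)
        rw [← Sq_SL, hL, Sq_SL]
    rw [Cw_coeff, sum_congr rfl hterm, ← sum_filter, sum_const, nsmul_eq_mul]
    refine mul_ne_zero ?_ (mul_ne_zero ?_ ?_)
    · rw [Nat.cast_ne_zero, Finset.card_ne_zero]
      exact ⟨M, mem_filter.2 ⟨(mem_secs _ _).2 rfl, List.Perm.refl _⟩⟩
    · unfold sgl
      apply List.prod_ne_zero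
      intro h0
      obtain ⟨t, _, ht⟩ := List.mem_map.1 h0
      exact sgt_ne t ht
    · rw [crs_coeff]; exact ⟨cs_nodup M hM, rfl⟩
  · intro l hl
    rw [Cw_coeff] at hl
    obtain ⟨L, hL, h0⟩ := exists_ne_zero_of_sum_ne_zero hl
    have h4 := (crs_coeff L _).1 (right_ne_zero_of_mul h0)
    have h5 := SL_max L M hM h4.1 h4.2
    rw [mem_secs] at hL
    rw [← hL, Sq_SL, hSq]
    rcases h5.1.lt_or_eq with h6 | h6
    · exact Or.inr h6
    · left
      rw [← hfs', Multiset.coe_eq_coe.2 ((h5.2 h6).map vr)]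
end Co
end PV

namespace PV
set_option linter.unusedSectionVars false
set_option linter.unusedSimpArgs false
set_option linter.unusedVariables false
open Finset

section Van
variable {k : ℕ}

theorem gl_sw {R : Type*} [Ring R] (a b c d : R) (h1 : b * c + c * b = 0) (h2 : b * d + d * b = 0) (h3 : c * d + d * c = 0) :
    (a * b) * (c * d) + (a * d) * (c * b) = 0 := by
  have e1 : b * c = - (c * b) := eq_neg_of_add_eq_zero_left h1
  have e2 : b * d = - (d * b) := eq_neg_of_add_eq_zero_left h2
  have e3 : c * d = - (d * c) := eq_neg_of_add_eq_zero_left h3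
  have : (a * b) * (c * d) = - ((a * d) * (c * b)) := by
    calc (a * b) * (c * d) = a * (b * c) * d := by noncomm_ring
      _ = - (a * c * (b * d)) := by rw [e1]; noncomm_ring
      _ = a * (c * d) * b := by rw [e2]; noncomm_ring
      _ = _ := by rw [e3]; noncomm_ring
  rw [this]; simp

theorem tau_sw (p q p' q' : ℕ) (c : Fin k) : tau (p, q, c) * tau (p', q', c) + tau (p, q', c) * tau (p', q, c) = 0 := 
  gl_sw (R := Module.End ℂ (Fk (BB k))) (cr (cA (p, q, c))) (cr (cB (p, q, c))) (cr (cA (p', q', c))) (cr (cB (p', q', c))) (cr_cr _ _) (cr_cr _ _) (cr_cr _ _)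

def sw {n : ℕ} (i j : Fin n) (F : Fin n → Tr k) : Fin n → Tr k := fun l => ((F l).1, (F (Equiv.swap i j l)).2.1, (F l).2.2)

theorem sw_sw {n : ℕ} (i j : Fin n) (F : Fin n → Tr k) : sw i j (sw i j F) = F := by
  funext l
  simp [sw]

theorem sw_crs {n : ℕ} (i j : Fin n) (hij : i ≠ j) (F : Fin n → Tr k) (hc : (F i).2.2 = (F j).2.2) :
    crs (List.ofFn F) + crs (List.ofFn (sw i j F)) = 0 := by
  classical
  let R := ((List.finRange n).erase i).erase j
  have hnd : ((List.finRange n).erase i).Nodup := (List.nodup_finRange n).erase i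
  have hp : (List.finRange n).Perm (i :: j :: R) := by
    refine (List.perm_cons_erase (List.mem_finRange i)).trans (List.Perm.cons i (List.perm_cons_erase ?_))
    rw [(List.nodup_finRange n).mem_erase_iff]
    exact ⟨hij.symm, List.mem_finRange j⟩
  have hR : R.map (sw i j F) = R.map F := by
    refine List.map_congr_left fun l hl => ?_
    rw [hnd.mem_erase_iff, (List.nodup_finRange n).mem_erase_iff] at hl
    unfold sw
    rw [Equiv.swap_apply_of_ne_of_ne hl.2.1 hl.1]
  rw [List.ofFn_eq_map, List.ofFn_eq_map, crs_perm (hp.map F), crs_perm (hp.map (sw i j F))]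
  simp only [List.map_cons, crs_cons]
  rw [hR]
  have h := tau_sw (F i).1 (F i).2.1 (F j).1 (F j).2.1 (F i).2.2
  have e1 : sw i j F i = ((F i).1, (F j).2.1, (F i).2.2) := by simp [sw]
  have e2 : sw i j F j = ((F j).1, (F i).2.1, (F i).2.2) := by simp [sw, hc]
  have e3 : F j = ((F j).1, (F j).2.1, (F i).2.2) := by rw [hc]
  have h' := LinearMap.congr_fun h (crs (R.map F))
  rw [LinearMap.add_apply, Module.End.mul_apply, Module.End.mul_apply, ← e3, ← e1, ← e2] at h'
  exact h'

theorem secs_ofFn {n : ℕ} (a : Fin n → Var) (g : List (Tr k) → Fk (BB k)) :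
    ∑ L ∈ secs k (List.ofFn a), g L = ∑ F ∈ Fintype.piFinset (fun i => prs (a i)), g (List.ofFn F) := by
  classical
  symm
  refine Finset.sum_bij (fun F _ => List.ofFn F) ?_ ?_ ?_ ?_
  · intro F hF
    rw [Fintype.mem_piFinset] at hF
    rw [mem_secs, List.map_ofFn]
    congr 1
    funext i
    exact (mem_prs _ _).1 (hF i)
  · intro F _ F' _ h
    exact List.ofFn_injective h
  · intro L hL
    rw [mem_secs] at hL
    have hlen : L.length = n := by
      have := congrArg List.length hL
      simpa using this
    subst hlen
    refine ⟨L.get, ?_, List.ofFn_get L⟩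
    rw [Fintype.mem_piFinset]
    intro i
    rw [mem_prs]
    have : List.ofFn (vr ∘ L.get) = List.ofFn a := by
      rw [← hL, ← List.map_ofFn, List.ofFn_get]
    exact congrFun (List.ofFn_injective this) i
  · intros; rfl

def Om (k d : ℕ) : Finset (Fin (k+1) → Tr k) := (MS k d).biUnion fun m => Fintype.piFinset (fun i => prs (SL2Gen.e, m i))

theorem mem_Om (d : ℕ) (F : Fin (k+1) → Tr k) : F ∈ Om k d ↔ (∀ i, (F i).1 % 2 = 0 ∧ (F i).2.1 % 2 = 0) ∧ ∑ i, (F i).1 + ∑ i, (F i).2.1 = 2 * d := by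
  unfold Om
  simp only [mem_biUnion, Fintype.mem_piFinset, mem_prs, vr_iff, Nv, ta, Par, add_zero]
  constructor
  · rintro ⟨m, hm, h⟩
    unfold MS at hm
    rw [mem_filter] at hm
    refine ⟨fun i => by have := h i; omega, ?_⟩
    rw [← hm.2, mul_sum, ← sum_add_distrib]
    exact sum_congr rfl fun i _ => by have := h i; omega
  · rintro ⟨h1, h2⟩
    have h3 : ∑ i, ((F i).1 + (F i).2.1) / 2 = d := by
      have : 2 * ∑ i, ((F i).1 + (F i).2.1) / 2 = 2 * d := by
        rw [← h2, mul_sum, ← sum_add_distrib]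
        exact sum_congr rfl fun i _ => by have := h1 i; omega
      omega
    refine ⟨fun i => ((F i).1 + (F i).2.1) / 2, ?_, fun i => ?_⟩
    · unfold MS
      rw [mem_filter]
      refine ⟨?_, h3⟩
      rw [Fintype.mem_piFinset]
      intro i
      rw [mem_range]
      have := Finset.single_le_sum (f := fun i => ((F i).1 + (F i).2.1) / 2) (fun i _ => Nat.zero_le _) (mem_univ i)
      rw [h3] at this
      exact Nat.lt_succ_of_le this
    · have := h1 i; dsimp only; omega

theorem Om_zero (d : ℕ) : ∑ F ∈ Om k d, crs (List.ofFn F) = 0 := by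
  classical
  have hpig : ∀ c : Fin (k+1) → Fin k, ∃ i j, i ≠ j ∧ c i = c j := fun c =>
    Fintype.exists_ne_map_eq_of_card_lt c (by simp)
  choose I J hne hc using hpig
  let g : (Fin (k+1) → Tr k) → (Fin (k+1) → Tr k) := fun F => sw (I fun l => (F l).2.2) (J fun l => (F l).2.2) F
  have hg : ∀ F, crs (List.ofFn F) + crs (List.ofFn (g F)) = 0 := fun F => sw_crs _ _ (hne _) F (hc fun l => (F l).2.2)
  refine Finset.sum_involution (fun F _ => g F) (fun F _ => hg F) ?_ ?_ ?_
  · intro F _ h0 hF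
    have := hg F
    rw [hF, ← two_smul ℂ] at this
    exact h0 ((smul_eq_zero.1 this).resolve_left two_ne_zero)
  · intro F hF
    rw [mem_Om] at hF ⊢
    refine ⟨fun i => ⟨(hF.1 i).1, (hF.1 _).2⟩, ?_⟩
    rw [← hF.2]
    congr 1
    exact Equiv.sum_comp (Equiv.swap (I fun l => (F l).2.2) (J fun l => (F l).2.2)) (fun l => (F l).2.1)
  · intro F _
    show sw (I fun l => (F l).2.2) (J fun l => (F l).2.2) (sw _ _ F) = F
    exact sw_sw _ _ _

theorem e_vanish (d : ℕ) : ∑ m ∈ MS k d, wd (FX k) vac (List.ofFn fun i => (SL2Gen.e, m i)) = 0 := by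
  classical
  rw [← Om_zero (k := k) d, Om, sum_biUnion]
  · refine sum_congr rfl fun m _ => ?_
    have h1 : (List.ofFn fun i => (SL2Gen.e, m i)) = (List.ofFn m).map fun m => (SL2Gen.e, m) := by
      rw [List.map_ofFn]; rfl
    rw [h1, (wd_e _).1, ← h1, Cw_expand, secs_ofFn]
    refine sum_congr rfl fun F hF => ?_
    rw [Fintype.mem_piFinset] at hF
    have : sgl (List.ofFn F) = 1 := by
      unfold sgl
      apply List.prod_eq_one
      intro x hx
      obtain ⟨t, ht, rfl⟩ := List.mem_map.1 hx
      obtain ⟨i, rfl⟩ := (List.mem_ofFn' _ _).1 ht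
      have := hF i
      rw [mem_prs, vr_iff] at this
      simp [Nv, ta, Par] at this
      unfold sgt
      rw [if_neg (by omega)]
    rw [this, one_smul]
  · intro m _ m' _ hne
    refine Finset.disjoint_left.2 fun F hF hF' => hne ?_
    rw [Fintype.mem_piFinset] at hF hF'
    funext i
    have h1 := (mem_prs _ _).1 (hF i)
    rw [(mem_prs _ _).1 (hF' i)] at h1
    exact (congrArg Prod.snd h1).symm

theorem Cw_Ln (l : List Var) : Cw k l ∈ Ln k (l.length + 1) := by
  induction l with
  | nil => exact ket_mem (by simp)
  | cons x l ih => exact Cx_Ln x _ _ ih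

end Van

section Fin
variable {k : ℕ} {M : Type*} [AddCommGroup M] [Module ℂ M] {X : SL2Gen → ℤ → Module.End ℂ M} {v0 : M}
  {Q : ℕ → ℤ → M →ₗ[ℂ] M}

theorem hgen_of (hX : Rep k X) (h0 : ∀ g (n : ℤ), 0 ≤ n → X g n v0 = 0) (j : M →ₗ[ℂ] Fk (BB k)) (hj : Function.Injective j)
    (hj0 : j v0 = vac) (hjX : ∀ g n v, j (X g n v) = FX k g n (j v)) (d : ℕ) : Rel X v0 (k+1) ((d:ℤ)+(k+1)) (eGen k d) 0 := by
  have hw : ∑ m ∈ MS k d, wd X v0 (List.ofFn fun i => (SL2Gen.e, m i)) = 0 := by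
    apply hj
    rw [map_sum, map_zero, ← e_vanish d]
    refine sum_congr rfl fun m _ => ?_
    rw [wd_map j hjX, hj0]
  rw [← hw]
  have he : eGen k d = ∑ m ∈ MS k d, pm (List.ofFn fun i => (SL2Gen.e, m i)) := by
    unfold eGen MS
    refine sum_congr rfl fun m _ => ?_
    unfold pm
    rw [List.map_ofFn, List.prod_ofFn]; rfl
  rw [he]
  refine Rel.sum _ fun m hm => ?_
  have := Rel_pm hX h0 (List.ofFn fun i => (SL2Gen.e, m i))
  have h1 : (List.ofFn fun i => (SL2Gen.e, m i)).length = k + 1 := by simp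
  have h2 : wt (List.ofFn fun i => (SL2Gen.e, m i)) = (d:ℤ) + (k+1) := by
    unfold MS at hm
    rw [mem_filter] at hm
    unfold wt
    rw [List.map_ofFn, List.sum_ofFn, ← hm.2]
    simp [wtVar, sum_add_distrib]
  rw [h1, h2] at this
  exact this

theorem jPsi (hX : Rep k X) (h0 : ∀ g (n : ℤ), 0 ≤ n → X g n v0 = 0) (hQ : QP X v0 Q) (j : M →ₗ[ℂ] Fk (BB k)) 
    (hj0 : j v0 = vac) (hjX : ∀ g n v, j (X g n v) = FX k g n (j v)) (l : List Var) (S : Finset (BB k)) (hS : 2 * l.length ≤ S.card) :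
    j (Psi X v0 Q (pm l)) S = Cw k l S := by
  have h1 := Psi_pm_sub hX h0 hQ l
  have hW : W X v0 l.length (wt l) ≤ (Ln k l.length).comap j := by
    unfold W
    rw [Submodule.span_le]
    rintro v ⟨l', h2, _, rfl⟩
    show j _ ∈ Ln k l.length
    rw [wd_map j hjX, hj0]
    exact Ln_mono h2 (wd_Ln l').1
  have h2 : j (Psi X v0 Q (pm l) - wd X v0 l) ∈ Ln k l.length := hW h1
  rw [map_sub, wd_map j hjX, hj0] at h2
  have h3 := add_mem h2 (wd_Ln (k := k) l).2
  rw [sub_add_sub_cancel] at h3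
  have h4 := Ln_apply h3 S hS
  rw [Finsupp.sub_apply] at h4
  exact sub_eq_zero.1 h4

theorem ker_le (hX : Rep k X) (h0 : ∀ g (n : ℤ), 0 ≤ n → X g n v0 = 0) (hQ : QP X v0 Q) (j : M →ₗ[ℂ] Fk (BB k)) (hj : Function.Injective j)
    (hj0 : j v0 = vac) (hjX : ∀ g n v, j (X g n v) = FX k g n (j v)) (p : PolySL2) (hp : Psi X v0 Q p = 0) : p ∈ idealSL2 k := by
  classical
  have hT := TT_top k p
  unfold TT at hT
  obtain ⟨a, ha, q, hq, rfl⟩ := Submodule.mem_sup.1 hT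
  have ha' : a ∈ idealSL2 k := ha
  rw [map_add, Psi_I hX h0 hQ (hgen_of hX h0 j hj hj0 hjX) a ha', zero_add] at hp
  suffices hq0 : q = 0 by rw [hq0, add_zero]; exact ha'
  have hadm : ∀ s, ¬ Adm k s → MvPolynomial.coeff s q = 0 := by
    intro s hs
    clear hp hT
    induction hq using Submodule.span_induction with
    | mem x hx =>
      obtain ⟨s', h1, rfl⟩ := hx
      rw [MvPolynomial.coeff_monomial, if_neg]
      rintro rfl; exact hs h1
    | zero => simp
    | add x y _ _ hx hy => rw [MvPolynomial.coeff_add, hx, hy, add_zero]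
    | smul c x _ hx => rw [MvPolynomial.coeff_smul, hx, smul_zero]
  by_contra hne
  have hsup : q.support.Nonempty := by
    rw [Finset.nonempty_iff_ne_empty]; simpa using hne
  let len : (Var →₀ ℕ) → ℕ := fun s => s.toMultiset.toList.length
  obtain ⟨s1, hs1, hmax⟩ := Finset.exists_max_image q.support len hsup
  obtain ⟨s0, hs0, hmin⟩ := Finset.exists_min_image (q.support.filter fun s => len s = len s1) Sq ⟨s1, mem_filter.2 ⟨hs1, rfl⟩⟩
  rw [mem_filter] at hs0
  obtain ⟨l0, S0, h1, h2, h3, h4⟩ := key (k := k) s0 (by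
    by_contra h
    exact MvPolynomial.mem_support_iff.1 hs0.1 (hadm s0 h))
  have hl0 : l0.length = len s0 := by
    simp only [len]
    rw [← h1]; simp
  have hcoef : j (Psi X v0 Q q) S0 = ∑ s ∈ q.support, MvPolynomial.coeff s q * j (Psi X v0 Q (MvPolynomial.monomial s 1)) S0 := by
    conv_lhs => rw [q.as_sum]
    rw [map_sum, map_sum, Finsupp.finsetSum_apply]
    refine sum_congr rfl fun s _ => ?_
    have : MvPolynomial.monomial s (MvPolynomial.coeff s q) = (MvPolynomial.coeff s q) • (MvPolynomial.monomial s 1 : PolySL2) := by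
      rw [MvPolynomial.smul_monomial]; simp
    rw [this, map_smul, map_smul]; rfl
  rw [hp, map_zero, Finsupp.zero_apply, Finset.sum_eq_single s0] at hcoef
  · have hm : (MvPolynomial.monomial s0 1 : PolySL2) = pm l0 := by rw [pm_eq_monomial, h1]
    rw [hm, jPsi hX h0 hQ j hj0 hjX l0 S0 (by omega)] at hcoef
    exact mul_ne_zero (MvPolynomial.mem_support_iff.1 hs0.1) h3 hcoef.symm
  · intro s hs hne'
    rw [monomial_eq_pm, jPsi hX h0 hQ j hj0 hjX _ S0 (by
      have := hmax s hs
      simp only [len] at *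
      omega)]
    by_contra hcon
    have h5 := right_ne_zero_of_mul hcon
    have hfs : Multiset.toFinsupp ((s.toMultiset.toList : List Var) : Multiset Var) = s := by simp
    have h6 := h4 _ h5
    rw [hfs] at h6
    have h7 : Sq s < Sq s0 := h6.resolve_left hne'
    by_cases hlen : len s = len s1
    · have := hmin s (mem_filter.2 ⟨hs, hlen⟩)
      omega
    · have h8 := hmax s hs
      refine h5 (Ln_apply (Cw_Ln _) S0 ?_)
      simp only [len] at *
      omega
  · intro h; exact absurd hs0.1 h

end Fin
end PV

namespace PV
open Finset
theorem final (k : ℕ) 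
    (S : SL2VacuumModule k) :
    ∃ φ : (PolySL2 ⧸ idealSL2 k) ≃ₗ[ℂ] S.V,
      (∀ (p : PolySL2) (d : ℕ), p.IsWeightedHomogeneous wtVar d →
        S.D (φ (Ideal.Quotient.mk (idealSL2 k) p))
          = ((-(d : ℤ) : ℤ) : ℂ) • φ (Ideal.Quotient.mk (idealSL2 k) p)) ∧
      (∀ p : PolySL2,
        φ (Ideal.Quotient.mk (idealSL2 k) (adE p))
          = S.E 0 (φ (Ideal.Quotient.mk (idealSL2 k) p)) ∧
        φ (Ideal.Quotient.mk (idealSL2 k) (adH p))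
          = S.Hh 0 (φ (Ideal.Quotient.mk (idealSL2 k) p)) ∧
        φ (Ideal.Quotient.mk (idealSL2 k) (adF p))
          = S.F 0 (φ (Ideal.Quotient.mk (idealSL2 k) p))) := by
  have hX := VX_rep S
  have h0 := VX_vac S
  obtain ⟨j, hj, hj0, hjX⟩ := exists_j S
  obtain ⟨Q, hQ⟩ := exists_Q hX h0 j hj hjX
  have hgen := hgen_of hX h0 j hj hj0 hjX
  have hs : Function.Surjective (Psi (VX S) S.hwv Q) := by
    rw [← LinearMap.range_eq_top, eq_top_iff, ← V_Wall S]
    exact Psi_surj hX h0 hQ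
  let π : PolySL2 →ₗ[ℂ] (PolySL2 ⧸ idealSL2 k) := (Ideal.Quotient.mkₐ ℂ (idealSL2 k)).toLinearMap
  have hπ : Function.Surjective π := Ideal.Quotient.mk_surjective
  have hker : LinearMap.ker π = LinearMap.ker (Psi (VX S) S.hwv Q) := by
    ext p
    rw [LinearMap.mem_ker, LinearMap.mem_ker]
    constructor
    · intro h
      exact Psi_I hX h0 hQ hgen p (Ideal.Quotient.eq_zero_iff_mem.1 h)
    · intro h
      exact Ideal.Quotient.eq_zero_iff_mem.2 (ker_le hX h0 hQ j hj hj0 hjX p h)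
  let φ : (PolySL2 ⧸ idealSL2 k) ≃ₗ[ℂ] S.V := (π.quotKerEquivOfSurjective hπ).symm ≪≫ₗ
    Submodule.quotEquivOfEq _ _ hker ≪≫ₗ (Psi (VX S) S.hwv Q).quotKerEquivOfSurjective hs
  have hφ : ∀ p, φ (Ideal.Quotient.mk (idealSL2 k) p) = Psi (VX S) S.hwv Q p := by
    intro p
    have h1 : (π.quotKerEquivOfSurjective hπ).symm (Ideal.Quotient.mk (idealSL2 k) p)
        = Submodule.Quotient.mk p := by
      rw [LinearEquiv.symm_apply_eq]; rfl
    simp only [φ, LinearEquiv.trans_apply]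
    rw [h1]; rfl
  refine ⟨φ, fun p d hp => ?_, fun p => ?_⟩
  · rw [hφ]
    exact Psi_D hX h0 hQ S.D (D_wd S) p d hp
  · simp only [hφ]
    exact ⟨Psi_ad hX h0 hQ .e p, Psi_ad hX h0 hQ .h p, Psi_ad hX h0 hQ .f p⟩
end PV

/-- **Theorem (Primc, Theorem 9.1).**  For every positive integer `k`,
`L(kΛ₀) ≅ P/I_{kΛ₀}` as `ℤ`-graded vector spaces and `g`-modules: there is a
linear isomorphism mapping (classes of) weighted-homogeneous polynomials of
weight `d` to vectors of degree `−d` and intertwining the adjoint action of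
`g = sl(2,ℂ)` on `P/I_{kΛ₀}` with the action of `e(0), h(0), f(0)` on
`L(kΛ₀)`. -/
theorem presentation_of_vacuum_sl2_module (k : ℕ) (hk : 0 < k)
    (S : SL2VacuumModule k) :
    ∃ φ : (PolySL2 ⧸ idealSL2 k) ≃ₗ[ℂ] S.V,
      (∀ (p : PolySL2) (d : ℕ), p.IsWeightedHomogeneous wtVar d →
        S.D (φ (Ideal.Quotient.mk (idealSL2 k) p))
          = ((-(d : ℤ) : ℤ) : ℂ) • φ (Ideal.Quotient.mk (idealSL2 k) p)) ∧
      (∀ p : PolySL2,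
        φ (Ideal.Quotient.mk (idealSL2 k) (adE p))
          = S.E 0 (φ (Ideal.Quotient.mk (idealSL2 k) p)) ∧
        φ (Ideal.Quotient.mk (idealSL2 k) (adH p))
          = S.Hh 0 (φ (Ideal.Quotient.mk (idealSL2 k) p)) ∧
        φ (Ideal.Quotient.mk (idealSL2 k) (adF p))
          = S.F 0 (φ (Ideal.Quotient.mk (idealSL2 k) p))) := by
  exact PV.final k S
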